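/- Let ω₀: S → ℝ be nonnegative, bounded and compactly supported on the strip S = ℝ × [0,2π], and let ω(·,t) be the vorticity of the mild solution of the 2D incompressible Navier–Stokes equations on the cylinder with viscosity ν > 0 and initial vorticity ω₀. Then for each ℓ > 0 and α > 1 there exists T(α,ℓ) such that for all t ≥ T(α,ℓ), ∫_{|y1| > sqrt(t (log t)^α)} ω(y,t) dy ≤ t^{−ℓ}. -/

import Mathlib

open MeasureTheory Real

/-- The strip `S = ℝ × [0,2π]`. -/
noncomputable def strip : Set (ℝ × ℝ) := Set.univ ×ˢ Set.Icc 0 (2 * Real.pi)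

/-- The kernel `∂G/∂x₂(x,y)` of the cylindrical Biot–Savart law for the first velocity
component, where `G(x,y) = -(1/2)log(cosh(x₁-y₁) - cos(x₂-y₂))`. -/
noncomputable def K (x y : ℝ × ℝ) : ℝ :=
  -Real.sin (x.2 - y.2) / (2 * (Real.cosh (x.1 - y.1) - Real.cos (x.2 - y.2)))

/-! ### The bump function -/

lemma hasDerivAt_max_pow (n : ℕ) (y : ℝ) :
    HasDerivAt (fun y : ℝ => (max 0 y) ^ (n + 2)) ((n + 2) * (max 0 y) ^ (n + 1)) y := by
  rcases lt_trichotomy y 0 with h | h | h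
  · have : (fun y : ℝ => (max 0 y) ^ (n + 2)) =ᶠ[nhds y] fun _ => 0 := by
      filter_upwards [Iio_mem_nhds h] with z hz
      rw [max_eq_left (le_of_lt hz)]; simp
    rw [max_eq_left h.le]
    simpa using (hasDerivAt_const y (0 : ℝ)).congr_of_eventuallyEq this
  · subst h
    simp only [max_self]
    rw [hasDerivAt_iff_isLittleO_nhds_zero]
    simp only [zero_add, max_self, ne_eq, Nat.add_eq_zero_iff, OfNat.ofNat_ne_zero, and_false,
      not_false_eq_true, zero_pow, sub_zero, one_ne_zero, mul_zero, smul_zero]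
    have h1 : (fun h : ℝ => max 0 h ^ (n + 2)) =O[nhds 0] fun h : ℝ => h ^ (n + 2) := by
      apply Asymptotics.IsBigO.of_bound 1
      filter_upwards with z
      rw [norm_pow, norm_pow, one_mul]
      apply pow_le_pow_left₀ (norm_nonneg _)
      rw [Real.norm_eq_abs, Real.norm_eq_abs, abs_of_nonneg (le_max_left _ _)]
      exact max_le (abs_nonneg _) (le_abs_self _)
    refine h1.trans_isLittleO ?_
    have := Asymptotics.isLittleO_pow_id (𝕜 := ℝ) (n := n + 2) (by omega)
    simpa using this
  · have : (fun y : ℝ => (max 0 y) ^ (n + 2)) =ᶠ[nhds y] fun y => y ^ (n + 2) := by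
      filter_upwards [Ioi_mem_nhds h] with z hz
      rw [max_eq_right (le_of_lt hz)]
    rw [max_eq_right h.le]
    simpa using (hasDerivAt_pow (n + 2) y).congr_of_eventuallyEq this

/-- base of the bump -/
noncomputable def bph (x : ℝ) : ℝ := max 0 (1 - x ^ 2)
/-- the bump -/
noncomputable def bmp (x : ℝ) : ℝ := bph x ^ 4
noncomputable def bmp1 (x : ℝ) : ℝ := -8 * x * bph x ^ 3
noncomputable def bmp2 (x : ℝ) : ℝ := -8 * bph x ^ 3 + 48 * x ^ 2 * bph x ^ 2

lemma bph_nonneg (x : ℝ) : 0 ≤ bph x := le_max_left _ _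
lemma bph_le_one (x : ℝ) : bph x ≤ 1 := max_le zero_le_one (by nlinarith [sq_nonneg x])
lemma bph_cont : Continuous bph := by unfold bph; fun_prop
lemma bph_eq_zero {x : ℝ} (hx : 1 ≤ |x|) : bph x = 0 := by
  unfold bph; apply max_eq_left
  have := sq_abs x
  nlinarith [abs_nonneg x]
lemma bmp_cont : Continuous bmp := bph_cont.pow 4
lemma bmp1_cont : Continuous bmp1 := by unfold bmp1; have := bph_cont; fun_prop
lemma bmp2_cont : Continuous bmp2 := by unfold bmp2; have := bph_cont; fun_prop
lemma bmp_hasDerivAt (x : ℝ) : HasDerivAt bmp (bmp1 x) x := by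
  have h := (hasDerivAt_max_pow 2 (1 - x ^ 2)).comp x (((hasDerivAt_pow 2 x).const_sub 1))
  refine h.congr_deriv ?_
  unfold bmp1 bph; push_cast; ring
lemma bmp1_hasDerivAt (x : ℝ) : HasDerivAt bmp1 (bmp2 x) x := by
  have h := (hasDerivAt_max_pow 1 (1 - x ^ 2)).comp x (((hasDerivAt_pow 2 x).const_sub 1))
  have h2 := (((hasDerivAt_id x).const_mul (-8 : ℝ))).mul h
  refine h2.congr_deriv ?_
  simp only [bmp2, bph, Function.comp, id]; push_cast; ring
lemma abs_le_one_of_bph {x : ℝ} (h : bph x ≠ 0) : |x| ≤ 1 := by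
  by_contra hc; push Not at hc; exact h (bph_eq_zero hc.le)
lemma bmp_nonneg (x : ℝ) : 0 ≤ bmp x := pow_nonneg (bph_nonneg x) 4
lemma bmp_le_one (x : ℝ) : bmp x ≤ 1 := pow_le_one₀ (bph_nonneg x) (bph_le_one x)
lemma bmp1_abs (x : ℝ) : |bmp1 x| ≤ 8 * bph x ^ 2 := by
  by_cases h : bph x = 0
  · simp [bmp1, h]
  have hx := abs_le_one_of_bph h
  have h0 := bph_nonneg x
  have h1 := bph_le_one x
  unfold bmp1
  rw [abs_mul, abs_mul, abs_of_nonneg (pow_nonneg h0 3)]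
  norm_num
  have : |x| * bph x ≤ 1 := mul_le_one₀ hx h0 h1
  nlinarith [pow_nonneg h0 2, pow_nonneg h0 3]
lemma bmp2_abs (x : ℝ) : |bmp2 x| ≤ 56 := by
  by_cases h : bph x = 0
  · simp [bmp2, h]
  have hx := abs_le_one_of_bph h
  have h0 := bph_nonneg x
  have h1 := bph_le_one x
  have h2 : bph x ^ 2 ≤ 1 := pow_le_one₀ h0 h1
  have h3 : bph x ^ 3 ≤ 1 := pow_le_one₀ h0 h1
  have hx2 : x ^ 2 ≤ 1 := by rw [← sq_abs]; exact pow_le_one₀ (abs_nonneg x) hx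
  unfold bmp2
  have h5 : x ^ 2 * bph x ^ 2 ≤ 1 := mul_le_one₀ hx2 (by positivity) h2
  have h6 : 0 ≤ x ^ 2 * bph x ^ 2 := by positivity
  have h7 := pow_nonneg h0 3
  rw [abs_le]; constructor <;> nlinarith

lemma bph_lip (x y : ℝ) (h : |x - y| ≤ bph x / 4) : bph x / 2 ≤ bph y := by
  by_cases h0 : bph x = 0
  · rw [h0]; simpa using bph_nonneg y
  have hx := abs_le_one_of_bph h0
  have hb1 := bph_le_one x
  have hbn := bph_nonneg x
  have hbx : bph x = 1 - x ^ 2 := by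
    unfold bph at *; rcases max_choice 0 (1 - x ^ 2) with h | h <;> simp_all
  have : 1 - y ^ 2 ≤ bph y := le_max_right _ _
  obtain ⟨hx1, hx2⟩ := abs_le.1 hx
  obtain ⟨hd1, hd2⟩ := abs_le.1 h
  have key : |x - y| * |x + y| ≤ bph x / 2 := by
    by_cases hs : |x + y| ≤ 2
    · nlinarith [abs_nonneg (x - y), abs_nonneg (x + y)]
    · -- |x + y| > 2 : use |y| ≥ 1, |x| ≥ 1 - δ
      push Not at hs
      have : |x + y| ≤ 2 * |x| + |x - y| := by
        have : x + y = 2 * x - (x - y) := by ring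
        rw [this]; refine (abs_sub _ _).trans ?_
        rw [abs_mul]; simp
      set d := |x - y|
      have hd0 : 0 ≤ d := abs_nonneg _
      have hbb : bph x ≤ 2 * (1 - |x|) := by
        rw [hbx, ← sq_abs]; nlinarith [abs_nonneg x]
      nlinarith [abs_nonneg x]
  have h2 : y ^ 2 - x ^ 2 ≤ |x - y| * |x + y| := by
    rw [← abs_mul]; have := neg_abs_le ((x - y) * (x + y)); nlinarith
  nlinarith

/-! ### Maximum principle -/

lemma second_deriv_nonpos_of_isLocalMax {f f' : ℝ → ℝ} {f'' x : ℝ} (hm : IsLocalMax f x)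
    (h1 : ∀ y, HasDerivAt f (f' y) y) (h2 : HasDerivAt f' f'' x) : f'' ≤ 0 := by
  by_contra hc
  push Not at hc
  have hd : deriv f = f' := funext fun y => (h1 y).deriv
  have hmin : IsLocalMin f x := by
    apply isLocalMin_of_deriv_deriv_pos
    · rw [hd, h2.deriv]; exact hc
    · exact hm.deriv_eq_zero
    · exact (h1 x).continuousAt
  have hconst : f =ᶠ[nhds x] fun _ => f x := by
    filter_upwards [hm, hmin] with y a b using le_antisymm a b
  have : f' =ᶠ[nhds x] fun _ => 0 := by
    have := hconst.deriv
    rw [hd] at this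
    simpa using this
  have h3 := this.deriv_eq
  rw [h2.deriv] at h3
  simp at h3
  linarith

lemma max_principle {ν B s T Λ m C : ℝ} (hν : 0 ≤ ν) (hB : 0 ≤ B) (hT : s ≤ T)
    (Q Qt Q1 Q11 Q2 Q22 : ℝ → ℝ → ℝ → ℝ)
    (hcont : ContinuousOn (fun p : ℝ × (ℝ × ℝ) => Q p.1 p.2.1 p.2.2)
      (Set.Icc s T ×ˢ Set.univ))
    (hper : ∀ t ∈ Set.Icc s T, ∀ a b, Q t a (b + 2 * π) = Q t a b)
    (hbd : ∀ t ∈ Set.Icc s T, ∀ a b, Q t a b ≤ C)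
    (hinit : ∀ a b, Q s a b ≤ m)
    (ht : ∀ t ∈ Set.Ioc s T, ∀ a b, HasDerivAt (fun t => Q t a b) (Qt t a b) t)
    (h1 : ∀ t ∈ Set.Ioc s T, ∀ a b, HasDerivAt (fun a => Q t a b) (Q1 t a b) a)
    (h11 : ∀ t ∈ Set.Ioc s T, ∀ a b, HasDerivAt (fun a => Q1 t a b) (Q11 t a b) a)
    (h2 : ∀ t ∈ Set.Ioc s T, ∀ a b, HasDerivAt (fun b => Q t a b) (Q2 t a b) b)
    (h22 : ∀ t ∈ Set.Ioc s T, ∀ a b, HasDerivAt (fun b => Q2 t a b) (Q22 t a b) b)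
    (hineq : ∀ t ∈ Set.Ioc s T, ∀ a b, Q2 t a b = 0 → Q22 t a b ≤ 0 →
      Qt t a b ≤ B * |Q1 t a b| + ν * Q11 t a b + Λ) :
    ∀ t ∈ Set.Icc s T, ∀ a b, Q t a b ≤ m + Λ * (t - s) := by
  have key : ∀ ε > 0, ∀ t ∈ Set.Icc s T, ∀ a b,
      Q t a b - (Λ + ε * (B + ν + 1)) * (t - s) - ε * √(1 + a ^ 2) ≤ m := by
    intro ε hε
    set L := Λ + ε * (B + ν + 1) with hL
    set P : ℝ → ℝ → ℝ → ℝ := fun t a b => Q t a b - L * (t - s) - ε * √(1 + a ^ 2) with hP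
    by_contra hcon
    push Not at hcon
    obtain ⟨t0, ht0, a0, b0, h0⟩ := hcon
    obtain ⟨R, hR0, hR⟩ : ∃ R, |a0| ≤ R ∧ C + |L| * (T - s) - ε * R < m := by
      refine ⟨max |a0| ((C + |L| * (T - s) - m) / ε + 1), le_max_left _ _, ?_⟩
      have h := le_max_right |a0| ((C + |L| * (T - s) - m) / ε + 1)
      have h' := mul_le_mul_of_nonneg_left h hε.le
      have : ε * ((C + |L| * (T - s) - m) / ε + 1) = C + |L| * (T - s) - m + ε := by
        field_simp
      linarith
    have hPper : ∀ t ∈ Set.Icc s T, ∀ a, Function.Periodic (P t a) (2 * π) := by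
      intro t htI a b; simp only [hP, hper t htI]
    obtain ⟨c0, hc0, hc0'⟩ := (hPper t0 ht0 a0).exists_mem_Ico₀ (by positivity) b0
    have hPc : ContinuousOn (fun p : ℝ × (ℝ × ℝ) => P p.1 p.2.1 p.2.2)
        (Set.Icc s T ×ˢ (Set.Icc (-R) R ×ˢ Set.Icc 0 (2 * π))) := by
      have h : ContinuousOn (fun p : ℝ × (ℝ × ℝ) => Q p.1 p.2.1 p.2.2)
        (Set.Icc s T ×ˢ (Set.Icc (-R) R ×ˢ Set.Icc 0 (2 * π))) :=
        hcont.mono (Set.prod_mono le_rfl (Set.subset_univ _))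
      refine (h.sub (Continuous.continuousOn (by fun_prop))).sub
        (Continuous.continuousOn (by fun_prop))
    have hcomp : IsCompact (Set.Icc s T ×ˢ (Set.Icc (-R) R ×ˢ Set.Icc 0 (2 * π))) :=
      isCompact_Icc.prod (isCompact_Icc.prod isCompact_Icc)
    have hmem : (t0, (a0, c0)) ∈ Set.Icc s T ×ˢ (Set.Icc (-R) R ×ˢ Set.Icc 0 (2 * π)) :=
      ⟨ht0, abs_le.1 hR0, hc0.1, hc0.2.le⟩
    obtain ⟨⟨t1, a1, b1⟩, hm1, hmax⟩ := hcomp.exists_isMaxOn ⟨_, hmem⟩ hPc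
    have hm1t : t1 ∈ Set.Icc s T := hm1.1
    have hbig : m < P t1 a1 b1 := by
      have h : P t0 a0 c0 ≤ P t1 a1 b1 := hmax hmem
      rw [← hc0'] at h
      exact lt_of_lt_of_le h0 h
    have hglob : ∀ t ∈ Set.Icc s T, ∀ a b, P t a b ≤ P t1 a1 b1 := by
      intro t htt a b
      by_cases ha : |a| ≤ R
      · obtain ⟨c, hc, hc'⟩ := (hPper t htt a).exists_mem_Ico₀ (by positivity) b
        rw [hc']
        have h : (t, (a, c)) ∈ Set.Icc s T ×ˢ (Set.Icc (-R) R ×ˢ Set.Icc 0 (2 * π)) :=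
          ⟨htt, abs_le.1 ha, hc.1, hc.2.le⟩
        exact hmax h
      · push Not at ha
        have e1 := hbd t htt a b
        have e2 : -(L * (t - s)) ≤ |L| * (T - s) := by
          have f1 : -L ≤ |L| := neg_le_abs L
          have f2 := htt.1
          have f3 := htt.2
          have f4 := abs_nonneg L
          nlinarith
        have e3 : R ≤ √(1 + a ^ 2) := by
          refine ha.le.trans (Real.abs_le_sqrt (by linarith))
        have e4 := mul_le_mul_of_nonneg_left e3 hε.le
        simp only [hP] at hbig ⊢
        linarith
    have hts : s < t1 := by
      rcases eq_or_lt_of_le hm1t.1 with h | h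
      · exfalso
        rw [← h] at hbig
        have := hinit a1 b1
        have h5 : 0 ≤ ε * √(1 + a1 ^ 2) := by positivity
        simp only [hP] at hbig
        linarith
      · exact h
    have ht1 : t1 ∈ Set.Ioc s T := ⟨hts, hm1t.2⟩
    -- time derivative
    have hQt : L ≤ Qt t1 a1 b1 := by
      have hd : HasDerivAt (fun t => P t a1 b1) (Qt t1 a1 b1 - L) t1 := by
        have h := ((ht t1 ht1 a1 b1).sub (((hasDerivAt_id t1).sub_const s).const_mul L)).sub_const
          (ε * √(1 + a1 ^ 2))
        refine h.congr_deriv (by ring)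
      have hl := (hasDerivAt_iff_tendsto_slope.1 hd).mono_left
        (nhdsWithin_mono t1 (s := Set.Iio t1) (fun x hx => ne_of_lt hx))
      have : 0 ≤ Qt t1 a1 b1 - L := by
        refine ge_of_tendsto hl ?_
        filter_upwards [Ioo_mem_nhdsLT hts] with t htt
        rw [slope_def_field]
        apply div_nonneg_of_nonpos
        · have := hglob t ⟨htt.1.le, htt.2.le.trans ht1.2⟩ a1 b1
          linarith
        · linarith [htt.2]
      linarith
    -- b derivatives
    have hmb : IsLocalMax (fun b => P t1 a1 b) b1 := Filter.Eventually.of_forall fun b =>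
      hglob t1 hm1t a1 b
    have hdb : ∀ b, HasDerivAt (fun b => P t1 a1 b) (Q2 t1 a1 b) b := fun b =>
      ((h2 t1 ht1 a1 b).sub_const _).sub_const _
    have hQ2 : Q2 t1 a1 b1 = 0 := hmb.hasDerivAt_eq_zero (hdb b1)
    have hQ22 : Q22 t1 a1 b1 ≤ 0 :=
      second_deriv_nonpos_of_isLocalMax hmb hdb (h22 t1 ht1 a1 b1)
    -- a derivatives
    have hma : IsLocalMax (fun a => P t1 a b1) a1 := Filter.Eventually.of_forall fun a =>
      hglob t1 hm1t a b1
    have hsq : ∀ a : ℝ, HasDerivAt (fun a : ℝ => √(1 + a ^ 2)) (a / √(1 + a ^ 2)) a := by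
      intro a
      have hpos : (1 : ℝ) + a ^ 2 ≠ 0 := by positivity
      have h := ((hasDerivAt_pow 2 a).const_add 1).sqrt hpos
      refine h.congr_deriv ?_
      field_simp
      push_cast; ring
    have hda : ∀ a, HasDerivAt (fun a => P t1 a b1) (Q1 t1 a b1 - ε * (a / √(1 + a ^ 2))) a :=
      fun a => ((h1 t1 ht1 a b1).sub_const _).sub ((hsq a).const_mul ε)
    have hs1 : 1 ≤ √(1 + a1 ^ 2) := by
      rw [Real.one_le_sqrt]; nlinarith [sq_nonneg a1]
    have hss : √(1 + a1 ^ 2) ^ 2 = 1 + a1 ^ 2 := Real.sq_sqrt (by positivity)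
    have hsa : |a1| ≤ √(1 + a1 ^ 2) := Real.abs_le_sqrt (by linarith)
    have hQ1 : |Q1 t1 a1 b1| ≤ ε := by
      have h := hma.hasDerivAt_eq_zero (hda a1)
      have : Q1 t1 a1 b1 = ε * (a1 / √(1 + a1 ^ 2)) := by linarith
      rw [this, abs_mul, abs_div, abs_of_pos hε, abs_of_pos (by linarith : 0 < √(1 + a1 ^ 2))]
      have : |a1| / √(1 + a1 ^ 2) ≤ 1 := (div_le_one (by linarith)).2 hsa
      nlinarith
    have hQ11 : Q11 t1 a1 b1 ≤ ε := by
      have hd2 : HasDerivAt (fun a => Q1 t1 a b1 - ε * (a / √(1 + a ^ 2)))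
          (Q11 t1 a1 b1 - ε * ((1 * √(1 + a1 ^ 2) - a1 * (a1 / √(1 + a1 ^ 2)))
            / √(1 + a1 ^ 2) ^ 2)) a1 :=
        (h11 t1 ht1 a1 b1).sub (((hasDerivAt_id a1).div (hsq a1) (by linarith)).const_mul ε)
      have h := second_deriv_nonpos_of_isLocalMax hma hda hd2
      have : (1 * √(1 + a1 ^ 2) - a1 * (a1 / √(1 + a1 ^ 2))) / √(1 + a1 ^ 2) ^ 2 ≤ 1 := by
        rw [div_le_one (by positivity)]
        have : 0 ≤ a1 * (a1 / √(1 + a1 ^ 2)) := by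
          rw [← mul_div_assoc]; exact div_nonneg (mul_self_nonneg _) (Real.sqrt_nonneg _)
        nlinarith
      nlinarith
    have := hineq t1 ht1 a1 b1 hQ2 hQ22
    have e1 : B * |Q1 t1 a1 b1| ≤ B * ε := mul_le_mul_of_nonneg_left hQ1 hB
    have e2 : ν * Q11 t1 a1 b1 ≤ ν * ε := mul_le_mul_of_nonneg_left hQ11 hν
    simp only [hL] at hQt
    nlinarith
  intro t htt a b
  refine le_of_forall_pos_le_add fun δ hδ => ?_
  have hc : 0 < (B + ν + 1) * (t - s) + √(1 + a ^ 2) := by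
    have := htt.1
    have h2 : 0 < √(1 + a ^ 2) := by positivity
    have h3 : 0 ≤ (B + ν + 1) * (t - s) := mul_nonneg (by linarith) (by linarith)
    linarith
  have := key (δ / ((B + ν + 1) * (t - s) + √(1 + a ^ 2))) (by positivity) t htt a b
  have e : δ / ((B + ν + 1) * (t - s) + √(1 + a ^ 2)) * ((B + ν + 1) * (t - s) + √(1 + a ^ 2)) = δ :=
    div_mul_cancel₀ _ hc.ne'
  nlinarith


/-! ### Kernels -/

/-- denominator -/
noncomputable def Dn (z : ℝ × ℝ) : ℝ := Real.cosh z.1 - Real.cos z.2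
noncomputable def kR (e : ℝ) (z : ℝ × ℝ) : ℝ := -Real.sin z.2 / (2 * (Dn z + e))
noncomputable def hR (e : ℝ) (z : ℝ × ℝ) : ℝ := Real.sinh z.1 / (2 * (Dn z + e))
noncomputable def k1R (e : ℝ) (z : ℝ × ℝ) : ℝ :=
  Real.sin z.2 * Real.sinh z.1 / (2 * (Dn z + e) ^ 2)
noncomputable def k2R (e : ℝ) (z : ℝ × ℝ) : ℝ :=
  -Real.cos z.2 / (2 * (Dn z + e)) + Real.sin z.2 ^ 2 / (2 * (Dn z + e) ^ 2)

lemma Dn_eq (z : ℝ × ℝ) : Dn z = 2 * (|Real.sinh (z.1 / 2)| ^ 2 + |Real.sin (z.2 / 2)| ^ 2) := by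
  have h1 : Real.cosh z.1 = Real.cosh (z.1 / 2) ^ 2 + Real.sinh (z.1 / 2) ^ 2 := by
    rw [← Real.cosh_two_mul]; ring_nf
  have h2 : Real.cos z.2 = 2 * Real.cos (z.2 / 2) ^ 2 - 1 := by
    rw [← Real.cos_two_mul]; ring_nf
  have h3 := Real.cosh_sq (z.1 / 2)
  have h4 := Real.sin_sq_add_cos_sq (z.2 / 2)
  rw [Dn, h1, h2, sq_abs, sq_abs]; linarith
lemma Dn_nonneg (z : ℝ × ℝ) : 0 ≤ Dn z := by rw [Dn_eq]; positivity
lemma Dn_cont : Continuous Dn := by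
  unfold Dn
  exact (Real.continuous_cosh.comp continuous_fst).sub (Real.continuous_cos.comp continuous_snd)
lemma kR_meas (e : ℝ) : Measurable (kR e) := by
  unfold kR; have := Dn_cont.measurable
  exact ((Real.measurable_sin.comp measurable_snd).neg).div ((this.add_const e).const_mul 2)
lemma hR_meas (e : ℝ) : Measurable (hR e) := by
  unfold hR; have := Dn_cont.measurable
  exact ((Real.measurable_sinh.comp measurable_fst)).div ((this.add_const e).const_mul 2)
lemma k1R_meas (e : ℝ) : Measurable (k1R e) := by
  unfold k1R; have := Dn_cont.measurable
  exact ((Real.measurable_sin.comp measurable_snd).mul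
    (Real.measurable_sinh.comp measurable_fst)).div (((this.add_const e).pow_const 2).const_mul 2)
lemma k2R_meas (e : ℝ) : Measurable (k2R e) := by
  unfold k2R; have := Dn_cont.measurable
  exact (((Real.measurable_cos.comp measurable_snd).neg).div ((this.add_const e).const_mul 2)).add
    (((Real.measurable_sin.comp measurable_snd).pow_const 2).div
      (((this.add_const e).pow_const 2).const_mul 2))

lemma abs_sin_eq (b : ℝ) : |Real.sin b| ≤ 2 * |Real.sin (b / 2)| := by
  have h : Real.sin b = 2 * Real.sin (b / 2) * Real.cos (b / 2) := by
    rw [← Real.sin_two_mul]; ring_nf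
  rw [h, abs_mul, abs_mul]
  have := Real.abs_cos_le_one (b / 2)
  norm_num
  nlinarith [abs_nonneg (Real.sin (b / 2))]
lemma abs_sinh_eq (a : ℝ) : |Real.sinh a| = 2 * |Real.sinh (a / 2)| * Real.cosh (a / 2) := by
  have h : Real.sinh a = 2 * Real.sinh (a / 2) * Real.cosh (a / 2) := by
    rw [← Real.sinh_two_mul]; ring_nf
  rw [h, abs_mul, abs_mul, abs_of_pos (Real.cosh_pos (a / 2))]; norm_num
lemma sinh_half_lower (a : ℝ) : |a| / 4 * Real.exp (|a| / 4) ≤ |Real.sinh (a / 2)| := by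
  have h : |Real.sinh (a / 2)| = Real.sinh (|a| / 2) := by
    rw [Real.abs_sinh, abs_div]; norm_num
  rw [h]
  have h2 : Real.sinh (|a| / 2) = 2 * Real.sinh (|a| / 4) * Real.cosh (|a| / 4) := by
    rw [← Real.sinh_two_mul]; ring_nf
  rw [h2]
  have h3 : |a| / 4 ≤ Real.sinh (|a| / 4) := Real.self_le_sinh_iff.2 (by positivity)
  have h4 : Real.exp (|a| / 4) / 2 ≤ Real.cosh (|a| / 4) := by
    rw [Real.cosh_eq]; have := Real.exp_pos (-(|a| / 4)); linarith
  have h5 : 0 ≤ |a| / 4 := by positivity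
  have h6 := Real.exp_pos (|a| / 4)
  calc |a| / 4 * Real.exp (|a| / 4) = 2 * (|a| / 4) * (Real.exp (|a| / 4) / 2) := by ring
    _ ≤ _ := by gcongr
lemma cosh_half_upper (a : ℝ) : Real.cosh (a / 2) ≤ 1 + |Real.sinh (a / 2)| := by
  have h := Real.cosh_sq (a / 2)
  have h2 := Real.cosh_pos (a / 2)
  have h3 := abs_nonneg (Real.sinh (a / 2))
  have h4 := sq_abs (Real.sinh (a / 2))
  nlinarith

lemma kR_abs_le {e : ℝ} (he : 0 ≤ e) (z : ℝ × ℝ) : |kR e z| ≤ |kR 0 z| := by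
  unfold kR
  have h := Dn_nonneg z
  rw [abs_div, abs_div, abs_of_nonneg (by linarith : 0 ≤ 2 * (Dn z + e)),
    abs_of_nonneg (by linarith : 0 ≤ 2 * (Dn z + 0))]
  rcases eq_or_lt_of_le h with h0 | h0
  · have : Real.sin z.2 = 0 := by
      rw [Dn_eq] at h0
      have hs : |Real.sin (z.2 / 2)| = 0 := by
        nlinarith [sq_nonneg |Real.sinh (z.1 / 2)|, sq_nonneg |Real.sin (z.2 / 2)|]
      have := abs_sin_eq z.2
      rw [hs] at this
      exact abs_eq_zero.1 (le_antisymm (by linarith) (abs_nonneg _))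
    simp [this]
  · gcongr
lemma hR_abs_le {e : ℝ} (he : 0 ≤ e) (z : ℝ × ℝ) : |hR e z| ≤ |hR 0 z| := by
  unfold hR
  have h := Dn_nonneg z
  rw [abs_div, abs_div, abs_of_nonneg (by linarith : 0 ≤ 2 * (Dn z + e)),
    abs_of_nonneg (by linarith : 0 ≤ 2 * (Dn z + 0))]
  rcases eq_or_lt_of_le h with h0 | h0
  · have : Real.sinh z.1 = 0 := by
      rw [Dn_eq] at h0
      have hs : |Real.sinh (z.1 / 2)| = 0 := by
        nlinarith [sq_nonneg |Real.sinh (z.1 / 2)|, sq_nonneg |Real.sin (z.2 / 2)|]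
      have := abs_sinh_eq z.1
      rw [hs] at this
      exact abs_eq_zero.1 (by linarith)
    simp [this]
  · gcongr

section pointwise
variable (z : ℝ × ℝ)

lemma Dn_pos (h : z.1 ≠ 0) : 0 < Dn z := by
  rw [Dn_eq]
  have : 0 < |Real.sinh (z.1 / 2)| := by
    refine lt_of_lt_of_le ?_ (sinh_half_lower z.1)
    have := abs_pos.2 h
    positivity
  positivity

lemma kR_bound : |kR 0 z| * (2 * (|Real.sinh (z.1 / 2)| ^ 2 + |Real.sin (z.2 / 2)| ^ 2))
    ≤ |Real.sin (z.2 / 2)| := by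
  rw [← Dn_eq, kR, abs_div, abs_of_nonneg (by linarith [Dn_nonneg z] : 0 ≤ 2 * (Dn z + 0)), abs_neg]
  rcases eq_or_lt_of_le (Dn_nonneg z) with h0 | h0
  · rw [← h0]; simp
  · have := abs_sin_eq z.2
    rw [add_zero, div_mul_eq_mul_div, div_le_iff₀ (by positivity)]
    nlinarith
lemma hR_bound : |hR 0 z| * (2 * (|Real.sinh (z.1 / 2)| ^ 2 + |Real.sin (z.2 / 2)| ^ 2))
    ≤ |Real.sinh (z.1 / 2)| * Real.cosh (z.1 / 2) := by
  rw [← Dn_eq, hR, abs_div, abs_of_nonneg (by linarith [Dn_nonneg z] : 0 ≤ 2 * (Dn z + 0))]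
  rcases eq_or_lt_of_le (Dn_nonneg z) with h0 | h0
  · rw [← h0]; simp; have := Real.cosh_pos (z.1 / 2); positivity
  · have := abs_sinh_eq z.1
    rw [add_zero, div_mul_eq_mul_div, div_le_iff₀ (by positivity), this]
    nlinarith

/-- the weight used for symmetrization -/
lemma kR_sym_bound : |z.1| * |kR 0 z| * Real.exp (|z.1| / 4) ≤ 1 := by
  by_cases h0 : z.1 = 0
  · simp [h0]
  have hb := kR_bound z
  have hl := sinh_half_lower z.1
  have hz := abs_pos.2 h0
  set s := |Real.sinh (z.1 / 2)|
  set σ := |Real.sin (z.2 / 2)|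
  have hE := Real.exp_pos (|z.1| / 4)
  have hs : 0 < s := lt_of_lt_of_le (by positivity) hl
  have hσ : 0 ≤ σ := abs_nonneg _
  have hk := abs_nonneg (kR 0 z)
  have h1 : |kR 0 z| * (4 * s) ≤ 1 := by
    rcases eq_or_lt_of_le hσ with h | h
    · rw [← h] at hb
      have : |kR 0 z| * s ^ 2 ≤ 0 := by nlinarith
      have : |kR 0 z| = 0 := by
        by_contra hne
        have : 0 < |kR 0 z| := lt_of_le_of_ne hk (Ne.symm hne)
        have := mul_pos this (pow_pos hs 2)
        linarith
      rw [this]; simp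
    · have h3 : |kR 0 z| * (4 * s) * σ ≤ 1 * σ := by nlinarith [sq_nonneg (s - σ)]
      exact le_of_mul_le_mul_right h3 h
  calc |z.1| * |kR 0 z| * Real.exp (|z.1| / 4)
      = |kR 0 z| * (4 * (|z.1| / 4 * Real.exp (|z.1| / 4))) := by ring
    _ ≤ |kR 0 z| * (4 * s) := by gcongr
    _ ≤ 1 := h1

lemma k1R_far {e ρ : ℝ} (he : 0 ≤ e) (hρ : 0 < ρ) (hρ1 : ρ ≤ 1) (hz : ρ ≤ |z.1|) :
    |k1R e z| ≤ ρ⁻¹ ^ 2 * (12 * Real.exp (-|z.1| / 4)) := by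
  have hl := sinh_half_lower z.1
  have hc := cosh_half_upper z.1
  have h1 := abs_sin_eq z.2
  have h2 := abs_sinh_eq z.1
  have hz0 : 0 < |z.1| := lt_of_lt_of_le hρ hz
  have hD := Dn_eq z
  set s := |Real.sinh (z.1 / 2)|
  set σ := |Real.sin (z.2 / 2)|
  set c := Real.cosh (z.1 / 2)
  have hE := Real.exp_pos (|z.1| / 4)
  have hs : 0 < s := lt_of_lt_of_le (by positivity) hl
  have hσ : 0 ≤ σ := abs_nonneg _
  have hc0 : 0 < c := Real.cosh_pos _
  have hDp : 0 < Dn z + e := by rw [hD]; positivity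
  rw [k1R, abs_div, abs_mul, h2, abs_of_pos (by positivity : 0 < 2 * (Dn z + e) ^ 2)]
  have hD2 : 2 * s ^ 2 ≤ Dn z + e := by rw [hD]; nlinarith
  have hD3 : 4 * (s * σ) ≤ Dn z + e := by rw [hD]; nlinarith [sq_nonneg (s - σ)]
  have step1 : |Real.sin z.2| * (2 * s * c) / (2 * (Dn z + e) ^ 2) ≤ c / (4 * s ^ 2) := by
    rw [div_le_div_iff₀ (by positivity) (by positivity)]
    have a1 : |Real.sin z.2| * (2 * s * c) ≤ 2 * σ * (2 * s * c) := by gcongr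
    have a2 : (4 * (s * σ)) * (2 * s ^ 2) ≤ (Dn z + e) * (Dn z + e) := by gcongr
    calc |Real.sin z.2| * (2 * s * c) * (4 * s ^ 2) ≤ 2 * σ * (2 * s * c) * (4 * s ^ 2) := by gcongr
      _ = 2 * c * ((4 * (s * σ)) * (2 * s ^ 2)) := by ring
      _ ≤ 2 * c * ((Dn z + e) * (Dn z + e)) := by gcongr
      _ = _ := by ring
  have step2 : c / (4 * s ^ 2) ≤ 1 / (4 * s ^ 2) + 1 / (4 * s) := by
    rw [show 1 / (4 * s ^ 2) + 1 / (4 * s) = (1 + s) / (4 * s ^ 2) by field_simp]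
    gcongr
  have hw : 1 / s ≤ 4 * ρ⁻¹ * Real.exp (-|z.1| / 4) := by
    have h5 : ρ / 4 * Real.exp (|z.1| / 4) ≤ s := le_trans (by gcongr) hl
    calc 1 / s ≤ 1 / (ρ / 4 * Real.exp (|z.1| / 4)) := by gcongr
      _ = _ := by rw [neg_div, Real.exp_neg]; field_simp
  have hρi : 1 ≤ ρ⁻¹ := (one_le_inv₀ hρ).2 hρ1
  have hE1 : Real.exp (-|z.1| / 4) ≤ 1 := Real.exp_le_one_iff.2 (by linarith)
  have hE0 := Real.exp_pos (-|z.1| / 4)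
  set E := Real.exp (-|z.1| / 4)
  set r := ρ⁻¹
  have hw2 : (1 / s) ^ 2 ≤ (4 * r * E) ^ 2 := by gcongr
  have e1 : 1 / (4 * s ^ 2) = (1 / s) ^ 2 / 4 := by field_simp
  have e2 : 1 / (4 * s) = (1 / s) / 4 := by field_simp
  have a3 : r * E ≤ r ^ 2 * E := by nlinarith [mul_pos (by linarith : 0 < r) hE0]
  have a4 : r ^ 2 * E ^ 2 ≤ r ^ 2 * E := by nlinarith [sq_nonneg r, mul_nonneg (sq_nonneg r) hE0.le]
  nlinarith

lemma k2R_far {e ρ : ℝ} (he : 0 ≤ e) (hρ : 0 < ρ) (hz : ρ ≤ |z.1|) :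
    |k2R e z| ≤ ρ⁻¹ ^ 2 * (12 * Real.exp (-|z.1| / 4)) := by
  have hl := sinh_half_lower z.1
  have h1 := abs_sin_eq z.2
  have hz0 : 0 < |z.1| := lt_of_lt_of_le hρ hz
  have hD := Dn_eq z
  set s := |Real.sinh (z.1 / 2)|
  set σ := |Real.sin (z.2 / 2)|
  have hE := Real.exp_pos (|z.1| / 4)
  have hs : 0 < s := lt_of_lt_of_le (by positivity) hl
  have hσ : 0 ≤ σ := abs_nonneg _
  have hDp : 0 < Dn z + e := by rw [hD]; positivity
  have hD2 : 2 * s ^ 2 ≤ Dn z + e := by rw [hD]; nlinarith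
  have hD3 : 2 * σ ^ 2 ≤ Dn z + e := by rw [hD]; nlinarith
  have t1 : |-Real.cos z.2 / (2 * (Dn z + e))| ≤ 1 / (4 * s ^ 2) := by
    rw [abs_div, abs_neg, abs_of_pos (by positivity : 0 < 2 * (Dn z + e))]
    have := Real.abs_cos_le_one z.2
    exact div_le_div₀ zero_le_one this (by positivity) (by linarith)
  have t2 : |Real.sin z.2 ^ 2 / (2 * (Dn z + e) ^ 2)| ≤ 1 / (2 * s ^ 2) := by
    rw [abs_div, abs_pow, abs_of_pos (by positivity : 0 < 2 * (Dn z + e) ^ 2),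
      div_le_div_iff₀ (by positivity) (by positivity)]
    have : |Real.sin z.2| ^ 2 ≤ (2 * σ) ^ 2 := by gcongr
    have a2 : (2 * σ ^ 2) * (2 * s ^ 2) ≤ (Dn z + e) * (Dn z + e) := by gcongr
    nlinarith [mul_le_mul_of_nonneg_right this (sq_nonneg s)]
  have hw : 1 / s ≤ 4 * ρ⁻¹ * Real.exp (-|z.1| / 4) := by
    have h5 : ρ / 4 * Real.exp (|z.1| / 4) ≤ s := le_trans (by gcongr) hl
    calc 1 / s ≤ 1 / (ρ / 4 * Real.exp (|z.1| / 4)) := by gcongr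
      _ = _ := by rw [neg_div, Real.exp_neg]; field_simp
  have hE1 : Real.exp (-|z.1| / 4) ≤ 1 := Real.exp_le_one_iff.2 (by linarith)
  have hE0 := Real.exp_pos (-|z.1| / 4)
  have := abs_add_le (-Real.cos z.2 / (2 * (Dn z + e))) (Real.sin z.2 ^ 2 / (2 * (Dn z + e) ^ 2))
  rw [k2R]
  set E := Real.exp (-|z.1| / 4)
  set r := ρ⁻¹
  have hw2 : (1 / s) ^ 2 ≤ (4 * r * E) ^ 2 := by gcongr
  have e1 : 1 / (4 * s ^ 2) = (1 / s) ^ 2 / 4 := by field_simp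
  have e2 : 1 / (2 * s ^ 2) = (1 / s) ^ 2 / 2 := by field_simp
  have a4 : r ^ 2 * E ^ 2 ≤ r ^ 2 * E := by nlinarith [sq_nonneg r, mul_nonneg (sq_nonneg r) hE0.le]
  nlinarith

/-- a.e. product bound -/
lemma near_bound (h1 : z.1 ≠ 0) (h2 : Real.sin (z.2 / 2) ≠ 0) :
    |kR 0 z| + (if |z.1| ≤ 1 then |hR 0 z| else 0) ≤
      4 * ((√|z.1|)⁻¹ * Real.exp (-(1/8) * |z.1|)) * (√|Real.sin (z.2 / 2)|)⁻¹ := by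
  have hl := sinh_half_lower z.1
  have hc := cosh_half_upper z.1
  have hz0 : 0 < |z.1| := abs_pos.2 h1
  have hb1 := kR_bound z
  have hb2 := hR_bound z
  set s := |Real.sinh (z.1 / 2)| with hsdef
  set σ := |Real.sin (z.2 / 2)|
  have hE := Real.exp_pos (|z.1| / 4)
  have hs : 0 < s := lt_of_lt_of_le (by positivity) hl
  have hσ : 0 < σ := abs_pos.2 h2
  set x := √s with hx
  set y := √σ with hy
  have hxs : x ^ 2 = s := Real.sq_sqrt hs.le
  have hys : y ^ 2 = σ := Real.sq_sqrt hσ.le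
  have hx0 : 0 < x := Real.sqrt_pos.2 hs
  have hy0 : 0 < y := Real.sqrt_pos.2 hσ
  have hxi : x⁻¹ ≤ 2 * ((√|z.1|)⁻¹ * Real.exp (-(1/8) * |z.1|)) := by
    have h3 : √|z.1| / 2 * Real.exp (|z.1| / 8) ≤ x := by
      apply Real.le_sqrt_of_sq_le
      rw [mul_pow, div_pow, Real.sq_sqrt hz0.le, ← Real.exp_nat_mul]
      convert hl using 2
      · norm_num
      · push_cast; ring_nf
    have hzs : 0 < √|z.1| := Real.sqrt_pos.2 hz0
    calc x⁻¹ ≤ (√|z.1| / 2 * Real.exp (|z.1| / 8))⁻¹ := by gcongr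
      _ = _ := by
        rw [show -(1/8) * |z.1| = -(|z.1| / 8) by ring, Real.exp_neg]; field_simp
  have p1 : x * y ^ 3 ≤ x ^ 4 + y ^ 4 := by
    nlinarith [sq_nonneg (x ^ 2 - y ^ 2), sq_nonneg (x * y - y ^ 2), sq_nonneg (x*y), sq_nonneg (x^2)]
  have p2 : y * x ^ 3 ≤ x ^ 4 + y ^ 4 := by
    nlinarith [sq_nonneg (x ^ 2 - y ^ 2), sq_nonneg (x * y - x ^ 2), sq_nonneg (x*y), sq_nonneg (y^2)]
  have q1 : |kR 0 z| ≤ x⁻¹ * y⁻¹ / 2 := by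
    rw [← hxs, ← hys] at hb1
    have : |kR 0 z| * (2 * (x ^ 4 + y ^ 4)) ≤ y ^ 2 := by
      convert hb1 using 2; ring
    have h5 : |kR 0 z| * (2 * (x * y ^ 3)) ≤ y ^ 2 :=
      le_trans (by gcongr) this
    rw [show x⁻¹ * y⁻¹ / 2 = y ^ 2 / (2 * (x * y ^ 3)) by field_simp, le_div_iff₀ (by positivity)]
    exact h5
  have q2 : (if |z.1| ≤ 1 then |hR 0 z| else 0) ≤ x⁻¹ * y⁻¹ * (3 / 2) := by
    split_ifs with hz1
    · have hch : Real.cosh (z.1 / 2) ≤ 3 := by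
        have : Real.cosh (z.1 / 2) ≤ Real.cosh 1 := by
          rw [Real.cosh_le_cosh, abs_div]; norm_num; linarith
        refine this.trans ?_
        rw [Real.cosh_eq]
        have := Real.exp_one_lt_d9
        have : Real.exp (-1) ≤ 1 := Real.exp_le_one_iff.2 (by norm_num)
        linarith
      rw [← hxs, ← hys] at hb2
      have : |hR 0 z| * (2 * (x ^ 4 + y ^ 4)) ≤ x ^ 2 * 3 := by
        refine le_trans (le_of_eq ?_) (hb2.trans ?_)
        · ring
        · gcongr
      have h5 : |hR 0 z| * (2 * (y * x ^ 3)) ≤ x ^ 2 * 3 :=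
        le_trans (by gcongr) this
      rw [show x⁻¹ * y⁻¹ * (3 / 2) = x ^ 2 * 3 / (2 * (y * x ^ 3)) by field_simp,
        le_div_iff₀ (by positivity)]
      exact h5
    · positivity
  have hyi : 0 < y⁻¹ := by positivity
  have := mul_le_mul_of_nonneg_right hxi hyi.le
  nlinarith

end pointwise


noncomputable def mS : Measure (ℝ × ℝ) := volume.restrict strip

lemma mS_eq : mS = (volume : Measure ℝ).prod (volume.restrict (Set.Icc 0 (2 * π))) := by
  rw [mS, strip, Measure.volume_eq_prod, ← Measure.prod_restrict, Measure.restrict_univ]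

instance : SFinite mS := by rw [mS_eq]; infer_instance

noncomputable def m1 (z : ℝ × ℝ) : ℝ := |kR 0 z| + (if |z.1| ≤ 1 then |hR 0 z| else 0)
noncomputable def m2 (z : ℝ × ℝ) : ℝ := 12 * Real.exp (-|z.1| / 4)

lemma integrable_even {f : ℝ → ℝ} (hf : IntegrableOn (fun x => f x) (Set.Ioi 0)) :
    Integrable (fun x => f |x|) := by
  rw [← integrableOn_univ, ← Set.Iic_union_Ioi (a := (0 : ℝ))]
  refine IntegrableOn.union ?_ ?_
  · have h : IntegrableOn (fun x => f (-x)) (Set.Iic 0) := by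
      rw [integrableOn_Iic_iff_integrableOn_Iio]
      have h2 := (Measure.measurePreserving_neg (volume : Measure ℝ)).integrableOn_comp_preimage
        (Homeomorph.neg ℝ).measurableEmbedding (f := f) (s := Set.Ioi 0)
      rw [show (Neg.neg ⁻¹' Set.Ioi (0:ℝ)) = Set.Iio 0 by ext; simp] at h2
      exact h2.2 hf
    refine h.congr_fun (fun x hx => ?_) measurableSet_Iic
    simp only [abs_of_nonpos (Set.mem_Iic.1 hx)]
  · refine hf.congr_fun (fun x hx => ?_) measurableSet_Ioi
    simp only [abs_of_pos (Set.mem_Ioi.1 hx)]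

lemma int_aux1 : Integrable (fun x : ℝ => (√|x|)⁻¹ * Real.exp (-(1/8) * |x|)) := by
  apply integrable_even (f := fun x => (√x)⁻¹ * Real.exp (-(1/8) * x))
  have := integrableOn_rpow_mul_exp_neg_mul_rpow (p := 1) (s := -(1/2)) (b := 1/8)
    (by norm_num) (by norm_num) (by norm_num)
  refine this.congr_fun (fun x hx => ?_) measurableSet_Ioi
  have hx : 0 < x := hx
  simp only [Real.rpow_one]
  rw [Real.sqrt_eq_rpow, ← Real.rpow_neg hx.le]

lemma int_exp (c : ℝ) (hc : 0 < c) : Integrable (fun x : ℝ => Real.exp (-c * |x|)) := by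
  apply integrable_even (f := fun x => Real.exp (-c * x))
  exact exp_neg_integrableOn_Ioi 0 hc

lemma int_aux2 : IntegrableOn (fun b : ℝ => (√|Real.sin (b / 2)|)⁻¹) (Set.Icc 0 (2 * π)) := by
  have hmeas : Measurable (fun b : ℝ => (√|Real.sin (b / 2)|)⁻¹) := by fun_prop
  have hpi := Real.pi_pos
  have h0 : IntegrableOn (fun b : ℝ => b ^ (-(1/2) : ℝ)) (Set.Ioc 0 π) := by
    have := intervalIntegral.intervalIntegrable_rpow' (a := 0) (b := π) (r := -(1/2)) (by norm_num)
    rwa [intervalIntegrable_iff_integrableOn_Ioc_of_le hpi.le] at this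
  have h1 : IntegrableOn (fun b : ℝ => (√|Real.sin (b / 2)|)⁻¹) (Set.Ioc 0 π) := by
    refine Integrable.mono' (h0.const_mul √π) hmeas.aestronglyMeasurable ?_
    filter_upwards [ae_restrict_mem measurableSet_Ioc] with b hb
    have hs : b / π ≤ Real.sin (b / 2) := by
      have := Real.mul_le_sin (x := b / 2) (by linarith [hb.1]) (by linarith [hb.2])
      refine le_trans (le_of_eq ?_) this
      field_simp
    have hb0 : 0 < b / π := div_pos hb.1 hpi
    rw [Real.norm_eq_abs, abs_of_nonneg (by positivity), abs_of_pos (lt_of_lt_of_le hb0 hs)]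
    have : (√(Real.sin (b / 2)))⁻¹ ≤ (√(b / π))⁻¹ := by
      have := Real.sqrt_pos.2 hb0
      gcongr
    refine this.trans (le_of_eq ?_)
    rw [Real.sqrt_div hb.1.le, inv_div, Real.rpow_neg hb.1.le, ← Real.sqrt_eq_rpow]
    rfl
  have h2 : IntegrableOn (fun b : ℝ => (√|Real.sin (b / 2)|)⁻¹) (Set.Ico π (2 * π)) := by
    have h3 : IntervalIntegrable (fun b : ℝ => (√|Real.sin (b / 2)|)⁻¹) volume 0 π :=
      (intervalIntegrable_iff_integrableOn_Ioc_of_le hpi.le).2 h1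
    have h4 := h3.comp_sub_left (2 * π)
    have h5 : IntervalIntegrable (fun b : ℝ => (√|Real.sin (b / 2)|)⁻¹) volume
        (2 * π - 0) (2 * π - π) := by
      refine h4.congr ?_
      intro b _
      simp only
      rw [show (2 * π - b) / 2 = π - b / 2 by ring, Real.sin_pi_sub]
    have h6 := h5.symm
    rw [show 2 * π - π = π by ring, sub_zero] at h6
    have := (intervalIntegrable_iff_integrableOn_Ico_of_le (by linarith)).1 h6
    exact this
  rw [integrableOn_Icc_iff_integrableOn_Ioo]
  refine (h1.union h2).mono_set fun b hb => ?_
  rcases le_or_gt b π with h | h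
  · exact Or.inl ⟨hb.1, h⟩
  · exact Or.inr ⟨h.le, hb.2⟩

lemma m1_meas : Measurable m1 := by
  unfold m1
  have h : MeasurableSet {z : ℝ × ℝ | |z.1| ≤ 1} :=
    (isClosed_le (continuous_fst.abs) continuous_const).measurableSet
  have hk := (kR_meas 0)
  have hh := (hR_meas 0)
  exact (continuous_abs.measurable.comp hk).add
    (Measurable.ite h (continuous_abs.measurable.comp hh) measurable_const)
lemma m2_cont : Continuous m2 := by unfold m2; fun_prop
lemma m1_nonneg (z : ℝ × ℝ) : 0 ≤ m1 z := by unfold m1; split_ifs <;> positivity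
lemma m2_nonneg (z : ℝ × ℝ) : 0 ≤ m2 z := by unfold m2; positivity

lemma m1_int : Integrable m1 mS := by
  rw [mS_eq]
  have h := (int_aux1.const_mul 4).mul_prod int_aux2
  refine Integrable.mono' h m1_meas.aestronglyMeasurable ?_
  have a1 : ∀ᵐ z ∂((volume : Measure ℝ).prod (volume.restrict (Set.Icc 0 (2 * π)))), z.1 ≠ 0 :=
    Measure.quasiMeasurePreserving_fst.ae (Measure.ae_ne volume 0)
  have a2 : ∀ᵐ z ∂((volume : Measure ℝ).prod (volume.restrict (Set.Icc 0 (2 * π)))),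
      Real.sin (z.2 / 2) ≠ 0 := by
    refine Measure.quasiMeasurePreserving_snd.ae (p := fun b => Real.sin (b / 2) ≠ 0) ?_
    filter_upwards [ae_restrict_mem measurableSet_Icc,
      ae_restrict_of_ae (Measure.ae_ne volume (0 : ℝ)),
      ae_restrict_of_ae (Measure.ae_ne volume (2 * π))] with b hb hb0 hb1
    refine (Real.sin_pos_of_pos_of_lt_pi ?_ ?_).ne'
    · have := lt_of_le_of_ne hb.1 (Ne.symm hb0); linarith
    · have := lt_of_le_of_ne hb.2 hb1; linarith
  filter_upwards [a1, a2] with z h1 h2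
  rw [Real.norm_eq_abs, abs_of_nonneg (m1_nonneg z)]
  exact near_bound z h1 h2

lemma int_exp_mS (c : ℝ) (hc : 0 < c) : Integrable (fun z : ℝ × ℝ => Real.exp (-c * |z.1|)) mS := by
  rw [mS_eq]
  have := (int_exp c hc).mul_prod (integrable_const (1 : ℝ) (μ := volume.restrict (Set.Icc 0 (2 * π))))
  simpa using this

lemma m2_int : Integrable m2 mS := by
  have := (int_exp_mS (1/4) (by norm_num)).const_mul 12
  refine this.congr (Filter.Eventually.of_forall fun z => ?_)
  simp only [m2]; ring_nf

/-! translation -/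
lemma Icc_int_eq (f : ℝ → ℝ) : ∫ b in Set.Icc 0 (2 * π), f b = ∫ b in (0)..(2 * π), f b := by
  rw [integral_Icc_eq_integral_Ioc, intervalIntegral.integral_of_le (by positivity)]

lemma per_sub_integral {f : ℝ → ℝ} (hf : Function.Periodic f (2 * π)) (b : ℝ) :
    ∫ y in Set.Icc 0 (2 * π), f (b - y) = ∫ y in Set.Icc 0 (2 * π), f y := by
  rw [Icc_int_eq, Icc_int_eq, intervalIntegral.integral_comp_sub_left]
  have := hf.intervalIntegral_add_eq (b - 2 * π) 0
  simpa using this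

lemma per_sub_integrable {f : ℝ → ℝ} (hf : Function.Periodic f (2 * π)) (b : ℝ)
    (h : IntegrableOn f (Set.Icc 0 (2 * π))) :
    IntegrableOn (fun y => f (b - y)) (Set.Icc 0 (2 * π)) := by
  have hp : (0 : ℝ) ≤ 2 * π := by positivity
  rw [← intervalIntegrable_iff_integrableOn_Icc_of_le hp] at h ⊢
  have h2 := (hf.intervalIntegrable₀ (by positivity) h b (b - 2 * π))
  have := h2.comp_sub_left b
  simpa using this

lemma shift_integrable {h : ℝ × ℝ → ℝ} (hm : Measurable h)
    (hp : ∀ a, Function.Periodic (fun b => h (a, b)) (2 * π)) (hi : Integrable h mS) (a b : ℝ) :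
    Integrable (fun y => h (a - y.1, b - y.2)) mS := by
  rw [mS_eq] at hi ⊢
  have hm' : Measurable (fun y : ℝ × ℝ => h (a - y.1, b - y.2)) := hm.comp (by fun_prop)
  rw [integrable_prod_iff hi.1] at hi
  rw [integrable_prod_iff hm'.aestronglyMeasurable]
  constructor
  · have h1 := (Measure.measurePreserving_sub_left volume a).quasiMeasurePreserving.ae hi.1
    filter_upwards [h1] with y hy
    exact per_sub_integrable (hp (a - y)) b hy
  · have h2 := hi.2.comp_sub_left a
    refine h2.congr (Filter.Eventually.of_forall fun y => ?_)
    simp only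
    refine (per_sub_integral (f := fun c => ‖h (a - y, c)‖) ?_ b).symm
    intro c; exact congrArg norm (hp (a - y) c)

lemma shift_integral {h : ℝ × ℝ → ℝ} (hm : Measurable h)
    (hp : ∀ a, Function.Periodic (fun b => h (a, b)) (2 * π)) (hi : Integrable h mS) (a b : ℝ) :
    ∫ y, h (a - y.1, b - y.2) ∂mS = ∫ z, h z ∂mS := by
  have h1 := shift_integrable hm hp hi a b
  rw [mS_eq] at hi h1 ⊢
  rw [integral_prod _ hi, integral_prod _ h1]
  rw [← integral_sub_left_eq_self (fun x => ∫ y in Set.Icc 0 (2 * π), h (x, y)) volume a]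
  refine integral_congr_ae (Filter.Eventually.of_forall fun y => ?_)
  exact per_sub_integral (hp (a - y)) b


noncomputable def conv (κ : ℝ × ℝ → ℝ) (f : ℝ → ℝ → ℝ) (a b : ℝ) : ℝ :=
  ∫ z, κ z * f (a - z.1) (b - z.2) ∂mS

lemma shiftcont {f : ℝ → ℝ → ℝ} (hf : Continuous (fun x : ℝ × ℝ => f x.1 x.2)) (a b : ℝ) :
    Continuous (fun z : ℝ × ℝ => f (a - z.1) (b - z.2)) :=
  hf.comp (f := fun z : ℝ × ℝ => (a - z.1, b - z.2)) (by fun_prop)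

lemma conv_integrable {κ g : ℝ × ℝ → ℝ} {f : ℝ → ℝ → ℝ} {C : ℝ} (hκ : Measurable κ)
    (hg : Integrable g mS) (hκg : ∀ z, |κ z| ≤ g z)
    (hf : Continuous (fun x : ℝ × ℝ => f x.1 x.2)) (a b : ℝ)
    (hC : ∀ z, κ z ≠ 0 → |f (a - z.1) (b - z.2)| ≤ C) :
    Integrable (fun z => κ z * f (a - z.1) (b - z.2)) mS := by
  refine Integrable.mono' (hg.mul_const |C|)
    (hκ.mul (shiftcont hf a b).measurable).aestronglyMeasurable ?_
  filter_upwards with z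
  rw [Real.norm_eq_abs, abs_mul]
  by_cases h : κ z = 0
  · rw [h]; simp; exact mul_nonneg ((abs_nonneg _).trans (hκg z)) (abs_nonneg _)
  · exact mul_le_mul (hκg z) ((hC z h).trans (le_abs_self C)) (abs_nonneg _)
      ((abs_nonneg _).trans (hκg z))

lemma conv_abs_le {κ g : ℝ × ℝ → ℝ} {f : ℝ → ℝ → ℝ} {C : ℝ} (hC0 : 0 ≤ C)
    (hg : Integrable g mS) (hκg : ∀ z, |κ z| ≤ g z) (a b : ℝ)
    (hC : ∀ z, κ z ≠ 0 → |f (a - z.1) (b - z.2)| ≤ C) :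
    |conv κ f a b| ≤ C * ∫ z, g z ∂mS := by
  rw [conv, ← integral_const_mul, ← Real.norm_eq_abs]
  refine norm_integral_le_of_norm_le (hg.const_mul C) (Filter.Eventually.of_forall fun z => ?_)
  rw [Real.norm_eq_abs, abs_mul, mul_comm]
  by_cases h : κ z = 0
  · rw [h]; simp; exact mul_nonneg hC0 ((abs_nonneg _).trans (hκg z))
  · exact mul_le_mul (hC z h) (hκg z) (abs_nonneg _) hC0

lemma conv_deriv {κ g : ℝ × ℝ → ℝ} {f f' : ℝ → ℝ → ℝ} {C : ℝ} (hκ : Measurable κ)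
    (hg : Integrable g mS) (hκg : ∀ z, |κ z| ≤ g z)
    (hf : Continuous (fun x : ℝ × ℝ => f x.1 x.2))
    (hf' : Continuous (fun x : ℝ × ℝ => f' x.1 x.2)) (a : ℝ)
    (hd : ∀ a b, HasDerivAt (f a) (f' a b) b)
    (hC : ∀ z, κ z ≠ 0 → ∀ b, |f (a - z.1) b| ≤ C)
    (hC' : ∀ z, κ z ≠ 0 → ∀ b, |f' (a - z.1) b| ≤ C) (b : ℝ) :
    HasDerivAt (fun b => conv κ f a b) (conv κ f' a b) b := by
  refine (hasDerivAt_integral_of_dominated_loc_of_deriv_le (μ := mS)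
    (F := fun b z => κ z * f (a - z.1) (b - z.2)) (F' := fun b z => κ z * f' (a - z.1) (b - z.2))
    (x₀ := b) (s := Set.univ) (bound := fun z => g z * |C|) Filter.univ_mem ?_ ?_ ?_ ?_ ?_ ?_).2
  · exact Filter.Eventually.of_forall fun b =>
      (hκ.mul (shiftcont hf a b).measurable).aestronglyMeasurable
  · exact conv_integrable hκ hg hκg hf a b (fun z hz => hC z hz _)
  · exact (hκ.mul (shiftcont hf' a b).measurable).aestronglyMeasurable
  · filter_upwards with z b _
    rw [Real.norm_eq_abs, abs_mul]
    by_cases h : κ z = 0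
    · rw [h]; simp; exact mul_nonneg ((abs_nonneg _).trans (hκg z)) (abs_nonneg _)
    · exact mul_le_mul (hκg z) ((hC' z h _).trans (le_abs_self C)) (abs_nonneg _)
        ((abs_nonneg _).trans (hκg z))
  · exact hg.mul_const _
  · filter_upwards with z b _
    have h := ((hd (a - z.1) (b - z.2)).comp b ((hasDerivAt_id b).sub_const z.2)).const_mul (κ z)
    simpa using h

lemma conv_cont {κ g : ℝ × ℝ → ℝ} {f : ℝ → ℝ → ℝ} {C : ℝ} (hκ : Measurable κ)
    (hg : Integrable g mS) (hκg : ∀ z, |κ z| ≤ g z)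
    (hf : Continuous (fun x : ℝ × ℝ => f x.1 x.2)) (a : ℝ)
    (hC : ∀ z, κ z ≠ 0 → ∀ b, |f (a - z.1) b| ≤ C) :
    Continuous (fun b => conv κ f a b) := by
  refine continuous_of_dominated (bound := fun z => g z * |C|) ?_ ?_ (hg.mul_const _) ?_
  · exact fun b => (hκ.mul (shiftcont hf a b).measurable).aestronglyMeasurable
  · intro b
    filter_upwards with z
    rw [Real.norm_eq_abs, abs_mul]
    by_cases h : κ z = 0
    · rw [h]; simp; exact mul_nonneg ((abs_nonneg _).trans (hκg z)) (abs_nonneg _)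
    · exact mul_le_mul (hκg z) ((hC z h _).trans (le_abs_self C)) (abs_nonneg _)
        ((abs_nonneg _).trans (hκg z))
  · filter_upwards with z
    exact continuous_const.mul (hf.comp (f := fun b : ℝ => (a - z.1, b - z.2)) (by fun_prop))

lemma conv_per {κ : ℝ × ℝ → ℝ} {f : ℝ → ℝ → ℝ} (hp : ∀ a b, f a (b + 2 * π) = f a b) (a b : ℝ) :
    conv κ f a (b + 2 * π) = conv κ f a b := by
  unfold conv
  congr 1; ext z
  rw [show b + 2 * π - z.2 = b - z.2 + 2 * π by ring, hp]

/-- swapping the shift -/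
lemma conv_swap {κ g : ℝ × ℝ → ℝ} {f : ℝ → ℝ → ℝ} {C : ℝ} (hκ : Measurable κ)
    (hκp : ∀ a, Function.Periodic (fun b => κ (a, b)) (2 * π))
    (hg : Integrable g mS) (hκg : ∀ z, |κ z| ≤ g z)
    (hf : Continuous (fun x : ℝ × ℝ => f x.1 x.2)) (hp : ∀ a b, f a (b + 2 * π) = f a b) (a b : ℝ)
    (hC : ∀ z, κ z ≠ 0 → |f (a - z.1) (b - z.2)| ≤ C) :
    Integrable (fun y => κ (a - y.1, b - y.2) * f y.1 y.2) mS ∧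
    conv κ f a b = ∫ y, κ (a - y.1, b - y.2) * f y.1 y.2 ∂mS := by
  set h : ℝ × ℝ → ℝ := fun z => κ z * f (a - z.1) (b - z.2) with hh
  have hm : Measurable h := hκ.mul (shiftcont hf a b).measurable
  have hper : ∀ a, Function.Periodic (fun b => h (a, b)) (2 * π) := by
    intro a' c
    have e1 := hκp a' c
    have e2 := hp (a - a') (b - (c + 2 * π))
    simp only [hh] at *
    rw [e1, ← e2]; congr 2; ring
  have hi : Integrable h mS := conv_integrable hκ hg hκg hf a b hC
  have e : (fun y : ℝ × ℝ => h (a - y.1, b - y.2)) =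
      fun y => κ (a - y.1, b - y.2) * f y.1 y.2 := by
    ext y; simp [hh]
  have h1 := shift_integrable hm hper hi a b
  have h2 := shift_integral hm hper hi a b
  rw [e] at h1 h2
  exact ⟨h1, h2.symm⟩

lemma loc_bdd {f : ℝ → ℝ → ℝ} (hf : Continuous (fun x : ℝ × ℝ => f x.1 x.2))
    (hp : ∀ a b, f a (b + 2 * π) = f a b) (a R : ℝ) :
    ∃ C, 0 ≤ C ∧ ∀ a', |a - a'| ≤ R → ∀ b, |f a' b| ≤ C := by
  have hc : IsCompact (Set.Icc (a - R) (a + R) ×ˢ Set.Icc 0 (2 * π)) :=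
    isCompact_Icc.prod isCompact_Icc
  obtain ⟨C, hC⟩ := hc.exists_bound_of_continuousOn hf.continuousOn
  refine ⟨|C|, abs_nonneg _, fun a' ha b => ?_⟩
  obtain ⟨c, hc, hc'⟩ := Function.Periodic.exists_mem_Ico₀ (f := f a') (c := 2 * π)
    (fun b => hp a' b) (by positivity) b
  rw [hc']
  have ha := abs_le.1 ha
  exact (hC (a', c) ⟨⟨by linarith, by linarith⟩, hc.1, hc.2.le⟩).trans (le_abs_self C)

/-! near and far kernels -/
noncomputable def kN (ρ : ℝ) (z : ℝ × ℝ) : ℝ := if |z.1| < ρ then kR 0 z else 0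
noncomputable def hN (e ρ : ℝ) (z : ℝ × ℝ) : ℝ := if |z.1| < ρ then hR e z else 0
noncomputable def kG (ρ : ℝ) (z : ℝ × ℝ) : ℝ := if |z.1| < ρ then 0 else kR 0 z
noncomputable def kF (ρ : ℝ) (z : ℝ × ℝ) : ℝ := if |z.1| < ρ then 0 else k2R 0 z
noncomputable def hF (e ρ : ℝ) (z : ℝ × ℝ) : ℝ := if |z.1| < ρ then 0 else k1R e z

lemma nset_meas (ρ : ℝ) : MeasurableSet {z : ℝ × ℝ | |z.1| < ρ} :=
  (isOpen_lt (continuous_fst.abs) continuous_const).measurableSet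
lemma kN_meas (ρ : ℝ) : Measurable (kN ρ) :=
  Measurable.ite (nset_meas ρ) (kR_meas 0) measurable_const
lemma hN_meas (e ρ : ℝ) : Measurable (hN e ρ) :=
  Measurable.ite (nset_meas ρ) (hR_meas e) measurable_const
lemma kG_meas (ρ : ℝ) : Measurable (kG ρ) :=
  Measurable.ite (nset_meas ρ) measurable_const (kR_meas 0)
lemma kF_meas (ρ : ℝ) : Measurable (kF ρ) :=
  Measurable.ite (nset_meas ρ) measurable_const (k2R_meas 0)
lemma hF_meas (e ρ : ℝ) : Measurable (hF e ρ) :=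
  Measurable.ite (nset_meas ρ) measurable_const (k1R_meas e)

lemma kR_m1 (z : ℝ × ℝ) : |kR 0 z| ≤ m1 z := by
  unfold m1; split_ifs <;> simp
lemma kN_m1 (ρ : ℝ) (z : ℝ × ℝ) : |kN ρ z| ≤ m1 z := by
  unfold kN; split_ifs
  · exact kR_m1 z
  · simpa using m1_nonneg z
lemma kG_m1 (ρ : ℝ) (z : ℝ × ℝ) : |kG ρ z| ≤ m1 z := by
  unfold kG; split_ifs
  · simpa using m1_nonneg z
  · exact kR_m1 z
lemma hN_m1 {e ρ : ℝ} (he : 0 ≤ e) (hρ : ρ ≤ 1) (z : ℝ × ℝ) : |hN e ρ z| ≤ m1 z := by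
  unfold hN; split_ifs with h
  · refine (hR_abs_le he z).trans ?_
    unfold m1; rw [if_pos (by linarith)]; simp
  · simpa using m1_nonneg z
lemma kF_m2 {ρ : ℝ} (hρ : 0 < ρ) (z : ℝ × ℝ) : |kF ρ z| ≤ ρ⁻¹ ^ 2 * m2 z := by
  unfold kF; split_ifs with h
  · simpa using mul_nonneg (by positivity) (m2_nonneg z)
  · exact k2R_far z le_rfl hρ (not_lt.1 h)
lemma hF_m2 {e ρ : ℝ} (he : 0 ≤ e) (hρ : 0 < ρ) (hρ1 : ρ ≤ 1) (z : ℝ × ℝ) :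
    |hF e ρ z| ≤ ρ⁻¹ ^ 2 * m2 z := by
  unfold hF; split_ifs with h
  · simpa using mul_nonneg (by positivity) (m2_nonneg z)
  · exact k1R_far z he hρ hρ1 (not_lt.1 h)

lemma kN_supp {ρ : ℝ} {z : ℝ × ℝ} (h : kN ρ z ≠ 0) : |z.1| ≤ ρ := by
  unfold kN at h; split_ifs at h with h1
  · exact h1.le
  · simp at h
lemma hN_supp {e ρ : ℝ} {z : ℝ × ℝ} (h : hN e ρ z ≠ 0) : |z.1| ≤ ρ := by
  unfold hN at h; split_ifs at h with h1
  · exact h1.le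
  · simp at h

lemma Dn_per (a b : ℝ) : Dn (a, b + 2 * π) = Dn (a, b) := by simp [Dn]
lemma kR_per (e a : ℝ) : Function.Periodic (fun b => kR e (a, b)) (2 * π) := by
  intro b; simp only [kR, Dn_per, Real.sin_add_two_pi]
lemma kG_per (ρ a : ℝ) : Function.Periodic (fun b => kG ρ (a, b)) (2 * π) := by
  intro b; simp only [kG, kR, Dn_per, Real.sin_add_two_pi]

/-- A smooth-in-`x₂` family at a fixed time. -/
structure Fam (th : ℕ → ℝ → ℝ → ℝ) (M : ℝ) : Prop where
  cont : ∀ k, Continuous (fun x : ℝ × ℝ => th k x.1 x.2)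
  d2 : ∀ k a b, HasDerivAt (th k a) (th (k + 1) a b) b
  per : ∀ k a b, th k a (b + 2 * π) = th k a b
  bd : ∀ a b, |th 0 a b| ≤ M

noncomputable def UU (ρ : ℝ) (th : ℕ → ℝ → ℝ → ℝ) : ℕ → ℝ → ℝ → ℝ
  | 0 => conv (kR 0) (th 0)
  | j + 1 => fun a b => conv (kN ρ) (th (j + 1)) a b + conv (kF ρ) (th j) a b
noncomputable def VV (ρ : ℝ) (th : ℕ → ℝ → ℝ → ℝ) (j : ℕ) (a b : ℝ) : ℝ :=
  -conv (hN 0 ρ) (th (j + 1)) a b + conv (hF 0 ρ) (th j) a b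

lemma m2r_int (ρ : ℝ) : Integrable (fun z => ρ⁻¹ ^ 2 * m2 z) mS := m2_int.const_mul _

lemma near_bd {th : ℕ → ℝ → ℝ → ℝ} {M : ℝ} (F : Fam th M) {κ : ℝ × ℝ → ℝ} {ρ : ℝ}
    (hs : ∀ z, κ z ≠ 0 → |z.1| ≤ ρ) (k : ℕ) (a : ℝ) :
    ∃ C, ∀ z, κ z ≠ 0 → ∀ b, |th k (a - z.1) b| ≤ C := by
  obtain ⟨C, _, hC⟩ := loc_bdd (F.cont k) (F.per k) a ρ
  exact ⟨C, fun z hz b => hC _ (by simpa using hs z hz) b⟩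

lemma near_deriv {th : ℕ → ℝ → ℝ → ℝ} {M : ℝ} (F : Fam th M) {κ g : ℝ × ℝ → ℝ} {ρ : ℝ}
    (hκ : Measurable κ) (hg : Integrable g mS) (hκg : ∀ z, |κ z| ≤ g z)
    (hs : ∀ z, κ z ≠ 0 → |z.1| ≤ ρ) (k : ℕ) (a b : ℝ) :
    HasDerivAt (fun b => conv κ (th k) a b) (conv κ (th (k + 1)) a b) b := by
  obtain ⟨C1, h1⟩ := near_bd F hs k a
  obtain ⟨C2, h2⟩ := near_bd F hs (k + 1) a
  exact conv_deriv (C := max C1 C2) hκ hg hκg (F.cont k) (F.cont (k + 1)) a (F.d2 k)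
    (fun z hz b => (h1 z hz b).trans (le_max_left _ _))
    (fun z hz b => (h2 z hz b).trans (le_max_right _ _)) b

def GB (f : ℝ → ℝ → ℝ) : Prop := ∃ C, ∀ a b, |f a b| ≤ C

lemma far_deriv {th : ℕ → ℝ → ℝ → ℝ} {M : ℝ} (F : Fam th M) {κ g : ℝ × ℝ → ℝ}
    (hκ : Measurable κ) (hg : Integrable g mS) (hκg : ∀ z, |κ z| ≤ g z)
    (k : ℕ) (hb : GB (th k)) (hb1 : GB (th (k + 1))) (a b : ℝ) :
    HasDerivAt (fun b => conv κ (th k) a b) (conv κ (th (k + 1)) a b) b := by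
  obtain ⟨C1, h1⟩ := hb
  obtain ⟨C2, h2⟩ := hb1
  exact conv_deriv (C := max C1 C2) hκ hg hκg (F.cont k) (F.cont (k + 1)) a (F.d2 k)
    (fun z hz b => (h1 _ b).trans (le_max_left _ _))
    (fun z hz b => (h2 _ b).trans (le_max_right _ _)) b

section

lemma kG_hasDeriv {th : ℕ → ℝ → ℝ → ℝ} {M ρ : ℝ} (F : Fam th M) (hρ : 0 < ρ)
    (a b : ℝ) : HasDerivAt (fun b => kG ρ (a, b)) (kF ρ (a, b)) b := by
  unfold kG kF
  simp only
  split_ifs with h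
  · exact hasDerivAt_const _ _
  · have hD : Dn (a, b) + 0 ≠ 0 := by
      have : a ≠ 0 := by
        intro h0; rw [h0] at h; simp at h; linarith
      have := Dn_pos (a, b) this; linarith
    have hDd : HasDerivAt (fun b => 2 * (Dn (a, b) + 0)) (2 * Real.sin b) b := by
      unfold Dn
      have := ((((Real.hasDerivAt_cos b).const_sub (Real.cosh a)).add_const 0).const_mul 2)
      simpa using this
    have := ((Real.hasDerivAt_sin b).neg).div hDd (by positivity)
    unfold kR k2R
    refine this.congr_deriv ?_
    simp only [Pi.neg_apply]
    field_simp
    ring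

lemma far_base {th : ℕ → ℝ → ℝ → ℝ} {M ρ : ℝ} (F : Fam th M) (hρ : 0 < ρ)
    (a b : ℝ) :
    HasDerivAt (fun b => conv (kG ρ) (th 0) a b) (conv (kF ρ) (th 0) a b) b := by
  have hkFp : ∀ a, Function.Periodic (fun b => kF ρ (a, b)) (2 * π) := by
    intro a b; simp only [kF, k2R, Dn_per, Real.sin_add_two_pi, Real.cos_add_two_pi]
  have e1 : ∀ b, _ := fun b => conv_swap (C := M) (kG_meas ρ) (kG_per ρ) m1_int (kG_m1 ρ) (F.cont 0)
    (F.per 0) a b (fun z _ => F.bd _ _)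
  have e2 := conv_swap (C := M) (kF_meas ρ) hkFp (m2r_int ρ) (kF_m2 hρ) (F.cont 0)
    (F.per 0) a b (fun z _ => F.bd _ _)
  rw [e2.2]
  simp_rw [fun b => (e1 b).2]
  have hsh : Integrable (fun y : ℝ × ℝ => ρ⁻¹ ^ 2 * m2 (a - y.1, b - y.2)) mS :=
    shift_integrable (h := fun z => ρ⁻¹ ^ 2 * m2 z) (m2_cont.measurable.const_mul _)
      (fun a b => by simp [m2]) (m2r_int ρ) a b
  refine (hasDerivAt_integral_of_dominated_loc_of_deriv_le (μ := mS)
    (F := fun b y => kG ρ (a - y.1, b - y.2) * th 0 y.1 y.2)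
    (F' := fun b y => kF ρ (a - y.1, b - y.2) * th 0 y.1 y.2)
    (x₀ := b) (s := Set.univ) (bound := fun y => ρ⁻¹ ^ 2 * m2 (a - y.1, b - y.2) * M)
    Filter.univ_mem ?_ ?_ ?_ ?_ ?_ ?_).2
  · exact Filter.Eventually.of_forall fun b => (e1 b).1.1
  · exact (e1 b).1
  · exact e2.1.1
  · filter_upwards with y c _
    rw [Real.norm_eq_abs, abs_mul]
    have h3 : m2 (a - y.1, c - y.2) = m2 (a - y.1, b - y.2) := rfl
    have h2 := kF_m2 hρ (a - y.1, c - y.2)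
    rw [h3] at h2
    exact mul_le_mul h2 (F.bd _ _) (abs_nonneg _) ((abs_nonneg _).trans h2)
  · exact hsh.mul_const _
  · filter_upwards with y c _
    have h := ((kG_hasDeriv F hρ (a - y.1) (c - y.2)).comp c
      ((hasDerivAt_id c).sub_const y.2)).mul_const (th 0 y.1 y.2)
    simpa using h

lemma UU_zero_deriv {th : ℕ → ℝ → ℝ → ℝ} {M ρ : ℝ} (F : Fam th M) (hρ : 0 < ρ)
    (a b : ℝ) :
    HasDerivAt (UU ρ th 0 a) (UU ρ th 1 a b) b := by
  have h1 := near_deriv F (kN_meas ρ) m1_int (kN_m1 ρ) (fun z hz => kN_supp hz) 0 a b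
  have h2 := far_base F hρ a b
  refine (h1.add h2).congr_of_eventuallyEq (Filter.Eventually.of_forall fun c => ?_)
  simp only [UU, Pi.add_apply]
  unfold conv
  rw [← integral_add (conv_integrable (C := M) (kN_meas ρ) m1_int (kN_m1 ρ) (F.cont 0) a c
    (fun _ _ => F.bd _ _)) (conv_integrable (C := M) (kG_meas ρ) m1_int (kG_m1 ρ) (F.cont 0) a c
    (fun _ _ => F.bd _ _))]
  congr 1; ext z
  unfold kN kG; split_ifs <;> ring

lemma UU_deriv {th : ℕ → ℝ → ℝ → ℝ} {M ρ : ℝ} (F : Fam th M) (hρ : 0 < ρ)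
    (j : ℕ) (hb : ∀ i ≤ j, GB (th i)) (a b : ℝ) :
    HasDerivAt (UU ρ th j a) (UU ρ th (j + 1) a b) b := by
  cases j with
  | zero => exact UU_zero_deriv F hρ a b
  | succ j =>
    exact (near_deriv F (kN_meas ρ) m1_int (kN_m1 ρ) (fun z hz => kN_supp hz) (j + 1) a b).add
      (far_deriv F (kF_meas ρ) (m2r_int ρ) (kF_m2 hρ) j (hb j (by omega)) (hb (j + 1) le_rfl) a b)

lemma VV_deriv {th : ℕ → ℝ → ℝ → ℝ} {M ρ : ℝ} (F : Fam th M) (hρ : 0 < ρ) (hρ1 : ρ ≤ 1)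
    (j : ℕ) (hb : ∀ i ≤ j + 1, GB (th i)) (a b : ℝ) :
    HasDerivAt (VV ρ th j a) (VV ρ th (j + 1) a b) b := by
  exact (near_deriv F (hN_meas 0 ρ) m1_int (hN_m1 le_rfl hρ1) (fun z hz => hN_supp hz)
    (j + 1) a b).neg.add
      (far_deriv F (hF_meas 0 ρ) (m2r_int ρ) (hF_m2 le_rfl hρ hρ1) j (hb j (by omega))
        (hb (j + 1) le_rfl) a b)

lemma VV_cont {th : ℕ → ℝ → ℝ → ℝ} {M ρ : ℝ} (F : Fam th M) (hρ : 0 < ρ) (hρ1 : ρ ≤ 1)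
    (j : ℕ) (hb : GB (th j)) (a : ℝ) : Continuous (VV ρ th j a) := by
  obtain ⟨C, hC⟩ := hb
  obtain ⟨C1, h1⟩ := near_bd F (κ := hN 0 ρ) (fun z hz => hN_supp hz) (j + 1) a
  exact (conv_cont (hN_meas 0 ρ) m1_int (hN_m1 le_rfl hρ1) (F.cont (j + 1)) a h1).neg.add
    (conv_cont (C := C) (hF_meas 0 ρ) (m2r_int ρ) (hF_m2 le_rfl hρ hρ1) (F.cont j) a
      (fun z _ b => hC _ b))

lemma UU_cont {th : ℕ → ℝ → ℝ → ℝ} {M ρ : ℝ} (F : Fam th M) (hρ : 0 < ρ)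
    (j : ℕ) (hb : ∀ i < j, GB (th i)) (a : ℝ) : Continuous (UU ρ th j a) := by
  cases j with
  | zero => exact conv_cont (C := M) (kR_meas 0) m1_int kR_m1 (F.cont 0) a (fun z _ b => F.bd _ _)
  | succ j =>
    obtain ⟨C, hC⟩ := hb j (by omega)
    obtain ⟨C1, h1⟩ := near_bd F (κ := kN ρ) (fun z hz => kN_supp hz) (j + 1) a
    exact (conv_cont (kN_meas ρ) m1_int (kN_m1 ρ) (F.cont (j + 1)) a h1).add
      (conv_cont (C := C) (kF_meas ρ) (m2r_int ρ) (kF_m2 hρ) (F.cont j) a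
        (fun z _ b => hC _ b))

end

noncomputable def C0 : ℝ := (∫ z, m1 z ∂mS) + (∫ z, m2 z ∂mS)
lemma C0_nonneg : 0 ≤ C0 :=
  add_nonneg (integral_nonneg m1_nonneg) (integral_nonneg m2_nonneg)
lemma m1_le_C0 : ∫ z, m1 z ∂mS ≤ C0 := by
  have : 0 ≤ ∫ z, m2 z ∂mS := (integral_nonneg m2_nonneg)
  unfold C0; linarith
lemma m2_le_C0 : ∫ z, m2 z ∂mS ≤ C0 := by
  have : 0 ≤ ∫ z, m1 z ∂mS := (integral_nonneg m1_nonneg)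
  unfold C0; linarith

lemma UU_zero_bd {th : ℕ → ℝ → ℝ → ℝ} {M ρ : ℝ} (hM : 0 ≤ M) (F : Fam th M) (a b : ℝ) :
    |UU ρ th 0 a b| ≤ C0 * M := by
  have := conv_abs_le hM m1_int kR_m1 a b (fun z _ => F.bd (a - z.1) (b - z.2))
  refine this.trans ?_
  rw [mul_comm]; exact mul_le_mul_of_nonneg_right m1_le_C0 hM

lemma UU_bd {th : ℕ → ℝ → ℝ → ℝ} {ρ S L : ℝ} (hρ : 0 < ρ) (j : ℕ) (a b : ℝ)
    (hS : 0 ≤ S) (hL : 0 ≤ L)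
    (h1 : ∀ a', |a - a'| ≤ ρ → ∀ b, |th (j + 1) a' b| ≤ S) (h2 : ∀ a b, |th j a b| ≤ L) :
    |UU ρ th (j + 1) a b| ≤ C0 * (S + ρ⁻¹ ^ 2 * L) := by
  have e1 := conv_abs_le (κ := kN ρ) (f := th (j + 1)) hS m1_int (kN_m1 ρ) a b
    (fun z hz => h1 _ (by simpa using kN_supp hz) _)
  have e2 := conv_abs_le (κ := kF ρ) (f := th j) hL (m2r_int ρ) (kF_m2 hρ) a b
    (fun z hz => h2 _ _)
  rw [integral_const_mul] at e2
  simp only [UU]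
  refine (abs_add_le _ _).trans ((add_le_add e1 e2).trans ?_)
  have := mul_le_mul_of_nonneg_left m1_le_C0 hS
  have := mul_le_mul_of_nonneg_left m2_le_C0 (mul_nonneg hL (by positivity : 0 ≤ ρ⁻¹ ^ 2))
  nlinarith

lemma VV_bd {th : ℕ → ℝ → ℝ → ℝ} {ρ S L : ℝ} (hρ : 0 < ρ) (hρ1 : ρ ≤ 1) (j : ℕ) (a b : ℝ)
    (hS : 0 ≤ S) (hL : 0 ≤ L)
    (h1 : ∀ a', |a - a'| ≤ ρ → ∀ b, |th (j + 1) a' b| ≤ S) (h2 : ∀ a b, |th j a b| ≤ L) :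
    |VV ρ th j a b| ≤ C0 * (S + ρ⁻¹ ^ 2 * L) := by
  have e1 := conv_abs_le (κ := hN 0 ρ) (f := th (j + 1)) hS m1_int (hN_m1 le_rfl hρ1) a b
    (fun z hz => h1 _ (by simpa using hN_supp hz) _)
  have e2 := conv_abs_le (κ := hF 0 ρ) (f := th j) hL (m2r_int ρ) (hF_m2 le_rfl hρ hρ1) a b
    (fun z hz => h2 _ _)
  rw [integral_const_mul] at e2
  simp only [VV]
  refine (abs_add_le _ _).trans ?_
  rw [abs_neg]
  refine ((add_le_add e1 e2).trans ?_)
  have := mul_le_mul_of_nonneg_left m1_le_C0 hS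
  have := mul_le_mul_of_nonneg_left m2_le_C0 (mul_nonneg hL (by positivity : 0 ≤ ρ⁻¹ ^ 2))
  nlinarith


/-! ### the `x₁`-derivative of the velocity -/

lemma ae_ne_mS : ∀ᵐ z ∂mS, z.1 ≠ 0 := by
  rw [mS_eq]
  exact Measure.quasiMeasurePreserving_fst.ae (Measure.ae_ne volume 0)

lemma kR_hasDeriv1 {e : ℝ} (he : 0 < e) (a b : ℝ) :
    HasDerivAt (fun a => kR e (a, b)) (k1R e (a, b)) a := by
  have hD := Dn_nonneg (a, b)
  have hDd : HasDerivAt (fun a => 2 * (Dn (a, b) + e)) (2 * Real.sinh a) a := by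
    unfold Dn
    have := ((((Real.hasDerivAt_cosh a).sub_const (Real.cos b)).add_const e).const_mul 2)
    simpa using this
  have hne : Dn (a, b) + e ≠ 0 := by linarith
  have := (hasDerivAt_const a (-Real.sin b)).div hDd (by positivity)
  unfold kR k1R
  refine this.congr_deriv ?_
  field_simp
  ring

lemma hR_hasDeriv2 {e : ℝ} (he : 0 < e) (a b : ℝ) :
    HasDerivAt (fun b => hR e (a, b)) (-k1R e (a, b)) b := by
  have hD := Dn_nonneg (a, b)
  have hDd : HasDerivAt (fun b => 2 * (Dn (a, b) + e)) (2 * Real.sin b) b := by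
    unfold Dn
    have := ((((Real.hasDerivAt_cos b).const_sub (Real.cosh a)).add_const e).const_mul 2)
    simpa using this
  have hne : Dn (a, b) + e ≠ 0 := by linarith
  have := (hasDerivAt_const b (Real.sinh a)).div hDd (by positivity)
  unfold hR k1R
  refine this.congr_deriv ?_
  field_simp
  ring

lemma k1R_cont {e : ℝ} (he : 0 < e) : Continuous (k1R e) := by
  unfold k1R
  have := Dn_cont
  refine Continuous.div (by fun_prop) (by fun_prop) fun z => ?_
  have := Dn_nonneg z
  positivity
lemma hR_cont {e : ℝ} (he : 0 < e) : Continuous (hR e) := by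
  unfold hR
  have := Dn_cont
  refine Continuous.div (by fun_prop) (by fun_prop) fun z => ?_
  have := Dn_nonneg z
  positivity

/-- a global bound for the regularised derivative -/
lemma k1R_glob {e : ℝ} (he : 0 < e) : ∃ C, 0 ≤ C ∧ ∀ z, |k1R e z| ≤ C * m2 z := by
  refine ⟨max 1 ((e ^ 2)⁻¹), by positivity, fun z => ?_⟩
  rcases le_or_gt 1 |z.1| with h | h
  · have := k1R_far z he.le one_pos le_rfl h
    simp only [inv_one, one_pow, one_mul] at this
    refine this.trans ?_
    have h2 := m2_nonneg z
    calc 12 * Real.exp (-|z.1| / 4) = 1 * m2 z := by rw [m2]; ring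
      _ ≤ _ := by gcongr; exact le_max_left _ _
  · have hD := Dn_nonneg z
    have h1 : |k1R e z| ≤ (e ^ 2)⁻¹ * (3 / 2) := by
      rw [k1R, abs_div, abs_mul, abs_of_pos (by positivity : 0 < 2 * (Dn z + e) ^ 2)]
      have hs := Real.abs_sin_le_one z.2
      have hsh : |Real.sinh z.1| ≤ 3 := by
        rw [Real.abs_sinh]
        have : Real.sinh |z.1| ≤ Real.sinh 1 := Real.sinh_le_sinh.2 h.le
        refine this.trans ?_
        rw [Real.sinh_eq]
        have := Real.exp_one_lt_d9
        have := Real.exp_pos (-1)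
        linarith
      rw [div_le_iff₀ (by positivity)]
      have h3 : |Real.sin z.2| * |Real.sinh z.1| ≤ 1 * 3 := by gcongr
      have h4 : (e ^ 2)⁻¹ * e ^ 2 = 1 := inv_mul_cancel₀ (by positivity)
      have h5 : e ^ 2 ≤ (Dn z + e) ^ 2 := by gcongr; linarith
      have h6 := mul_le_mul_of_nonneg_left h5 (by positivity : 0 ≤ (e ^ 2)⁻¹)
      nlinarith
    have h2 : 3 / 2 ≤ m2 z := by
      unfold m2
      have h8 := Real.add_one_le_exp (-|z.1| / 4)
      linarith
    refine h1.trans ?_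
    gcongr
    · exact le_max_right _ _

section

lemma reg_deriv {th : ℕ → ℝ → ℝ → ℝ} {M : ℝ} (F : Fam th M)
    {e : ℝ} (he : 0 < e) (a b : ℝ) :
    HasDerivAt (fun a => conv (kR e) (th 0) a b) (conv (k1R e) (th 0) a b) a := by
  obtain ⟨C, hC0, hC⟩ := k1R_glob he
  have hp : ∀ a, Function.Periodic (fun b => k1R e (a, b)) (2 * π) := by
    intro a b; simp only [k1R, Dn_per, Real.sin_add_two_pi]
  have e1 : ∀ a, _ := fun a => conv_swap (C := M) (kR_meas e) (kR_per e) m1_int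
    (fun z => (kR_abs_le he.le z).trans (kR_m1 z)) (F.cont 0) (F.per 0) a b (fun z _ => F.bd _ _)
  have e2 := conv_swap (C := M) (k1R_meas e) hp (m2_int.const_mul C) hC (F.cont 0)
    (F.per 0) a b (fun z _ => F.bd _ _)
  rw [e2.2]
  simp_rw [fun a => (e1 a).2]
  have hsh : Integrable (fun y : ℝ × ℝ => C * m2 (a - y.1, b - y.2)) mS :=
    shift_integrable (h := fun z => C * m2 z) (m2_cont.measurable.const_mul _)
      (fun a b => by simp [m2]) (m2_int.const_mul C) a b
  refine (hasDerivAt_integral_of_dominated_loc_of_deriv_le (μ := mS)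
    (F := fun a y => kR e (a - y.1, b - y.2) * th 0 y.1 y.2)
    (F' := fun a y => k1R e (a - y.1, b - y.2) * th 0 y.1 y.2)
    (x₀ := a) (s := Metric.ball a 1)
    (bound := fun y => C * m2 (a - y.1, b - y.2) * Real.exp (1 / 4) * M)
    (Metric.ball_mem_nhds a one_pos) ?_ ?_ ?_ ?_ ?_ ?_).2
  · exact Filter.Eventually.of_forall fun b => (e1 b).1.1
  · exact (e1 a).1
  · exact e2.1.1
  · filter_upwards with y c hc
    rw [Real.norm_eq_abs, abs_mul]
    have h3 : m2 (c - y.1, b - y.2) ≤ m2 (a - y.1, b - y.2) * Real.exp (1 / 4) := by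
      simp only [m2]
      rw [mul_assoc, ← Real.exp_add]
      gcongr
      rw [Metric.mem_ball, Real.dist_eq] at hc
      have : |a - y.1| ≤ |c - y.1| + |c - a| := by
        rw [show a - y.1 = (c - y.1) - (c - a) by ring]; exact abs_sub _ _
      linarith
    have h2 := hC (c - y.1, b - y.2)
    have h4 : |k1R e (c - y.1, b - y.2)| ≤ C * m2 (a - y.1, b - y.2) * Real.exp (1 / 4) := by
      refine h2.trans ?_
      rw [mul_assoc]
      exact mul_le_mul_of_nonneg_left h3 hC0
    exact mul_le_mul h4 (F.bd _ _) (abs_nonneg _) ((abs_nonneg _).trans h4)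
  · exact (hsh.mul_const _).mul_const _
  · filter_upwards with y c _
    have h := ((kR_hasDeriv1 he (c - y.1) (b - y.2)).comp c
      ((hasDerivAt_id c).sub_const y.1)).mul_const (th 0 y.1 y.2)
    simpa using h

lemma reg_ibp {th : ℕ → ℝ → ℝ → ℝ} {M : ℝ} (F : Fam th M)
    {e ρ : ℝ} (he : 0 < e) (hρ1 : ρ ≤ 1) (a b : ℝ) :
    conv (fun z => if |z.1| < ρ then k1R e z else 0) (th 0) a b = -conv (hN e ρ) (th 1) a b := by
  obtain ⟨C, hC0, hC⟩ := k1R_glob he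
  obtain ⟨C1, h1⟩ := near_bd F (κ := hN e ρ) (fun z hz => hN_supp hz) 1 a
  have i1 : Integrable (fun z : ℝ × ℝ => (if |z.1| < ρ then k1R e z else 0) *
      th 0 (a - z.1) (b - z.2)) mS := by
    refine conv_integrable (C := M) (Measurable.ite (nset_meas ρ) (k1R_meas e) measurable_const)
      (m2_int.const_mul C) (fun z => ?_) (F.cont 0) a b (fun z _ => F.bd _ _)
    split_ifs
    · exact hC z
    · simpa using mul_nonneg hC0 (m2_nonneg z)
  have i2 : Integrable (fun z : ℝ × ℝ => hN e ρ z * th 1 (a - z.1) (b - z.2)) mS :=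
    conv_integrable (hN_meas e ρ) m1_int (hN_m1 he.le hρ1) (F.cont 1) a b (fun z hz => h1 z hz _)
  unfold conv
  rw [mS_eq] at i1 i2 ⊢
  rw [integral_prod _ i1, integral_prod _ i2, ← integral_neg]
  congr 1; ext c
  by_cases hc : |c| < ρ
  · simp only [hN, hc, if_true]
    rw [Icc_int_eq, Icc_int_eq]
    have hd : ∀ x ∈ Set.uIcc 0 (2 * π), HasDerivAt (fun x => hR e (c, x) * th 0 (a - c) (b - x))
        (-(k1R e (c, x) * th 0 (a - c) (b - x)) - hR e (c, x) * th 1 (a - c) (b - x)) x := by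
      intro x _
      have h2 := (F.d2 0 (a - c) (b - x)).comp x ((hasDerivAt_id x).const_sub b)
      refine ((hR_hasDeriv2 he c x).mul h2).congr_deriv ?_
      simp only [Function.comp, id]; ring
    have hc1 : Continuous fun x => k1R e (c, x) * th 0 (a - c) (b - x) :=
      ((k1R_cont he).comp (by fun_prop : Continuous fun x : ℝ => (c, x))).mul
        ((F.cont 0).comp (by fun_prop : Continuous fun x : ℝ => (a - c, b - x)))
    have hc2 : Continuous fun x => hR e (c, x) * th 1 (a - c) (b - x) :=
      ((hR_cont he).comp (by fun_prop : Continuous fun x : ℝ => (c, x))).mul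
        ((F.cont 1).comp (by fun_prop : Continuous fun x : ℝ => (a - c, b - x)))
    have := intervalIntegral.integral_eq_sub_of_hasDerivAt hd
      ((hc1.neg.sub hc2).intervalIntegrable _ _)
    have hc1n : Continuous fun x => -(k1R e (c, x) * th 0 (a - c) (b - x)) := hc1.neg
    rw [intervalIntegral.integral_sub (hc1n.intervalIntegrable _ _)
      (hc2.intervalIntegrable _ _), intervalIntegral.integral_neg] at this
    have hper : hR e (c, 2 * π) * th 0 (a - c) (b - 2 * π) - hR e (c, 0) * th 0 (a - c) (b - 0) = 0 := by
      have e1 : hR e (c, 2 * π) = hR e (c, 0) := by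
        have := Dn_per c 0
        rw [zero_add] at this
        simp [hR, this]
      have e2 := F.per 0 (a - c) (b - 2 * π)
      rw [e1, ← e2, sub_add_cancel, sub_zero]; ring
    rw [hper] at this
    linarith
  · simp [hN, hc]

lemma UU_zero_deriv1 {th : ℕ → ℝ → ℝ → ℝ} {M : ℝ} (hM : 0 ≤ M) (F : Fam th M)
    {ρ : ℝ} (hρ : 0 < ρ) (hρ1 : ρ ≤ 1) (a b : ℝ) :
    HasDerivAt (fun a => UU ρ th 0 a b) (VV ρ th 0 a b) a := by
  set ε : ℕ → ℝ := fun n => 1 / ((n : ℝ) + 1) with hε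
  have hε0 : ∀ n, 0 < ε n := fun n => by positivity
  have hεl : Filter.Tendsto ε Filter.atTop (nhds 0) := tendsto_one_div_add_atTop_nhds_zero_nat
  have hsplit : ∀ n a, conv (k1R (ε n)) (th 0) a b =
      -conv (hN (ε n) ρ) (th 1) a b + conv (hF (ε n) ρ) (th 0) a b := by
    intro n a
    obtain ⟨C, hC0, hC⟩ := k1R_glob (hε0 n)
    rw [← reg_ibp F (hε0 n) hρ1 a b]
    unfold conv
    rw [← integral_add]
    · congr 1; ext z
      by_cases h : |z.1| < ρ <;> simp [hF, h]
    · refine conv_integrable (C := M) (Measurable.ite (nset_meas ρ) (k1R_meas _) measurable_const)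
        (m2_int.const_mul C) (fun z => ?_) (F.cont 0) a b (fun z _ => F.bd _ _)
      split_ifs
      · exact hC z
      · simpa using mul_nonneg hC0 (m2_nonneg z)
    · exact conv_integrable (C := M) (hF_meas _ _)
        (m2r_int ρ) (hF_m2 (hε0 n).le hρ hρ1) (F.cont 0) a b (fun z _ => F.bd _ _)
  have tD : ∀ z : ℝ × ℝ, Filter.Tendsto (fun n => Dn z + ε n) Filter.atTop (nhds (Dn z + 0)) :=
    fun z => tendsto_const_nhds.add hεl
  -- convergence of kernels
  have l1 : Filter.Tendsto (fun n => ∫ z, |hN (ε n) ρ z - hN 0 ρ z| ∂mS) Filter.atTop (nhds 0) := by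
    have := tendsto_integral_of_dominated_convergence (μ := mS)
      (F := fun n z => |hN (ε n) ρ z - hN 0 ρ z|) (f := fun _ => 0) (fun z => 2 * m1 z)
      (fun n => (continuous_abs.measurable.comp
        ((hN_meas _ ρ).sub (hN_meas 0 ρ))).aestronglyMeasurable) (m1_int.const_mul 2)
      (fun n => Filter.Eventually.of_forall fun z => ?_) ?_
    · simpa using this
    · rw [Real.norm_eq_abs, abs_abs]
      have := hN_m1 (hε0 n).le hρ1 z
      have := hN_m1 le_rfl hρ1 z
      have := abs_sub (hN (ε n) ρ z) (hN 0 ρ z)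
      linarith
    · filter_upwards [ae_ne_mS] with z hz
      have hD := Dn_pos z hz
      have : Filter.Tendsto (fun n => hN (ε n) ρ z) Filter.atTop (nhds (hN 0 ρ z)) := by
        unfold hN; split_ifs
        · unfold hR
          exact tendsto_const_nhds.div ((tD z).const_mul 2) (by rw [add_zero]; positivity)
        · exact tendsto_const_nhds
      simpa using (this.sub_const (hN 0 ρ z)).abs
  have l2 : Filter.Tendsto (fun n => ∫ z, |hF (ε n) ρ z - hF 0 ρ z| ∂mS) Filter.atTop (nhds 0) := by
    have := tendsto_integral_of_dominated_convergence (μ := mS)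
      (F := fun n z => |hF (ε n) ρ z - hF 0 ρ z|) (f := fun _ => 0)
      (fun z => 2 * (ρ⁻¹ ^ 2 * m2 z))
      (fun n => (continuous_abs.measurable.comp
        ((hF_meas _ ρ).sub (hF_meas 0 ρ))).aestronglyMeasurable) ((m2r_int ρ).const_mul 2)
      (fun n => Filter.Eventually.of_forall fun z => ?_) ?_
    · simpa using this
    · rw [Real.norm_eq_abs, abs_abs]
      have := hF_m2 (hε0 n).le hρ hρ1 z
      have := hF_m2 le_rfl hρ hρ1 z
      have := abs_sub (hF (ε n) ρ z) (hF 0 ρ z)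
      linarith
    · filter_upwards [ae_ne_mS] with z hz
      have hD := Dn_pos z hz
      have : Filter.Tendsto (fun n => hF (ε n) ρ z) Filter.atTop (nhds (hF 0 ρ z)) := by
        unfold hF; split_ifs
        · exact tendsto_const_nhds
        · unfold k1R
          exact tendsto_const_nhds.div (((tD z).pow 2).const_mul 2) (by rw [add_zero]; positivity)
      simpa using (this.sub_const (hF 0 ρ z)).abs
  obtain ⟨C1, hC10, hC1⟩ := loc_bdd (F.cont 1) (F.per 1) a 2
  have hC1' : ∀ a' ∈ Metric.ball a 1, ∀ n z, hN n ρ z ≠ 0 → |th 1 (a' - z.1) (b - z.2)| ≤ C1 := by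
    intro a' ha' n z hz
    apply hC1
    have h1 := hN_supp hz
    rw [Metric.mem_ball, Real.dist_eq, abs_sub_comm] at ha'
    rw [show a - (a' - z.1) = (a - a') + z.1 by ring]
    refine (abs_add_le _ _).trans (by linarith)
  refine hasDerivAt_of_tendstoUniformlyOn (l := Filter.atTop) (s := Metric.ball a 1)
    (f := fun n a => conv (kR (ε n)) (th 0) a b) (f' := fun n a => conv (k1R (ε n)) (th 0) a b)
    (g' := fun a => VV ρ th 0 a b)
    Metric.isOpen_ball ?_ ?_ ?_ (Metric.mem_ball_self one_pos)
  · rw [Metric.tendstoUniformlyOn_iff]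
    intro δ hδ
    have l3 := (l1.const_mul C1).add (l2.const_mul M)
    simp only [mul_zero, add_zero] at l3
    filter_upwards [l3.eventually_lt_const hδ] with n hn a' ha'
    rw [hsplit, VV, Real.dist_eq]
    refine lt_of_le_of_lt ?_ hn
    have s1 : conv (hN (ε n) ρ) (th 1) a' b - conv (hN 0 ρ) (th 1) a' b =
        conv (fun z => hN (ε n) ρ z - hN 0 ρ z) (th 1) a' b := by
      unfold conv
      rw [← integral_sub]
      · congr 1; ext z; ring
      · exact conv_integrable (hN_meas _ ρ) m1_int (hN_m1 (hε0 n).le hρ1) (F.cont 1) a' b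
          (hC1' a' ha' _)
      · exact conv_integrable (hN_meas _ ρ) m1_int (hN_m1 le_rfl hρ1) (F.cont 1) a' b
          (hC1' a' ha' _)
    have s2 : conv (hF (ε n) ρ) (th 0) a' b - conv (hF 0 ρ) (th 0) a' b =
        conv (fun z => hF (ε n) ρ z - hF 0 ρ z) (th 0) a' b := by
      unfold conv
      rw [← integral_sub]
      · congr 1; ext z; ring
      · exact conv_integrable (C := M) (hF_meas _ ρ) (m2r_int ρ) (hF_m2 (hε0 n).le hρ hρ1)
          (F.cont 0) a' b (fun z _ => F.bd _ _)
      · exact conv_integrable (C := M) (hF_meas _ ρ) (m2r_int ρ) (hF_m2 le_rfl hρ hρ1)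
          (F.cont 0) a' b (fun z _ => F.bd _ _)
    have t1 : |conv (fun z => hN (ε n) ρ z - hN 0 ρ z) (th 1) a' b| ≤
        C1 * ∫ z, |hN (ε n) ρ z - hN 0 ρ z| ∂mS := by
      refine conv_abs_le hC10 ?_ (fun z => le_rfl) a' b (fun z hz => ?_)
      · have q1 : Integrable (hN (ε n) ρ) mS := m1_int.mono' (hN_meas _ ρ).aestronglyMeasurable
          (Filter.Eventually.of_forall (hN_m1 (hε0 n).le hρ1))
        have q2 : Integrable (hN 0 ρ) mS := m1_int.mono' (hN_meas _ ρ).aestronglyMeasurable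
          (Filter.Eventually.of_forall (hN_m1 le_rfl hρ1))
        exact (q1.sub q2).abs
      · by_cases h : hN 0 ρ z = 0
        · rw [h, sub_zero] at hz
          exact hC1' a' ha' _ z hz
        · exact hC1' a' ha' _ z h
    have t2 : |conv (fun z => hF (ε n) ρ z - hF 0 ρ z) (th 0) a' b| ≤
        M * ∫ z, |hF (ε n) ρ z - hF 0 ρ z| ∂mS := by
      refine conv_abs_le hM ?_ (fun z => le_rfl) a' b (fun z hz => F.bd _ _)
      have q1 : Integrable (hF (ε n) ρ) mS := (m2r_int ρ).mono' (hF_meas _ ρ).aestronglyMeasurable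
          (Filter.Eventually.of_forall (hF_m2 (hε0 n).le hρ hρ1))
      have q2 : Integrable (hF 0 ρ) mS := (m2r_int ρ).mono' (hF_meas _ ρ).aestronglyMeasurable
          (Filter.Eventually.of_forall (hF_m2 le_rfl hρ hρ1))
      exact (q1.sub q2).abs
    rw [← s1] at t1
    rw [← s2] at t2
    refine le_trans ?_ (add_le_add t1 t2)
    refine le_trans (le_of_eq ?_) (abs_sub _ _)
    congr 1; ring
  · exact Filter.Eventually.of_forall fun n a' _ => reg_deriv F (hε0 n) a' b
  · intro a' _
    simp only [UU]
    unfold conv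
    refine tendsto_integral_of_dominated_convergence (fun z => m1 z * M)
      (fun n => ((kR_meas _).mul (shiftcont (F.cont 0) a' b).measurable).aestronglyMeasurable)
      (m1_int.mul_const M) (fun n => Filter.Eventually.of_forall fun z => ?_) ?_
    · rw [Real.norm_eq_abs, abs_mul]
      exact mul_le_mul ((kR_abs_le (hε0 n).le z).trans (kR_m1 z)) (F.bd _ _) (abs_nonneg _)
        (m1_nonneg z)
    · filter_upwards [ae_ne_mS] with z hz
      have hD := Dn_pos z hz
      refine Filter.Tendsto.mul_const _ ?_
      unfold kR
      exact tendsto_const_nhds.div ((tD z).const_mul 2) (by rw [add_zero]; positivity)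

end


/-- Directional derivative. -/
noncomputable def dd (v : ℝ × (ℝ × ℝ)) (f : ℝ × (ℝ × ℝ) → ℝ) (x : ℝ × (ℝ × ℝ)) : ℝ :=
  fderiv ℝ f x v

def Om : Set (ℝ × (ℝ × ℝ)) := {p | 0 < p.1}

lemma Om_open : IsOpen Om := isOpen_lt continuous_const continuous_fst

def SmO (f : ℝ × (ℝ × ℝ) → ℝ) : Prop := ContDiffOn ℝ (⊤ : ℕ∞) f Om

lemma SmO.dd {f : ℝ × (ℝ × ℝ) → ℝ} (hf : SmO f) (v : ℝ × (ℝ × ℝ)) : SmO (dd v f) := by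
  have h : ContDiffOn ℝ (⊤ : ℕ∞) (fderiv ℝ f) Om := hf.fderiv_of_isOpen Om_open (by simp)
  exact h.clm_apply contDiffOn_const

lemma SmO.hasFDerivAt {f : ℝ × (ℝ × ℝ) → ℝ} (hf : SmO f) {x : ℝ × (ℝ × ℝ)} (hx : x ∈ Om) :
    HasFDerivAt f (fderiv ℝ f x) x :=
  ((ContDiffOn.contDiffAt hf (Om_open.mem_nhds hx)).differentiableAt (by simp)).hasFDerivAt

lemma dd_congr {f g : ℝ × (ℝ × ℝ) → ℝ} (h : ∀ x ∈ Om, f x = g x) (v : ℝ × (ℝ × ℝ)) :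
    ∀ x ∈ Om, dd v f x = dd v g x := by
  intro x hx
  unfold dd
  rw [Filter.EventuallyEq.fderiv_eq]
  filter_upwards [Om_open.mem_nhds hx] with y hy using h y hy

lemma dd_comm {f : ℝ × (ℝ × ℝ) → ℝ} (hf : SmO f) (v w : ℝ × (ℝ × ℝ)) :
    ∀ x ∈ Om, dd v (dd w f) x = dd w (dd v f) x := by
  intro x hx
  have hs : IsSymmSndFDerivAt ℝ f x :=
    (ContDiffOn.contDiffAt hf (Om_open.mem_nhds hx)).isSymmSndFDerivAt (by
      simp only [minSmoothness_of_isRCLikeNormedField]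
      exact WithTop.coe_le_coe.2 (le_top : (2 : ℕ∞) ≤ ⊤))
  have h : ContDiffOn ℝ (⊤ : ℕ∞) (fderiv ℝ f) Om := hf.fderiv_of_isOpen Om_open (by simp)
  have hd : DifferentiableAt ℝ (fderiv ℝ f) x :=
    (h.contDiffAt (Om_open.mem_nhds hx)).differentiableAt (by simp)
  have e : ∀ v w, dd v (dd w f) x = fderiv ℝ (fderiv ℝ f) x v w := by
    intro v w
    have h1 : HasFDerivAt (fun y => fderiv ℝ f y w)
      ((ContinuousLinearMap.apply ℝ ℝ w).comp (fderiv ℝ (fderiv ℝ f) x)) x :=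
      (ContinuousLinearMap.apply ℝ ℝ w).hasFDerivAt.comp x hd.hasFDerivAt
    have : dd v (dd w f) x = fderiv ℝ (fun y => fderiv ℝ f y w) x v := rfl
    rw [this, h1.fderiv]
    rfl
  rw [e, e]
  exact hs v w

def vt : ℝ × (ℝ × ℝ) := (1, (0, 0))
def v1 : ℝ × (ℝ × ℝ) := (0, (1, 0))
def v2 : ℝ × (ℝ × ℝ) := (0, (0, 1))

lemma SmO.ht {f : ℝ × (ℝ × ℝ) → ℝ} (hf : SmO f) {t : ℝ} (ht : 0 < t) (a b : ℝ) :
    HasDerivAt (fun t => f (t, (a, b))) (_root_.dd vt f (t, (a, b))) t := by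
  have h := hf.hasFDerivAt (x := (t, (a, b))) ht
  have h2 : HasDerivAt (fun t : ℝ => ((t, (a, b)) : ℝ × (ℝ × ℝ))) vt t :=
    (hasDerivAt_id t).prodMk (hasDerivAt_const t (a, b))
  exact h.comp_hasDerivAt t h2

lemma SmO.h1 {f : ℝ × (ℝ × ℝ) → ℝ} (hf : SmO f) {t : ℝ} (ht : 0 < t) (a b : ℝ) :
    HasDerivAt (fun a => f (t, (a, b))) (_root_.dd v1 f (t, (a, b))) a := by
  have h := hf.hasFDerivAt (x := (t, (a, b))) ht
  have h2 : HasDerivAt (fun a : ℝ => ((t, (a, b)) : ℝ × (ℝ × ℝ))) v1 a :=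
    (hasDerivAt_const a t).prodMk ((hasDerivAt_id a).prodMk (hasDerivAt_const a b))
  exact h.comp_hasDerivAt a h2

lemma SmO.h2 {f : ℝ × (ℝ × ℝ) → ℝ} (hf : SmO f) {t : ℝ} (ht : 0 < t) (a b : ℝ) :
    HasDerivAt (fun b => f (t, (a, b))) (_root_.dd v2 f (t, (a, b))) b := by
  have h := hf.hasFDerivAt (x := (t, (a, b))) ht
  have h2 : HasDerivAt (fun b : ℝ => ((t, (a, b)) : ℝ × (ℝ × ℝ))) v2 b :=
    (hasDerivAt_const b t).prodMk ((hasDerivAt_const b a).prodMk (hasDerivAt_id b))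
  exact h.comp_hasDerivAt b h2

noncomputable def thf (w : ℝ × (ℝ × ℝ) → ℝ) : ℕ → ℝ × (ℝ × ℝ) → ℝ
  | 0 => w
  | k + 1 => dd v2 (thf w k)

lemma thf_sm {w : ℝ × (ℝ × ℝ) → ℝ} (hw : SmO w) (k : ℕ) : SmO (thf w k) := by
  induction k with
  | zero => exact hw
  | succ k ih => exact ih.dd v2

/-- The solution package. -/
structure Sol (ν M : ℝ) (th p q r : ℕ → ℝ → ℝ → ℝ → ℝ) (u2 : ℝ → ℝ → ℝ → ℝ) : Prop where
  fam : ∀ t, 0 < t → Fam (fun k => th k t) M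
  cth : ∀ k, ContinuousOn (fun x : ℝ × (ℝ × ℝ) => th k x.1 x.2.1 x.2.2) Om
  cp : ∀ k, ContinuousOn (fun x : ℝ × (ℝ × ℝ) => p k x.1 x.2.1 x.2.2) Om
  cq : ∀ k, ContinuousOn (fun x : ℝ × (ℝ × ℝ) => q k x.1 x.2.1 x.2.2) Om
  cr : ∀ k, ContinuousOn (fun x : ℝ × (ℝ × ℝ) => r k x.1 x.2.1 x.2.2) Om
  h1 : ∀ k t, 0 < t → ∀ a b, HasDerivAt (fun a => th k t a b) (p k t a b) a
  h11 : ∀ k t, 0 < t → ∀ a b, HasDerivAt (fun a => p k t a b) (q k t a b) a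
  ht : ∀ k t, 0 < t → ∀ a b, HasDerivAt (fun t => th k t a b) (r k t a b) t
  p2 : ∀ k t, 0 < t → ∀ a b, HasDerivAt (p k t a) (p (k + 1) t a b) b
  q2 : ∀ k t, 0 < t → ∀ a b, HasDerivAt (q k t a) (q (k + 1) t a b) b
  r2 : ∀ k t, 0 < t → ∀ a b, HasDerivAt (r k t a) (r (k + 1) t a b) b
  pde : ∀ t, 0 < t → ∀ a b, r 0 t a b + UU 1 (fun k => th k t) 0 a b * p 0 t a b
    + u2 t a b * th 1 t a b = ν * (q 0 t a b + th 2 t a b)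
  div : ∀ t, 0 < t → ∀ a b, VV 1 (fun k => th k t) 0 a b + deriv (u2 t a) b = 0

lemma fam_mk {w : ℝ × (ℝ × ℝ) → ℝ} (hw : SmO w) {M : ℝ}
    (hper : ∀ t x1 x2, w (t, (x1, x2 + 2 * π)) = w (t, (x1, x2)))
    (hb : ∀ t, 0 < t → ∀ a b, |w (t, (a, b))| ≤ M) (t : ℝ) (ht : 0 < t) :
    Fam (fun k a b => thf w k (t, (a, b))) M where
  cont k := by
    have h := (thf_sm hw k).continuousOn
    exact h.comp_continuous (f := fun x : ℝ × ℝ => (t, (x.1, x.2))) (by fun_prop) (fun x => ht)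
  d2 k a b := (thf_sm hw k).h2 ht a b
  per k a b := by
    induction k generalizing b with
    | zero => exact hper t a b
    | succ k ih =>
      have e1 := (thf_sm hw k).h2 ht a (b + 2 * π)
      have e2 := (thf_sm hw k).h2 ht a b
      have e3 := e1.comp_add_const b (2 * π)
      simp only [ih] at e3
      exact e3.unique e2
  bd a b := hb t ht a b

lemma sol_mk {ν : ℝ} {ω : ℝ → ℝ × ℝ → ℝ} {u : ℝ → ℝ × ℝ → ℝ × ℝ}
    (hsmooth : ContDiffOn ℝ (⊤ : ℕ∞) (fun p : ℝ × (ℝ × ℝ) => ω p.1 p.2)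
      {p : ℝ × (ℝ × ℝ) | 0 < p.1})
    (hper : ∀ t x1 x2, ω t (x1, x2 + 2 * Real.pi) = ω t (x1, x2))
    {M : ℝ} (hM : 0 < M)
    (hPDE : ∀ t > (0 : ℝ), ∀ x : ℝ × ℝ,
      deriv (fun s => ω s x) t
        + (u t x).1 * deriv (fun a => ω t (a, x.2)) x.1
        + (u t x).2 * deriv (fun b => ω t (x.1, b)) x.2
      = ν * (deriv (deriv (fun a => ω t (a, x.2))) x.1
        + deriv (deriv (fun b => ω t (x.1, b))) x.2))
    (hdiv : ∀ t > (0 : ℝ), ∀ x : ℝ × ℝ,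
      deriv (fun a => (u t (a, x.2)).1) x.1 + deriv (fun b => (u t (x.1, b)).2) x.2 = 0)
    (hBS : ∀ t > (0 : ℝ), ∀ x : ℝ × ℝ, (u t x).1 = ∫ y in strip, K x y * ω t y)
    (hbounds : ∀ t ≥ (0 : ℝ), ∀ x, 0 ≤ ω t x ∧ ω t x ≤ M) :
    ∃ th p q r, Sol ν M th p q r (fun t a b => (u t (a, b)).2) ∧
      (∀ t a b, th 0 t a b = ω t (a, b)) := by
  set w : ℝ × (ℝ × ℝ) → ℝ := fun p => ω p.1 p.2 with hw
  have sw : SmO w := hsmooth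
  have hF := fam_mk sw (M := M) hper (fun t ht a b => by
    have := hbounds t ht.le (a, b)
    exact abs_le.2 ⟨by simp only [hw]; linarith, this.2⟩)
  have s1 : ∀ k, SmO (dd v1 (thf w k)) := fun k => (thf_sm sw k).dd v1
  have s11 : ∀ k, SmO (dd v1 (dd v1 (thf w k))) := fun k => (s1 k).dd v1
  have st : ∀ k, SmO (dd vt (thf w k)) := fun k => (thf_sm sw k).dd vt
  have hu1 : ∀ t, 0 < t → ∀ a b, (u t (a, b)).1 =
      UU 1 (fun k a b => thf w k (t, (a, b))) 0 a b := by
    intro t ht a b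
    have e := conv_swap (C := M) (f := fun a b => thf w 0 (t, (a, b))) (kR_meas 0) (kR_per 0) m1_int kR_m1 ((hF t ht).cont 0)
      ((hF t ht).per 0) a b (fun z _ => (hF t ht).bd _ _)
    rw [hBS t ht]
    simp only [UU]
    rw [e.2]
    unfold mS
    congr 1; ext y
    simp [K, kR, Dn, thf, hw]
  refine ⟨fun k t a b => thf w k (t, (a, b)), fun k t a b => dd v1 (thf w k) (t, (a, b)),
    fun k t a b => dd v1 (dd v1 (thf w k)) (t, (a, b)), fun k t a b => dd vt (thf w k) (t, (a, b)),
    ⟨hF, fun k => (thf_sm sw k).continuousOn, fun k => (s1 k).continuousOn,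
      fun k => (s11 k).continuousOn, fun k => (st k).continuousOn,
      fun k t ht a b => (thf_sm sw k).h1 ht a b, fun k t ht a b => (s1 k).h1 ht a b,
      fun k t ht a b => (thf_sm sw k).ht ht a b, ?_, ?_, ?_, ?_, ?_⟩, fun t a b => rfl⟩
  · intro k t ht a b
    refine ((s1 k).h2 ht a b).congr_deriv ?_
    exact dd_comm (thf_sm sw k) v2 v1 _ ht
  · intro k t ht a b
    refine ((s11 k).h2 ht a b).congr_deriv ?_
    rw [dd_comm (s1 k) v2 v1 _ ht]
    exact dd_congr (dd_comm (thf_sm sw k) v2 v1) v1 _ ht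
  · intro k t ht a b
    refine ((st k).h2 ht a b).congr_deriv ?_
    exact dd_comm (thf_sm sw k) v2 vt _ ht
  · intro t ht a b
    have h := hPDE t ht (a, b)
    simp only at h
    have e1 : deriv (fun a => ω t (a, b)) = fun a => dd v1 w (t, (a, b)) :=
      funext fun a => (sw.h1 ht a b).deriv
    have e2 : deriv (fun b => ω t (a, b)) = fun b => dd v2 w (t, (a, b)) :=
      funext fun b => (sw.h2 ht a b).deriv
    have e3 : deriv (fun s => ω s (a, b)) t = dd vt w (t, (a, b)) := (sw.ht ht a b).deriv
    rw [e1, e2, e3, ((sw.dd v1).h1 ht a b).deriv, ((sw.dd v2).h2 ht a b).deriv, hu1 t ht a b] at h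
    exact h
  · intro t ht a b
    have h := hdiv t ht (a, b)
    simp only at h
    simp_rw [hu1 t ht] at h
    rw [(UU_zero_deriv1 hM.le (hF t ht) one_pos le_rfl a b).deriv] at h
    exact h


noncomputable def leib (k : ℕ) (x y : ℕ → ℝ) : ℝ :=
  ∑ i ∈ Finset.range (k + 1), (k.choose i : ℝ) * (x i * y (k - i))

lemma leib_zero (x y : ℕ → ℝ) : leib 0 x y = x 0 * y 0 := by simp [leib]

lemma leib_deriv {x y : ℕ → ℝ → ℝ} {b : ℝ} (k : ℕ)
    (hx : ∀ i ≤ k, HasDerivAt (x i) (x (i + 1) b) b)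
    (hy : ∀ i ≤ k, HasDerivAt (y i) (y (i + 1) b) b) :
    HasDerivAt (fun b => leib k (fun i => x i b) (fun i => y i b))
      (leib (k + 1) (fun i => x i b) (fun i => y i b)) b := by
  unfold leib
  have h := HasDerivAt.fun_sum (u := Finset.range (k + 1))
    (A := fun i b => (k.choose i : ℝ) * (x i b * y (k - i) b))
    (A' := fun i => (k.choose i : ℝ) * (x (i + 1) b * y (k - i) b + x i b * y (k - i + 1) b))
    (x := b) (fun i hi => by
      have hi' : i ≤ k := by simpa [Nat.lt_succ_iff] using hi
      exact ((hx i hi').mul (hy (k - i) (by omega))).const_mul _)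
  refine h.congr_deriv ?_
  rw [Finset.sum_choose_succ_mul (fun i j => x i b * y j b), ← Finset.sum_add_distrib]
  refine Finset.sum_congr rfl fun i hi => ?_
  have hi' : i ≤ k := by simpa [Nat.lt_succ_iff] using hi
  rw [show k + 1 - i = k - i + 1 by omega]
  ring

lemma leib_cont {x y : ℕ → ℝ → ℝ} (k : ℕ)
    (hx : ∀ i ≤ k, Continuous (x i)) (hy : ∀ i ≤ k, Continuous (y i)) :
    Continuous (fun b => leib k (fun i => x i b) (fun i => y i b)) := by
  unfold leib
  refine continuous_finsetSum _ fun i hi => ?_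
  have hi' : i ≤ k := by simpa [Nat.lt_succ_iff] using hi
  exact continuous_const.mul ((hx i hi').mul (hy _ (by omega)))

lemma coll {N : ℕ} {G T : ℕ → ℝ → ℝ} {f : ℝ → ℝ}
    (hG : ∀ k < N, ∀ b, HasDerivAt (G k) (G (k + 1) b) b)
    (hGc : ∀ k ≤ N, Continuous (G k))
    (hT : ∀ k b, HasDerivAt (T k) (T (k + 1) b) b)
    (h0 : ∀ b, G 0 b = f b * T 0 b)
    (hf : 0 < N → ∀ b, T 0 b ≠ 0 → HasDerivAt f 0 b) (i j : ℕ) (hi : i ≤ N) (hj : j ≤ N) (b : ℝ) :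
    G i b * T j b = G j b * T i b := by
  have hTc : ∀ k, Continuous (T k) := fun k =>
    continuous_iff_continuousAt.2 fun b => (hT k b).continuousAt
  have hopen : IsOpen {b | T 0 b ≠ 0} := isOpen_ne_fun (hTc 0) continuous_const
  have key : ∀ k ≤ N, ∀ b, T 0 b ≠ 0 → G k b = f b * T k b := by
    intro k
    induction k with
    | zero => intro _ b _; exact h0 b
    | succ k ih =>
      intro hk b hb
      have e1 := hG k (by omega) b
      have e2 := (hf (by omega) b hb).mul (hT k b)
      have e3 : G k =ᶠ[nhds b] (f * T k) := by
        filter_upwards [hopen.mem_nhds hb] with c hc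
        exact ih (by omega) c hc
      have := e1.unique (e2.congr_of_eventuallyEq e3)
      rw [this]; ring
  by_cases hb : b ∈ closure {b | T 0 b ≠ 0}
  · have hcl : IsClosed {b | G i b * T j b = G j b * T i b} :=
      isClosed_eq ((hGc i hi).mul (hTc j)) ((hGc j hj).mul (hTc i))
    refine closure_minimal ?_ hcl hb
    intro c hc
    simp only [Set.mem_ofPred_eq]
    rw [key i hi c hc, key j hj c hc]; ring
  · have hO : IsOpen (closure {b | T 0 b ≠ 0})ᶜ := isClosed_closure.isOpen_compl
    have hz : ∀ c ∈ (closure {b | T 0 b ≠ 0})ᶜ, T 0 c = 0 := by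
      intro c hc
      by_contra h
      exact hc (subset_closure h)
    have hTz : ∀ k, ∀ c ∈ (closure {b | T 0 b ≠ 0})ᶜ, T k c = 0 := by
      intro k
      induction k with
      | zero => exact hz
      | succ k ih =>
        intro c hc
        have e3 : T k =ᶠ[nhds c] (fun _ => 0) := by
          filter_upwards [hO.mem_nhds hc] with d hd using ih d hd
        exact ((hT k c).unique ((hasDerivAt_const c (0 : ℝ)).congr_of_eventuallyEq e3))
    rw [hTz i b hb, hTz j b hb]; ring

lemma coll_sum {N : ℕ} {G th w : ℕ → ℝ}
    (hc : ∀ i ≤ N, ∀ j ≤ N, G i * th (j + 1) = G j * th (i + 1))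
    (h0 : th 1 = 0 → G 0 = 0)
    (hs : ∑ k ∈ Finset.range (N + 1), w k * (th k * th (k + 1)) = 0) :
    ∑ k ∈ Finset.range (N + 1), w k * (th k * G k) = 0 := by
  by_cases h : ∃ j ≤ N, th (j + 1) ≠ 0
  · obtain ⟨j, hj, hne⟩ := h
    have : ∀ k ∈ Finset.range (N + 1), w k * (th k * G k) =
        G j / th (j + 1) * (w k * (th k * th (k + 1))) := by
      intro k hk
      have hk' : k ≤ N := by simpa [Nat.lt_succ_iff] using hk
      have := hc k hk' j hj
      field_simp
      linear_combination (w k * th k) * this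
    rw [Finset.sum_congr rfl this, ← Finset.mul_sum, hs, mul_zero]
  · push Not at h
    refine Finset.sum_eq_zero fun k hk => ?_
    have hk' : k ≤ N := by simpa [Nat.lt_succ_iff] using hk
    cases k with
    | zero => rw [h0 (h 0 (by omega))]; ring
    | succ k => rw [h k (by omega)]; ring

section
variable {th : ℕ → ℝ → ℝ → ℝ} {M ρ : ℝ}

lemma UU_indep (F : Fam th M) (hρ : 0 < ρ) (N : ℕ) (hb : ∀ i < N, GB (th i)) :
    ∀ j ≤ N, UU ρ th j = UU 1 th j := by
  intro j
  induction j with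
  | zero => intro _; rfl
  | succ j ih =>
    intro hj
    ext a b
    have e1 := UU_deriv F hρ j (fun i hi => hb i (by omega)) a b
    have e2 := UU_deriv F one_pos j (fun i hi => hb i (by omega)) a b
    rw [ih (by omega)] at e1
    exact e1.unique e2

lemma VV_indep (hM : 0 ≤ M) (F : Fam th M) (hρ : 0 < ρ) (hρ1 : ρ ≤ 1) (N : ℕ)
    (hb : ∀ i < N, GB (th i)) : ∀ j < N, VV ρ th j = VV 1 th j := by
  intro j
  induction j with
  | zero =>
    intro _
    ext a b
    exact (UU_zero_deriv1 hM F hρ hρ1 a b).unique (UU_zero_deriv1 hM F one_pos le_rfl a b)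
  | succ j ih =>
    intro hj
    ext a b
    have e1 := VV_deriv F hρ hρ1 j (fun i hi => hb i (by omega)) a b
    have e2 := VV_deriv F one_pos le_rfl j (fun i hi => hb i (by omega)) a b
    rw [ih (by omega)] at e1
    exact e1.unique e2
end

/-- Fiber antiderivative sequence of the second velocity component. -/
noncomputable def vv (th : ℕ → ℝ → ℝ → ℝ) (a b0 : ℝ) : ℕ → ℝ → ℝ
  | 0 => fun b => ∫ x in b0..b, -VV 1 th 0 a x
  | j + 1 => fun b => -VV 1 th j a b

section
variable {ν M : ℝ} {th p q r : ℕ → ℝ → ℝ → ℝ → ℝ} {u2 : ℝ → ℝ → ℝ → ℝ}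

noncomputable def FF (ν : ℝ) (th p q r : ℕ → ℝ → ℝ → ℝ → ℝ) (t a : ℝ) (k : ℕ) (b : ℝ) : ℝ :=
  ν * (q k t a b + th (k + 2) t a b) - r k t a b
    - leib k (fun i => UU 1 (fun k => th k t) i a b) (fun i => p i t a b)

noncomputable def GG (ν : ℝ) (th p q r : ℕ → ℝ → ℝ → ℝ → ℝ) (t a b0 : ℝ) (k : ℕ) (b : ℝ) : ℝ :=
  FF ν th p q r t a k b - leib k (fun i => vv (fun k => th k t) a b0 i b) (fun i => th (i + 1) t a b)

lemma cont_of_deriv {f f' : ℝ → ℝ} (h : ∀ b, HasDerivAt f (f' b) b) : Continuous f :=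
  continuous_iff_continuousAt.2 fun b => (h b).continuousAt

lemma vv_zero_deriv {th : ℕ → ℝ → ℝ → ℝ} (F : Fam th M) (a b0 b : ℝ) :
    HasDerivAt (vv th a b0 0) (vv th a b0 1 b) b := by
  have hc : Continuous fun x => -VV 1 th 0 a x :=
    (VV_cont F one_pos le_rfl 0 ⟨M, F.bd⟩ a).neg
  exact intervalIntegral.integral_hasDerivAt_right (hc.intervalIntegrable _ _)
    (hc.stronglyMeasurableAtFilter _ _) hc.continuousAt

lemma vv_deriv {th : ℕ → ℝ → ℝ → ℝ} (F : Fam th M) (a b0 b : ℝ) (j : ℕ)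
    (hb : ∀ i ≤ j, GB (th i)) :
    HasDerivAt (vv th a b0 j) (vv th a b0 (j + 1) b) b := by
  cases j with
  | zero => exact vv_zero_deriv F a b0 b
  | succ j => exact (VV_deriv F one_pos le_rfl j hb a b).neg

lemma vv_cont {th : ℕ → ℝ → ℝ → ℝ} (F : Fam th M) (a b0 : ℝ) (j : ℕ)
    (hb : ∀ i < j, GB (th i)) : Continuous (vv th a b0 j) := by
  cases j with
  | zero => exact cont_of_deriv (vv_zero_deriv F a b0)
  | succ j => exact (VV_cont F one_pos le_rfl j (hb j (by omega)) a).neg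

lemma FF_zero (S : Sol ν M th p q r u2) {t : ℝ} (ht : 0 < t) (a b : ℝ) :
    FF ν th p q r t a 0 b = u2 t a b * th 1 t a b := by
  have := S.pde t ht a b
  simp only [FF, leib_zero]
  linarith

lemma FF_deriv (S : Sol ν M th p q r u2) {t : ℝ} (ht : 0 < t) (a b : ℝ) (k : ℕ)
    (hb : ∀ i ≤ k, GB (th i t)) :
    HasDerivAt (FF ν th p q r t a k) (FF ν th p q r t a (k + 1) b) b := by
  have F := S.fam t ht
  exact ((((S.q2 k t ht a b).add (F.d2 (k + 2) a b)).const_mul ν).sub (S.r2 k t ht a b)).sub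
    (leib_deriv (x := fun i b => UU 1 (fun k => th k t) i a b) (y := fun i b => p i t a b) k
      (fun i hi => UU_deriv F one_pos i (fun j hj => hb j (by omega)) a b)
      (fun i _ => S.p2 i t ht a b))

lemma GG_deriv (S : Sol ν M th p q r u2) {t : ℝ} (ht : 0 < t) (a b0 b : ℝ) (k : ℕ)
    (hb : ∀ i ≤ k, GB (th i t)) :
    HasDerivAt (GG ν th p q r t a b0 k) (GG ν th p q r t a b0 (k + 1) b) b := by
  have F := S.fam t ht
  exact (FF_deriv S ht a b k hb).sub
    (leib_deriv (x := fun i b => vv (fun k => th k t) a b0 i b)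
      (y := fun i b => th (i + 1) t a b) k
      (fun i hi => vv_deriv F a b0 b i (fun j hj => hb j (by omega)))
      (fun i _ => F.d2 (i + 1) a b))

lemma GG_cont (S : Sol ν M th p q r u2) {t : ℝ} (ht : 0 < t) (a b0 : ℝ) (k : ℕ)
    (hb : ∀ i < k, GB (th i t)) : Continuous (GG ν th p q r t a b0 k) := by
  have F := S.fam t ht
  have c1 := cont_of_deriv (S.q2 k t ht a)
  have c2 := cont_of_deriv (F.d2 (k + 2) a)
  have c3 := cont_of_deriv (S.r2 k t ht a)
  exact (((continuous_const.mul (c1.add c2)).sub c3).sub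
    (leib_cont (x := fun i b => UU 1 (fun k => th k t) i a b) (y := fun i b => p i t a b) k
      (fun i hi => UU_cont F one_pos i (fun j hj => hb j (by omega)) a)
      (fun i _ => cont_of_deriv (S.p2 i t ht a)))).sub
    (leib_cont (x := fun i b => vv (fun k => th k t) a b0 i b)
      (y := fun i b => th (i + 1) t a b) k
      (fun i hi => vv_cont F a b0 i (fun j hj => hb j (by omega)))
      (fun i _ => cont_of_deriv (F.d2 (i + 1) a)))

lemma GG_coll (S : Sol ν M th p q r u2) {t : ℝ} (ht : 0 < t) (a b0 : ℝ) (N : ℕ)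
    (hb : ∀ i < N, GB (th i t)) (i j : ℕ) (hi : i ≤ N) (hj : j ≤ N) (b : ℝ) :
    GG ν th p q r t a b0 i b * th (j + 1) t a b = GG ν th p q r t a b0 j b * th (i + 1) t a b := by
  have F := S.fam t ht
  have h0 : ∀ b, GG ν th p q r t a b0 0 b =
      (u2 t a b - vv (fun k => th k t) a b0 0 b) * th 1 t a b := by
    intro b
    simp only [GG, leib_zero]
    rw [FF_zero S ht]; ring
  refine coll (N := N) (G := GG ν th p q r t a b0) (T := fun k => th (k + 1) t a)
    (f := fun b => u2 t a b - vv (fun k => th k t) a b0 0 b)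
    (fun k hk b => GG_deriv S ht a b0 b k (fun i hi => hb i (by omega)))
    (fun k hk => GG_cont S ht a b0 k (fun i hi => hb i (by omega)))
    (fun k b => F.d2 (k + 1) a b) h0 ?_ i j hi hj b
  intro hN b hne
  have hd := (GG_deriv S ht a b0 b 0 (fun i hi => hb i (by omega))).div (F.d2 1 a b) hne
  have hd2 := hd.add (vv_zero_deriv F a b0 b)
  have hne' : ∀ᶠ c in nhds b, th 1 t a c ≠ 0 := (F.d2 1 a b).continuousAt.eventually_ne hne
  have hu : DifferentiableAt ℝ (u2 t a) b := by
    refine (hd2.congr_of_eventuallyEq ?_).differentiableAt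
    filter_upwards [hne'] with c hc
    simp only [Pi.add_apply, Pi.div_apply, h0]
    field_simp
    ring
  have h2 := hu.hasDerivAt.sub (vv_zero_deriv F a b0 b)
  refine h2.congr_deriv ?_
  have := S.div t ht a b
  simp only [vv]
  linarith
end


noncomputable def bb (σ : ℝ) (k : ℕ) : ℝ := σ ^ k / k.factorial

lemma bb_nonneg {σ : ℝ} (h : 0 ≤ σ) (k : ℕ) : 0 ≤ bb σ k := by unfold bb; positivity
lemma bb_pos {σ : ℝ} (h : 0 < σ) (k : ℕ) : 0 < bb σ k := by unfold bb; positivity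
lemma bb_zero (σ : ℝ) : bb σ 0 = 1 := by simp [bb]
lemma bb_succ (σ : ℝ) (k : ℕ) : bb σ (k + 1) * (k + 1) = σ * bb σ k := by
  unfold bb
  rw [Nat.factorial_succ]
  push_cast
  field_simp
  ring
lemma bb_choose (σ : ℝ) {k i : ℕ} (h : i ≤ k) : bb σ k * (k.choose i : ℝ) = bb σ i * bb σ (k - i) := by
  unfold bb
  rw [Nat.cast_choose ℝ h]
  have e : σ ^ k = σ ^ i * σ ^ (k - i) := by rw [← pow_add]; congr 1; omega
  rw [e]
  have := Nat.factorial_ne_zero k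
  field_simp

noncomputable def bb' (σ : ℝ) (k : ℕ) : ℝ := k * σ ^ (k - 1) / k.factorial
lemma bb_deriv (σ : ℝ) (k : ℕ) : HasDerivAt (fun σ => bb σ k) (bb' σ k) σ :=
  (hasDerivAt_pow k σ).div_const _
lemma bb'_mul (σ : ℝ) (k : ℕ) : bb' σ k * σ = k * bb σ k := by
  unfold bb bb'
  cases k with
  | zero => simp
  | succ k => simp only [Nat.add_sub_cancel, pow_succ]; ring

lemma leib_bd {σ Z : ℝ} (hσ : 0 ≤ σ) (k : ℕ) (x y : ℕ → ℝ) {φ : ℝ} (hφ : 0 ≤ φ)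
    (hZ : ∀ i < k, φ * (bb σ (i + 1) * |x (i + 1)|) ≤ Z) :
    φ * (bb σ k * |leib k x y - x 0 * y k|) ≤ Z * ∑ i ∈ Finset.range k, bb σ i * |y i| := by
  have e : leib k x y - x 0 * y k =
      ∑ i ∈ Finset.range k, (k.choose (i + 1) : ℝ) * (x (i + 1) * y (k - (i + 1))) := by
    unfold leib
    rw [Finset.sum_range_succ']; simp
  rw [e, ← Finset.sum_range_reflect (fun i => bb σ i * |y i|), Finset.mul_sum]
  have h1 := Finset.abs_sum_le_sum_abs
    (fun i => (k.choose (i + 1) : ℝ) * (x (i + 1) * y (k - (i + 1)))) (Finset.range k)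
  refine (mul_le_mul_of_nonneg_left (mul_le_mul_of_nonneg_left h1 (bb_nonneg hσ k)) hφ).trans ?_
  rw [Finset.mul_sum, Finset.mul_sum]
  refine Finset.sum_le_sum fun i hi => ?_
  have hi' : i < k := by simpa using hi
  rw [abs_mul, abs_mul, Nat.abs_cast]
  have e2 := bb_choose σ (k := k) (i := i + 1) hi'
  rw [show k - 1 - i = k - (i + 1) by omega]
  calc φ * (bb σ k * ((k.choose (i + 1) : ℝ) * (|x (i + 1)| * |y (k - (i + 1))|)))
      = φ * ((bb σ k * (k.choose (i + 1) : ℝ)) * (|x (i + 1)| * |y (k - (i + 1))|)) := by ring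
    _ = (φ * (bb σ (i + 1) * |x (i + 1)|)) * (bb σ (k - (i + 1)) * |y (k - (i + 1))|) := by
        rw [e2]; ring
    _ ≤ _ := mul_le_mul_of_nonneg_right (hZ i hi') (mul_nonneg (bb_nonneg hσ _) (abs_nonneg _))

lemma hardy (e : ℕ → ℝ) (N : ℕ) :
    ∑ n ∈ Finset.range N, e n * (∑ i ∈ Finset.range (n + 1), e i) / (n + 1)
      + 1 / 2 * ((∑ i ∈ Finset.range N, e i) ^ 2 / N) ≤ 2 * ∑ n ∈ Finset.range N, e n ^ 2 := by
  induction N with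
  | zero => simp
  | succ N ih =>
    rw [Finset.sum_range_succ (fun n => e n * (∑ i ∈ Finset.range (n + 1), e i) / ((n : ℝ) + 1)),
      Finset.sum_range_succ (fun n => e n ^ 2)]
    set T := ∑ n ∈ Finset.range N, e n * (∑ i ∈ Finset.range (n + 1), e i) / ((n : ℝ) + 1)
    set E := ∑ n ∈ Finset.range N, e n ^ 2
    rw [Finset.sum_range_succ e]
    set s := ∑ i ∈ Finset.range N, e i with hs
    push_cast
    have key : e N * (s + e N) / (N + 1) + 1 / 2 * ((s + e N) ^ 2 / (N + 1)) ≤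
        2 * e N ^ 2 + 1 / 2 * (s ^ 2 / N) := by
      rcases Nat.eq_zero_or_pos N with h | h
      · subst h
        simp only [hs, Finset.range_zero, Finset.sum_empty]
        norm_num
        nlinarith [sq_nonneg (e 0)]
      · have hN : (0 : ℝ) < N := by exact_mod_cast h
        have : 2 * e N ^ 2 + 1 / 2 * (s ^ 2 / N) -
          (e N * (s + e N) / (N + 1) + 1 / 2 * ((s + e N) ^ 2 / (N + 1))) =
          ((2 * N * e N - s) ^ 2 + N * e N ^ 2) / (2 * N * (N + 1)) := by
          field_simp; ring
        have : 0 ≤ ((2 * N * e N - s) ^ 2 + N * e N ^ 2) / (2 * N * ((N : ℝ) + 1)) := by positivity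
        linarith
    linarith

lemma sq_abs_le (x y : ℝ) : (|x| + |y|) ^ 2 ≤ 2 * (x ^ 2 + y ^ 2) := by
  nlinarith [sq_abs x, sq_abs y, sq_nonneg (|x| - |y|)]

set_option maxHeartbeats 2000000 in
/-- The pointwise Bernstein inequality. -/
lemma bern_ineq {ν σ A φ Y B : ℝ} {N : ℕ} (hν : 0 < ν) (hσ : 0 < σ) (hσ1 : σ ≤ 1)
    (hA : 1 ≤ A) (hφ : 0 ≤ φ) (hφ1 : φ ≤ 1) (hY : 0 ≤ Y) (hB : 0 ≤ B)
    {c c1 c2 th p q r U v G : ℕ → ℝ}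
    (hc : ∀ k < N + 1, c k = A) (hcN : c (N + 1) = φ ^ 4)
    (hc1 : ∀ k < N + 1, c1 k = 0) (hc1N : |c1 (N + 1)| ≤ 8 * φ ^ 2)
    (hc2 : ∀ k < N + 1, c2 k = 0) (hc2N : |c2 (N + 1)| ≤ 56)
    (hG : ∑ k ∈ Finset.range (N + 2), (c k * bb σ k ^ 2) * (th k * G k) = 0)
    (hr : ∀ k ≤ N + 1, r k = ν * (q k + th (k + 2)) - leib k U p
      - leib k v (fun i => th (i + 1)) - G k)
    (hv0 : v 0 = 0)
    (hU0 : |U 0| ≤ B)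
    (hU : ∀ i < N, bb σ (i + 1) * |U (i + 1)| ≤ Y)
    (hV : ∀ i < N, bb σ (i + 1) * |v (i + 1)| ≤ Y)
    (hUN : φ ^ 2 * (bb σ (N + 1) * |U (N + 1)|) ≤ A * Y)
    (hVN : φ ^ 2 * (bb σ (N + 1) * |v (N + 1)|) ≤ A * Y)
    (hQ22 : ∑ k ∈ Finset.range (N + 2),
      2 * c k * bb σ k ^ 2 * (th (k + 1) ^ 2 + th k * th (k + 2)) ≤ 0)
    (hsm : σ * (4 * Y + 2 + 8 * B + 184 * ν) ≤ ν) :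
    ∑ k ∈ Finset.range (N + 2), c k * (2 * bb σ k * bb' σ k * th k ^ 2 + bb σ k ^ 2 * (2 * th k * r k))
    ≤ B * |∑ k ∈ Finset.range (N + 2), (c1 k * (bb σ k ^ 2 * th k ^ 2) +
          c k * (bb σ k ^ 2 * (2 * th k * p k)))|
      + ν * ∑ k ∈ Finset.range (N + 2), (c2 k * (bb σ k ^ 2 * th k ^ 2) +
          2 * (c1 k * (bb σ k ^ 2 * (2 * th k * p k))) +
          c k * (bb σ k ^ 2 * (2 * (p k ^ 2 + th k * q k)))) := by
  set β := bb σ with hβ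
  have hβp : ∀ k, 0 < β k := bb_pos hσ
  set R : ℕ → ℝ := fun k => (leib k U p - U 0 * p k) +
    (leib k v (fun i => th (i + 1)) - v 0 * th (k + 1)) with hR
  set X : ℕ → ℝ := fun k => U 0 * (c1 k * (β k ^ 2 * th k ^ 2)) - 2 * c k * β k ^ 2 * th k * R k
    + 2 * c k * β k * bb' σ k * th k ^ 2 - ν * (c2 k * (β k ^ 2 * th k ^ 2))
    - 4 * ν * c1 k * β k ^ 2 * th k * p k - 2 * ν * c k * β k ^ 2 * (p k ^ 2 + th (k + 1) ^ 2)
    with hX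
  set e : ℕ → ℝ := fun k => β k * (|p k| + |th (k + 1)|) with he
  set f : ℕ → ℝ := fun k => β k * |th k| with hf
  set s : ℕ → ℝ := fun k => ∑ i ∈ Finset.range k, e i with hs
  have he0 : ∀ k, 0 ≤ e k := fun k => mul_nonneg (hβp k).le (by positivity)
  have hf0 : ∀ k, 0 ≤ f k := fun k => mul_nonneg (hβp k).le (by positivity)
  have hs0 : ∀ k, 0 ≤ s k := fun k => Finset.sum_nonneg fun i _ => he0 i
  have hfe : ∀ k : ℕ, ((k : ℝ) + 1) * f (k + 1) ≤ σ * e k := by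
    intro k
    have h1 := bb_succ σ k
    have : ((k : ℝ) + 1) * f (k + 1) = σ * β k * |th (k + 1)| := by
      simp only [hf]; rw [← h1]; ring
    rw [this]
    simp only [he]
    have : 0 ≤ σ * (β k * |p k|) := mul_nonneg hσ.le (mul_nonneg (hβp k).le (abs_nonneg _))
    nlinarith
  have hf2 : ∀ k, β k ^ 2 * th k ^ 2 = f k ^ 2 := fun k => by
    simp only [hf, mul_pow, sq_abs]
  have hRk : ∀ k, ∀ Z φ' : ℝ, 0 ≤ φ' → (∀ i < k, φ' * (β (i + 1) * |U (i + 1)|) ≤ Z) →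
      (∀ i < k, φ' * (β (i + 1) * |v (i + 1)|) ≤ Z) → φ' * (β k * |R k|) ≤ Z * s k := by
    intro k Z φ' hφ' h1 h2
    have e1 := leib_bd hσ.le k U p hφ' h1
    have e2 := leib_bd hσ.le k v (fun i => th (i + 1)) hφ' h2
    have e3 : s k = (∑ i ∈ Finset.range k, β i * |p i|) +
        ∑ i ∈ Finset.range k, β i * |th (i + 1)| := by
      rw [← Finset.sum_add_distrib]
      exact Finset.sum_congr rfl fun i _ => by simp only [he]; ring
    have e4 : φ' * (β k * |R k|) ≤ φ' * (β k * |leib k U p - U 0 * p k|) +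
        φ' * (β k * |leib k v (fun i => th (i + 1)) - v 0 * th (k + 1)|) := by
      rw [← mul_add, ← mul_add]
      exact mul_le_mul_of_nonneg_left (mul_le_mul_of_nonneg_left (abs_add_le _ _) (hβp k).le) hφ'
    rw [e3, mul_add]
    linarith
  -- the sum of remainders
  have hXk : ∀ k < N + 1, X k ≤ 2 * A * Y * (f k * s k) + 2 * A * (k / σ) * f k ^ 2
      - ν * A * e k ^ 2 := by
    intro k hk
    have h1 := hRk k Y 1 one_pos.le (fun i hi => by rw [one_mul]; exact hU i (by omega))
      (fun i hi => by rw [one_mul]; exact hV i (by omega))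
    rw [one_mul] at h1
    have h2 : bb' σ k = k / σ * β k := by
      rw [div_mul_eq_mul_div, eq_div_iff hσ.ne', bb'_mul]
    have h3 : -(β k ^ 2 * th k * R k) ≤ f k * (Y * s k) := by
      refine (neg_le_abs _).trans ?_
      have : |β k ^ 2 * th k * R k| = f k * (β k * |R k|) := by
        rw [abs_mul, abs_mul, abs_of_nonneg (sq_nonneg _)]; simp only [hf]; ring
      rw [this]
      exact mul_le_mul_of_nonneg_left h1 (hf0 k)
    have h4 : e k ^ 2 ≤ 2 * (β k ^ 2 * (p k ^ 2 + th (k + 1) ^ 2)) := by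
      simp only [he, mul_pow]
      have := mul_le_mul_of_nonneg_left (sq_abs_le (p k) (th (k + 1))) (sq_nonneg (β k))
      linarith
    simp only [hX]
    rw [hc k hk, hc1 k hk, hc2 k hk, h2]
    have h5 := mul_le_mul_of_nonneg_left h4 (mul_nonneg hν.le (zero_le_one.trans hA))
    have h6 := mul_le_mul_of_nonneg_left h3 (zero_le_one.trans hA)
    have h7 := hf2 k
    have h8 : 2 * A * β k * (k / σ * β k) * th k ^ 2 = 2 * A * (k / σ) * f k ^ 2 := by
      rw [← h7]; ring
    rw [h8]
    linarith
  have hXN : X (N + 1) ≤ 2 * A * Y * (f (N + 1) * s (N + 1))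
      + 2 * A * (((N : ℝ) + 1) / σ) * f (N + 1) ^ 2 + (8 * B + 184 * ν) * f (N + 1) ^ 2 := by
    have hφ2 : φ ^ 2 ≤ 1 := pow_le_one₀ hφ hφ1
    have hφ20 : 0 ≤ φ ^ 2 := sq_nonneg φ
    have hYA : Y ≤ A * Y := by nlinarith
    have aux : ∀ x, 0 ≤ x → x ≤ Y → φ ^ 2 * x ≤ A * Y := by
      intro x h0 h1; nlinarith
    have h1 := hRk (N + 1) (A * Y) (φ ^ 2) hφ20 (fun i hi => by
        rcases Nat.lt_or_ge i N with h | h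
        · exact aux _ (mul_nonneg (hβp _).le (abs_nonneg _)) (hU i h)
        · have : i = N := by omega
          subst this; exact hUN) (fun i hi => by
        rcases Nat.lt_or_ge i N with h | h
        · exact aux _ (mul_nonneg (hβp _).le (abs_nonneg _)) (hV i h)
        · have : i = N := by omega
          subst this; exact hVN)
    set n := N + 1 with hn
    have h2 : bb' σ n = ((N : ℝ) + 1) / σ * β n := by
      rw [div_mul_eq_mul_div, eq_div_iff hσ.ne', bb'_mul]
      change ((N + 1 : ℕ) : ℝ) * β n = _
      push_cast; ring
    have h3 : -(φ ^ 4 * β n ^ 2 * th n * R n) ≤ A * Y * (f n * s n) := by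
      refine (neg_le_abs _).trans ?_
      have : |φ ^ 4 * β n ^ 2 * th n * R n| = φ ^ 2 * f n * (φ ^ 2 * (β n * |R n|)) := by
        rw [abs_mul, abs_mul, abs_of_nonneg (by positivity)]; simp only [hf]; ring
      rw [this]
      calc φ ^ 2 * f n * (φ ^ 2 * (β n * |R n|)) ≤ φ ^ 2 * f n * (A * Y * s n) :=
            mul_le_mul_of_nonneg_left h1 (mul_nonneg hφ20 (hf0 n))
        _ ≤ 1 * f n * (A * Y * s n) := by
            have : 0 ≤ A * Y * s n := mul_nonneg (mul_nonneg (by linarith) hY) (hs0 n)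
            exact mul_le_mul_of_nonneg_right (mul_le_mul_of_nonneg_right hφ2 (hf0 n)) this
        _ = _ := by ring
    have hfn2 : 0 ≤ f n ^ 2 := sq_nonneg _
    have h4 : U 0 * (c1 n * f n ^ 2) ≤ 8 * B * f n ^ 2 := by
      refine (le_abs_self _).trans ?_
      rw [abs_mul, abs_mul, abs_of_nonneg hfn2]
      have : |c1 n| ≤ 8 := hc1N.trans (by linarith)
      calc |U 0| * (|c1 n| * f n ^ 2) ≤ B * (8 * f n ^ 2) :=
            mul_le_mul hU0 (mul_le_mul_of_nonneg_right this hfn2) (by positivity) hB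
        _ = _ := by ring
    have h5 : -(ν * (c2 n * f n ^ 2)) ≤ 56 * ν * f n ^ 2 := by
      have : -c2 n ≤ 56 := (neg_le_abs _).trans hc2N
      have := mul_le_mul_of_nonneg_right this (mul_nonneg hν.le hfn2)
      linarith
    have h6 : -(4 * ν * c1 n * β n ^ 2 * th n * p n) ≤
        2 * ν * φ ^ 4 * β n ^ 2 * p n ^ 2 + 128 * ν * f n ^ 2 := by
      refine (neg_le_abs _).trans ?_
      have : |4 * ν * c1 n * β n ^ 2 * th n * p n| = 4 * ν * |c1 n| * (f n * (β n * |p n|)) := by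
        simp only [abs_mul, abs_of_pos hν, abs_of_nonneg (sq_nonneg (β n)), hf]
        norm_num
        ring
      rw [this]
      have h7 : 4 * ν * |c1 n| * (f n * (β n * |p n|)) ≤
          4 * ν * (8 * φ ^ 2) * (f n * (β n * |p n|)) := by
        have : 0 ≤ f n * (β n * |p n|) :=
          mul_nonneg (hf0 n) (mul_nonneg (hβp n).le (abs_nonneg _))
        gcongr
      refine h7.trans ?_
      have h8 : φ ^ 4 * β n ^ 2 * p n ^ 2 = (φ ^ 2 * (β n * |p n|)) ^ 2 := by
        rw [mul_pow, mul_pow, sq_abs]; ring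
      have h9 := mul_nonneg hν.le (sq_nonneg (φ ^ 2 * (β n * |p n|) - 8 * f n))
      have : 2 * ν * φ ^ 4 * β n ^ 2 * p n ^ 2 = 2 * ν * (φ ^ 2 * (β n * |p n|)) ^ 2 := by
        rw [← h8]; ring
      rw [this]
      nlinarith
    have h10 : 0 ≤ 2 * ν * φ ^ 4 * β n ^ 2 * th (n + 1) ^ 2 := by positivity
    have h11 : 2 * φ ^ 4 * β n * (((N : ℝ) + 1) / σ * β n) * th n ^ 2 ≤
        2 * A * (((N : ℝ) + 1) / σ) * f n ^ 2 := by
      have : 2 * φ ^ 4 * β n * (((N : ℝ) + 1) / σ * β n) * th n ^ 2 =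
        2 * φ ^ 4 * (((N : ℝ) + 1) / σ) * f n ^ 2 := by rw [← hf2 n]; ring
      rw [this]
      have : φ ^ 4 ≤ A := (pow_le_one₀ hφ hφ1).trans hA
      gcongr
    simp only [hX]
    rw [hcN, h2, hf2 n]
    linarith
  have hid : ∑ k ∈ Finset.range (N + 2),
      c k * (2 * β k * bb' σ k * th k ^ 2 + β k ^ 2 * (2 * th k * r k)) =
      -U 0 * (∑ k ∈ Finset.range (N + 2), (c1 k * (β k ^ 2 * th k ^ 2) +
          c k * (β k ^ 2 * (2 * th k * p k))))
      + ν * (∑ k ∈ Finset.range (N + 2), (c2 k * (β k ^ 2 * th k ^ 2) +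
          2 * (c1 k * (β k ^ 2 * (2 * th k * p k))) +
          c k * (β k ^ 2 * (2 * (p k ^ 2 + th k * q k)))))
      + ν * (∑ k ∈ Finset.range (N + 2),
      2 * c k * β k ^ 2 * (th (k + 1) ^ 2 + th k * th (k + 2)))
      - 2 * (∑ k ∈ Finset.range (N + 2), (c k * β k ^ 2) * (th k * G k))
      + ∑ k ∈ Finset.range (N + 2), X k := by
    simp only [Finset.mul_sum, ← Finset.sum_add_distrib, ← Finset.sum_sub_distrib]
    refine Finset.sum_congr rfl fun k hk => ?_
    have hk' : k ≤ N + 1 := by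
      have := Finset.mem_range.1 hk; omega
    rw [hr k hk']
    simp only [hX, hR, hv0]
    ring
  clear_value X s e f
  have hXsum : ∑ k ∈ Finset.range (N + 2), X k ≤ 0 := by
    set E := ∑ k ∈ Finset.range (N + 1), e k ^ 2 with hE
    have hE0 : 0 ≤ E := Finset.sum_nonneg fun _ _ => sq_nonneg _
    have b1 : ∑ k ∈ Finset.range (N + 2), X k ≤
        ∑ k ∈ Finset.range (N + 2), (2 * A * Y * (f k * s k) + 2 * A * (k / σ) * f k ^ 2)
        - ν * A * E + (8 * B + 184 * ν) * f (N + 1) ^ 2 := by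
      rw [Finset.sum_range_succ, Finset.sum_range_succ _ (N + 1)]
      have := Finset.sum_le_sum (s := Finset.range (N + 1))
        (fun k hk => hXk k (Finset.mem_range.1 hk))
      rw [Finset.sum_sub_distrib, ← Finset.mul_sum] at this
      push_cast
      linarith
    have b2 : ∑ k ∈ Finset.range (N + 2), (2 * A * Y * (f k * s k) + 2 * A * (k / σ) * f k ^ 2)
        ≤ 2 * A * Y * σ * (2 * E) + 2 * A * σ * E := by
      rw [Finset.sum_range_succ']
      have z : 2 * A * Y * (f 0 * s 0) + 2 * A * (((0 : ℕ) : ℝ) / σ) * f 0 ^ 2 = 0 := by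
        simp [hs]
      rw [z, add_zero]
      have hh := hardy e (N + 1)
      have hpos : 0 ≤ 1 / 2 * ((∑ i ∈ Finset.range (N + 1), e i) ^ 2 / ((N + 1 : ℕ) : ℝ)) := by
        positivity
      have : ∀ n ∈ Finset.range (N + 1), (2 * A * Y * (f (n + 1) * s (n + 1)) +
          2 * A * (((n + 1 : ℕ) : ℝ) / σ) * f (n + 1) ^ 2) ≤
          2 * A * Y * σ * (e n * (∑ i ∈ Finset.range (n + 1), e i) / (n + 1)) +
          2 * A * σ * e n ^ 2 := by
        intro n _
        have hn : (0 : ℝ) < (n : ℝ) + 1 := by positivity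
        have hfn := hfe n
        have e1 : f (n + 1) ≤ σ * e n / (n + 1) := by
          rw [le_div_iff₀ hn]; linarith
        have e2 : f (n + 1) * s (n + 1) ≤
            σ * (e n * (∑ i ∈ Finset.range (n + 1), e i) / (n + 1)) := by
          refine (mul_le_mul_of_nonneg_right e1 (hs0 _)).trans (le_of_eq ?_)
          simp only [hs]; ring
        have e3 : ((n : ℝ) + 1) / σ * f (n + 1) ^ 2 ≤ σ * e n ^ 2 := by
          have e4 : f (n + 1) ≤ σ * e n := by
            have : f (n + 1) ≤ ((n : ℝ) + 1) * f (n + 1) := by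
              have := hf0 (n + 1)
              have : (0 : ℝ) ≤ n := by positivity
              nlinarith
            linarith
          have e5 : ((n : ℝ) + 1) / σ * f (n + 1) ^ 2 = (((n : ℝ) + 1) * f (n + 1)) * f (n + 1) / σ := by
            ring
          rw [e5, div_le_iff₀ hσ]
          calc (((n : ℝ) + 1) * f (n + 1)) * f (n + 1) ≤ (σ * e n) * (σ * e n) :=
                mul_le_mul hfn e4 (hf0 _) (mul_nonneg hσ.le (he0 n))
            _ = _ := by ring
        have hAY : 0 ≤ 2 * A * Y := by positivity
        have hA2 : 0 ≤ 2 * A := by positivity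
        have g1 := mul_le_mul_of_nonneg_left e2 hAY
        have g2 := mul_le_mul_of_nonneg_left e3 hA2
        push_cast
        linarith
      refine (Finset.sum_le_sum this).trans ?_
      rw [Finset.sum_add_distrib, ← Finset.mul_sum, ← Finset.mul_sum]
      have hh2 : ∑ n ∈ Finset.range (N + 1), e n * (∑ i ∈ Finset.range (n + 1), e i) / ((n : ℝ) + 1)
        ≤ 2 * E := by linarith
      have : 0 ≤ 2 * A * Y * σ := by positivity
      have := mul_le_mul_of_nonneg_left hh2 this
      linarith
    have b3 : f (N + 1) ^ 2 ≤ σ * E := by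
      have e4 : f (N + 1) ≤ σ * e N := by
        have h := hfe N
        have : f (N + 1) ≤ ((N : ℝ) + 1) * f (N + 1) := by
          have := hf0 (N + 1)
          have : (0 : ℝ) ≤ N := by positivity
          nlinarith
        linarith
      have e5 : e N ^ 2 ≤ E := by
        refine Finset.single_le_sum (f := fun k => e k ^ 2) (fun _ _ => sq_nonneg _) ?_
        simp
      have := hf0 (N + 1)
      calc f (N + 1) ^ 2 ≤ (σ * e N) ^ 2 := by gcongr
        _ = σ * (σ * e N ^ 2) := by ring
        _ ≤ σ * (1 * E) := by gcongr
        _ = _ := by ring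
    have b4 : (8 * B + 184 * ν) * f (N + 1) ^ 2 ≤ A * ((8 * B + 184 * ν) * (σ * E)) := by
      have : 0 ≤ (8 * B + 184 * ν) * (σ * E) := by positivity
      have := mul_le_mul_of_nonneg_left b3 (by positivity : 0 ≤ 8 * B + 184 * ν)
      nlinarith
    have b5 := mul_le_mul_of_nonneg_right hsm (mul_nonneg (zero_le_one.trans hA) hE0)
    linarith
  rw [hid, hG]
  have hU0' : -U 0 * (∑ k ∈ Finset.range (N + 2), (c1 k * (β k ^ 2 * th k ^ 2) +
          c k * (β k ^ 2 * (2 * th k * p k)))) ≤ B * |∑ k ∈ Finset.range (N + 2),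
          (c1 k * (β k ^ 2 * th k ^ 2) + c k * (β k ^ 2 * (2 * th k * p k)))| := by
    refine (le_abs_self _).trans ?_
    rw [abs_mul, abs_neg]
    exact mul_le_mul_of_nonneg_right hU0 (abs_nonneg _)
  have := mul_nonpos_of_nonneg_of_nonpos hν.le hQ22
  linarith


lemma bb_antitone {σ : ℝ} (h : 0 ≤ σ) (h1 : σ ≤ 1) (k : ℕ) : bb σ (k + 1) ≤ bb σ k := by
  have e := bb_succ σ k
  have n0 := bb_nonneg h k
  have n1 := bb_nonneg h (k + 1)
  have : (0 : ℝ) ≤ k := Nat.cast_nonneg k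
  nlinarith

lemma vel_arith1 {b0 b1 M : ℝ} (hb1 : 0 < b1) (hb : b1 ≤ b0) (hM : 0 < M) :
    b1 * (C0 * (2 * M / b1 + (1 : ℝ)⁻¹ ^ 2 * (2 * M / b0))) ≤ 32 * M * C0 := by
  have hb0 : 0 < b0 := hb1.trans_le hb
  have e : b1 * (C0 * (2 * M / b1 + (1 : ℝ)⁻¹ ^ 2 * (2 * M / b0))) = C0 * (2 * M + 2 * M * (b1 / b0)) := by
    field_simp
  have h1 : b1 / b0 ≤ 1 := (div_le_one hb0).2 hb
  have := C0_nonneg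
  rw [e]
  have h2 : 2 * M * (b1 / b0) ≤ 2 * M := by nlinarith
  have h3 : C0 * (2 * M + 2 * M * (b1 / b0)) ≤ C0 * (4 * M) :=
    mul_le_mul_of_nonneg_left (by linarith) this
  nlinarith [mul_nonneg this hM.le]

lemma vel_arith2 {b0 b1 M φ Sv : ℝ} (hb1 : 0 < b1) (hb : b1 ≤ b0) (hM : 0 < M) (hφ : 0 < φ)
    (hS : 0 ≤ Sv) :
    φ ^ 2 * (b1 * (C0 * (4 * Sv / (φ ^ 2 * b1) + (φ / 4)⁻¹ ^ 2 * (2 * M / b0))))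
      ≤ (1 + Sv / (2 * M)) * (32 * M * C0) := by
  have hb0 : 0 < b0 := hb1.trans_le hb
  have e : φ ^ 2 * (b1 * (C0 * (4 * Sv / (φ ^ 2 * b1) + (φ / 4)⁻¹ ^ 2 * (2 * M / b0))))
     = C0 * (4 * Sv + 32 * M * (b1 / b0)) := by
    field_simp
    ring
  have h1 : b1 / b0 ≤ 1 := (div_le_one hb0).2 hb
  have := C0_nonneg
  rw [e]
  have e2 : (1 + Sv / (2 * M)) * (32 * M * C0) = C0 * (32 * M + 16 * Sv) := by
    field_simp
    ring
  rw [e2]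
  refine mul_le_mul_of_nonneg_left ?_ this
  nlinarith

set_option maxHeartbeats 2000000 in
lemma bern_step {ν M : ℝ} {th p q r : ℕ → ℝ → ℝ → ℝ → ℝ} {u2 : ℝ → ℝ → ℝ → ℝ}
    (S : Sol ν M th p q r u2) (hν : 0 < ν) (hM : 0 < M) {s τ : ℝ} (hs : 0 < s) (hτ : 0 < τ)
    (hτ1 : τ ≤ 1) (hsm : τ * (4 * (32 * M * C0) + 2 + 8 * (C0 * M) + 184 * ν) ≤ ν) (N : ℕ)
    (IH : ∀ k ≤ N, ∀ t ∈ Set.Icc s (s + τ), ∀ a b, bb (t - s) k * |th k t a b| ≤ 2 * M) :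
    ∀ t ∈ Set.Icc s (s + τ), ∀ a b, bb (t - s) (N + 1) * |th (N + 1) t a b| ≤ 2 * M := by
  intro t₀ ht₀ x0 y0
  have hC0 := C0_nonneg
  -- the maximum
  have hpos : ∀ t ∈ Set.Icc s (s + τ), 0 < t := fun t ht => hs.trans_le ht.1
  have hsub : Set.Icc s (s + τ) ×ˢ (Set.univ : Set (ℝ × ℝ)) ⊆ Om := by
    rintro ⟨t, x⟩ ⟨ht, _⟩; exact hpos t ht
  have hbbc : ∀ k, Continuous fun x : ℝ => bb (x - s) k := by
    intro k; unfold bb; fun_prop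
  set f : ℝ × (ℝ × ℝ) → ℝ := fun x => bph (x.2.1 - x0) ^ 2 *
    (bb (x.1 - s) (N + 1) * |th (N + 1) x.1 x.2.1 x.2.2|) with hf
  have hfc : ContinuousOn f (Set.Icc s (s + τ) ×ˢ Set.univ) := by
    refine ContinuousOn.mul ?_ (ContinuousOn.mul ?_ ?_)
    · have := bph_cont; exact Continuous.continuousOn (by fun_prop)
    · exact ((hbbc (N + 1)).comp continuous_fst).continuousOn
    · exact ((S.cth (N + 1)).mono hsub).abs
  obtain ⟨Sv, hSv0, hSv⟩ : ∃ Sv, 0 ≤ Sv ∧ (∀ t ∈ Set.Icc s (s + τ), ∀ a b,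
      bph (a - x0) ^ 2 * (bb (t - s) (N + 1) * |th (N + 1) t a b|) ≤ Sv) ∧
      ∃ t ∈ Set.Icc s (s + τ), ∃ a b,
       Sv = bph (a - x0) ^ 2 * (bb (t - s) (N + 1) * |th (N + 1) t a b|) := by
    have hcomp : IsCompact (Set.Icc s (s + τ) ×ˢ
        (Set.Icc (x0 - 1) (x0 + 1) ×ˢ Set.Icc 0 (2 * π))) :=
      isCompact_Icc.prod (isCompact_Icc.prod isCompact_Icc)
    have hne : (Set.Icc s (s + τ) ×ˢ
        (Set.Icc (x0 - 1) (x0 + 1) ×ˢ Set.Icc 0 (2 * π))).Nonempty :=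
      ⟨(s, (x0, 0)), ⟨le_rfl, by linarith⟩, ⟨by simp, by simp⟩, ⟨le_rfl, by positivity⟩⟩
    obtain ⟨⟨t1, a1, b1⟩, hm, hmax⟩ := hcomp.exists_isMaxOn hne
      (hfc.mono (Set.prod_mono le_rfl (Set.subset_univ _)))
    have hnn : 0 ≤ f (t1, (a1, b1)) := by
      have := bb_nonneg (σ := t1 - s) (by have := hm.1.1; simp at this; linarith) (N + 1)
      simp only [hf]; positivity
    refine ⟨f (t1, (a1, b1)), hnn, ?_, t1, hm.1, a1, b1, rfl⟩
    intro t ht a b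
    by_cases ha : |a - x0| ≤ 1
    · have hper : Function.Periodic (th (N + 1) t a) (2 * π) :=
        fun b => (S.fam t (hpos t ht)).per (N + 1) a b
      obtain ⟨c, hc, hc'⟩ := hper.exists_mem_Ico₀ (by positivity) b
      rw [hc']
      have h : (t, (a, c)) ∈ Set.Icc s (s + τ) ×ˢ
        (Set.Icc (x0 - 1) (x0 + 1) ×ˢ Set.Icc 0 (2 * π)) := by
        have := abs_le.1 ha
        exact ⟨ht, ⟨by linarith, by linarith⟩, hc.1, hc.2.le⟩
      exact hmax h
    · rw [bph_eq_zero (not_le.1 ha).le]; simpa using hnn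
  obtain ⟨hSv1, t₁, ht₁, a₁, b₁, hSve⟩ := hSv
  set A : ℝ := 1 + Sv / (2 * M) with hA
  have hA1 : 1 ≤ A := by rw [hA]; have : 0 ≤ Sv / (2 * M) := by positivity
                         linarith
  set c : ℕ → ℝ → ℝ := fun k a => if k < N + 1 then A else bmp (a - x0) with hc
  set c1 : ℕ → ℝ → ℝ := fun k a => if k < N + 1 then 0 else bmp1 (a - x0) with hc1
  set c2 : ℕ → ℝ → ℝ := fun k a => if k < N + 1 then 0 else bmp2 (a - x0) with hc2
  have hcd : ∀ k a, HasDerivAt (c k) (c1 k a) a := by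
    intro k a
    simp only [hc, hc1]
    split_ifs
    · exact hasDerivAt_const _ _
    · exact ((bmp_hasDerivAt (a - x0)).comp a ((hasDerivAt_id a).sub_const x0)).congr_deriv (mul_one _)
  have hcd1 : ∀ k a, HasDerivAt (c1 k) (c2 k a) a := by
    intro k a
    simp only [hc1, hc2]
    split_ifs
    · exact hasDerivAt_const _ _
    · exact ((bmp1_hasDerivAt (a - x0)).comp a ((hasDerivAt_id a).sub_const x0)).congr_deriv (mul_one _)
  have hcc : ∀ k, Continuous (c k) := fun k => cont_of_deriv (hcd k)
  have hc0 : ∀ k a, 0 ≤ c k a := by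
    intro k a; simp only [hc]; split_ifs
    · linarith
    · exact bmp_nonneg _
  have hcA : ∀ k a, c k a ≤ A := by
    intro k a; simp only [hc]; split_ifs
    · exact le_rfl
    · exact (bmp_le_one _).trans hA1
  have hbd1 : ∀ t, HasDerivAt (fun t : ℝ => t - s) 1 t := fun t => (hasDerivAt_id t).sub_const s
  have MP := max_principle (ν := ν) (B := C0 * M) (s := s) (T := s + τ) (Λ := 0) (m := A * M ^ 2)
    (C := ∑ k ∈ Finset.range (N + 2), (A * (2 * M) ^ 2 + Sv ^ 2))
    hν.le (by positivity) (by linarith)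
    (fun t a b => ∑ k ∈ Finset.range (N + 2), c k a * (bb (t - s) k ^ 2 * th k t a b ^ 2))
    (fun t a b => ∑ k ∈ Finset.range (N + 2), c k a * (2 * bb (t - s) k * bb' (t - s) k * th k t a b ^ 2
      + bb (t - s) k ^ 2 * (2 * th k t a b * r k t a b)))
    (fun t a b => ∑ k ∈ Finset.range (N + 2), (c1 k a * (bb (t - s) k ^ 2 * th k t a b ^ 2) +
          c k a * (bb (t - s) k ^ 2 * (2 * th k t a b * p k t a b))))
    (fun t a b => ∑ k ∈ Finset.range (N + 2), (c2 k a * (bb (t - s) k ^ 2 * th k t a b ^ 2) +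
          2 * (c1 k a * (bb (t - s) k ^ 2 * (2 * th k t a b * p k t a b))) +
          c k a * (bb (t - s) k ^ 2 * (2 * (p k t a b ^ 2 + th k t a b * q k t a b)))))
    (fun t a b => ∑ k ∈ Finset.range (N + 2), c k a * (bb (t - s) k ^ 2 *
      (2 * (th k t a b * th (k + 1) t a b))))
    (fun t a b => ∑ k ∈ Finset.range (N + 2), 2 * c k a * bb (t - s) k ^ 2 *
      (th (k + 1) t a b ^ 2 + th k t a b * th (k + 2) t a b))
    ?_ ?_ ?_ ?_ ?_ ?_ ?_ ?_ ?_ ?_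
  · -- conclusion
    have hSvA : Sv ^ 2 ≤ A * M ^ 2 := by
      have h := MP t₁ ht₁ a₁ b₁
      have h2 : c (N + 1) a₁ * (bb (t₁ - s) (N + 1) ^ 2 * th (N + 1) t₁ a₁ b₁ ^ 2) ≤
        ∑ k ∈ Finset.range (N + 2), c k a₁ * (bb (t₁ - s) k ^ 2 * th k t₁ a₁ b₁ ^ 2) :=
        Finset.single_le_sum (f := fun k => c k a₁ * (bb (t₁ - s) k ^ 2 * th k t₁ a₁ b₁ ^ 2))
          (fun k _ => mul_nonneg (hc0 k a₁) (by positivity)) (by simp)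
      have h3 : c (N + 1) a₁ * (bb (t₁ - s) (N + 1) ^ 2 * th (N + 1) t₁ a₁ b₁ ^ 2) = Sv ^ 2 := by
        rw [hSve, mul_pow, mul_pow, sq_abs]; simp only [hc, bmp, lt_irrefl, if_false]; ring
      linarith
    have hSv2 : Sv ≤ 2 * M := by
      have : A * M ^ 2 = M ^ 2 + Sv * M / 2 := by rw [hA]; field_simp
      by_contra hcon
      push Not at hcon
      nlinarith
    have := hSv1 t₀ ht₀ x0 y0
    simp [bph] at this
    linarith
  · -- continuity
    refine continuousOn_finsetSum _ fun k _ => ?_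
    refine ContinuousOn.mul ?_ (ContinuousOn.mul ?_ ?_)
    · exact ((hcc k).comp (continuous_fst.comp continuous_snd)).continuousOn
    · exact (((hbbc k).comp continuous_fst).pow 2).continuousOn
    · exact ((S.cth k).mono hsub).pow 2
  · intro t ht a b
    exact Finset.sum_congr rfl fun k _ => by rw [(S.fam t (hpos t ht)).per k a b]
  · intro t ht a b
    refine Finset.sum_le_sum fun k hk => ?_
    have hσ : 0 ≤ t - s := by linarith [ht.1]
    rcases Nat.lt_or_ge k (N + 1) with h | h
    · have h1 := IH k (by omega) t ht a b
      have h0 : 0 ≤ bb (t - s) k * |th k t a b| := mul_nonneg (bb_nonneg hσ k) (abs_nonneg _)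
      have h2 : bb (t - s) k ^ 2 * th k t a b ^ 2 ≤ (2 * M) ^ 2 := by
        rw [← sq_abs (th k t a b), ← mul_pow]; exact pow_le_pow_left₀ h0 h1 2
      have : c k a = A := if_pos h
      rw [this]
      have := mul_le_mul_of_nonneg_left h2 (by linarith : 0 ≤ A)
      have := sq_nonneg Sv
      linarith
    · have hk2 : k = N + 1 := by have := Finset.mem_range.1 hk; omega
      have h1 := hSv1 t ht a b
      have h0 : 0 ≤ bph (a - x0) ^ 2 * (bb (t - s) (N + 1) * |th (N + 1) t a b|) :=
        mul_nonneg (sq_nonneg _) (mul_nonneg (bb_nonneg hσ _) (abs_nonneg _))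
      have h2 := pow_le_pow_left₀ h0 h1 2
      rw [mul_pow, mul_pow, sq_abs] at h2
      rw [hk2]
      have : c (N + 1) a = (bph (a - x0) ^ 2) ^ 2 := by simp [hc, bmp]; ring
      rw [this]
      have : 0 ≤ A * (2 * M) ^ 2 := by positivity
      linarith
  · intro a b
    have : ∀ k, bb (s - s) (k + 1) = 0 := by intro k; simp [bb]
    rw [Finset.sum_range_succ']
    simp only [this]
    simp only [bb_zero]
    have h1 := (S.fam s hs).bd a b
    have h2 : th 0 s a b ^ 2 ≤ M ^ 2 := by rw [← sq_abs]; exact pow_le_pow_left₀ (abs_nonneg _) h1 2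
    have h3 : c 0 a = A := by simp [hc]
    rw [h3]; simp
    exact mul_le_mul_of_nonneg_left h2 (by linarith)
  · intro t ht a b
    have htp : 0 < t := hs.trans ht.1
    refine HasDerivAt.fun_sum fun k _ => ?_
    have h := ((((bb_deriv (t - s) k).comp t (hbd1 t)).pow 2).mul ((S.ht k t htp a b).pow 2)).const_mul (c k a)
    refine h.congr_deriv ?_
    simp [Function.comp]; try ring
  · intro t ht a b
    have htp : 0 < t := hs.trans ht.1
    refine HasDerivAt.fun_sum fun k _ => ?_
    have h := (hcd k a).mul (((S.h1 k t htp a b).pow 2).const_mul (bb (t - s) k ^ 2))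
    refine h.congr_deriv ?_
    simp
  · intro t ht a b
    have htp : 0 < t := hs.trans ht.1
    refine HasDerivAt.fun_sum fun k _ => ?_
    have h := ((hcd1 k a).mul (((S.h1 k t htp a b).pow 2).const_mul (bb (t - s) k ^ 2))).add
      ((hcd k a).mul ((((S.h1 k t htp a b).const_mul 2).mul (S.h11 k t htp a b)).const_mul (bb (t - s) k ^ 2)))
    refine h.congr_deriv ?_
    simp; ring
  · intro t ht a b
    have htp : 0 < t := hs.trans ht.1
    refine HasDerivAt.fun_sum fun k _ => ?_
    have h := (((((S.fam t htp).d2 k a b).pow 2).const_mul (bb (t - s) k ^ 2))).const_mul (c k a)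
    refine h.congr_deriv ?_
    push_cast; ring
  · intro t ht a b
    have htp : 0 < t := hs.trans ht.1
    refine HasDerivAt.fun_sum fun k _ => ?_
    have h := ((((((S.fam t htp).d2 k a b).mul ((S.fam t htp).d2 (k + 1) a b)).const_mul 2)).const_mul (bb (t - s) k ^ 2)).const_mul (c k a)
    refine h.congr_deriv ?_
    ring
  · intro t ht a b hQ2 hQ22
    have htp : 0 < t := hs.trans ht.1
    have htI : t ∈ Set.Icc s (s + τ) := ⟨ht.1.le, ht.2⟩
    have hσ : 0 < t - s := by linarith [ht.1]
    have hσ1 : t - s ≤ 1 := by linarith [ht.2]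
    have F := S.fam t htp
    have hthb : ∀ k ≤ N, ∀ a b, |th k t a b| ≤ 2 * M / bb (t - s) k := by
      intro k hk a b
      rw [le_div_iff₀ (bb_pos hσ k), mul_comm]
      exact IH k hk t htI a b
    have hGB : ∀ i < N + 1, GB (th i t) := fun i hi => ⟨_, hthb i (by omega)⟩
    have hb' := bb_antitone hσ.le hσ1
    have hφ0 := bph_nonneg (a - x0)
    have hφ1 := bph_le_one (a - x0)
    have hnear : bph (a - x0) ≠ 0 → ∀ a', |a - a'| ≤ bph (a - x0) / 4 → ∀ b, |th (N + 1) t a' b| ≤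
        4 * Sv / (bph (a - x0) ^ 2 * bb (t - s) (N + 1)) := by
      intro hφ a' ha' b
      have hφp : 0 < bph (a - x0) := lt_of_le_of_ne hφ0 (Ne.symm hφ)
      have h1 := bph_lip (a - x0) (a' - x0) (by simpa using ha')
      have h2 := hSv1 t htI a' b
      have hbp := bb_pos hσ (N + 1)
      have h3 : (bph (a - x0) / 2) ^ 2 ≤ bph (a' - x0) ^ 2 := pow_le_pow_left₀ (by positivity) h1 2
      have h4 := mul_le_mul_of_nonneg_right h3 (mul_nonneg hbp.le (abs_nonneg (th (N + 1) t a' b)))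
      rw [le_div_iff₀ (by positivity)]
      nlinarith
    have hM2 : ∀ k, 0 ≤ 2 * M / bb (t - s) k := fun k => div_nonneg (by positivity) (bb_nonneg hσ.le k)
    have hNN : 0 ≤ A * (32 * M * C0) := by positivity
    rw [add_zero]
    refine bern_ineq (σ := t - s) (A := A) (φ := bph (a - x0)) (Y := 32 * M * C0) (B := C0 * M) (N := N)
      (c := fun k => c k a) (c1 := fun k => c1 k a) (c2 := fun k => c2 k a)
      (th := fun k => th k t a b) (p := fun k => p k t a b) (q := fun k => q k t a b)
      (r := fun k => r k t a b) (U := fun i => UU 1 (fun k => th k t) i a b)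
      (v := fun i => vv (fun k => th k t) a b i b) (G := fun k => GG ν th p q r t a b k b)
      hν hσ hσ1 hA1 hφ0 hφ1 (by positivity) (by positivity)
      (fun k hk => if_pos hk) (by simp [hc, bmp]) (fun k hk => if_pos hk)
      (by simpa [hc1] using bmp1_abs (a - x0)) (fun k hk => if_pos hk)
      (by simpa [hc2] using bmp2_abs (a - x0)) ?_ ?_ ?_ ?_ ?_ ?_ ?_ ?_ hQ22 ?_
    · refine coll_sum (N := N + 1) (w := fun k => c k a * bb (t - s) k ^ 2)
        (th := fun k => th k t a b) (G := fun k => GG ν th p q r t a b k b) ?_ ?_ ?_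
      · intro i hi j hj
        exact GG_coll S htp a b (N + 1) hGB i j hi hj b
      · intro h
        simp only [GG, leib_zero, FF_zero S htp, h]; simp
      · have h : ∑ k ∈ Finset.range (N + 2), c k a * (bb (t - s) k ^ 2 *
          (2 * (th k t a b * th (k + 1) t a b))) = 2 * ∑ k ∈ Finset.range (N + 1 + 1),
            c k a * bb (t - s) k ^ 2 * (th k t a b * th (k + 1) t a b) := by
          rw [Finset.mul_sum]; exact Finset.sum_congr rfl fun k _ => by ring
        rw [h] at hQ2
        linarith
    · intro k _
      simp only [GG, FF]; ring
    · simp [vv]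
    · exact UU_zero_bd hM.le F a b
    · intro i hi
      have h := UU_bd (th := fun k => th k t) one_pos i a b (hM2 (i + 1)) (hM2 i)
        (fun a' _ b => hthb (i + 1) (by omega) a' b) (hthb i (by omega))
      exact (mul_le_mul_of_nonneg_left h (bb_nonneg hσ.le _)).trans
        (vel_arith1 (bb_pos hσ _) (hb' i) hM)
    · intro i hi
      have h := VV_bd (th := fun k => th k t) one_pos le_rfl i a b (hM2 (i + 1)) (hM2 i)
        (fun a' _ b => hthb (i + 1) (by omega) a' b) (hthb i (by omega))
      have e : |vv (fun k => th k t) a b (i + 1) b| = |VV 1 (fun k => th k t) i a b| := by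
        simp [vv]
      rw [e]
      exact (mul_le_mul_of_nonneg_left h (bb_nonneg hσ.le _)).trans
        (vel_arith1 (bb_pos hσ _) (hb' i) hM)
    · by_cases hφ : bph (a - x0) = 0
      · rw [hφ]; simpa using hNN
      have hφp : 0 < bph (a - x0) := lt_of_le_of_ne hφ0 (Ne.symm hφ)
      have h := UU_bd (th := fun k => th k t) (ρ := bph (a - x0) / 4) (by positivity) N a b
        (div_nonneg (by positivity) (mul_nonneg (by positivity) (bb_nonneg hσ.le _))) (hM2 N)
        (hnear hφ) (hthb N le_rfl)
      rw [UU_indep F (by positivity) (N + 1) hGB (N + 1) le_rfl] at h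
      refine (mul_le_mul_of_nonneg_left (mul_le_mul_of_nonneg_left h (bb_nonneg hσ.le _)) (sq_nonneg _)).trans ?_
      exact vel_arith2 (bb_pos hσ _) (hb' N) hM hφp hSv0
    · by_cases hφ : bph (a - x0) = 0
      · rw [hφ]; simpa using hNN
      have hφp : 0 < bph (a - x0) := lt_of_le_of_ne hφ0 (Ne.symm hφ)
      have h := VV_bd (th := fun k => th k t) (ρ := bph (a - x0) / 4) (by positivity) (by linarith) N a b
        (div_nonneg (by positivity) (mul_nonneg (by positivity) (bb_nonneg hσ.le _))) (hM2 N)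
        (hnear hφ) (hthb N le_rfl)
      rw [VV_indep hM.le F (by positivity) (by linarith) (N + 1) hGB N (by omega)] at h
      have e : |vv (fun k => th k t) a b (N + 1) b| = |VV 1 (fun k => th k t) N a b| := by
        simp [vv]
      rw [e]
      refine (mul_le_mul_of_nonneg_left (mul_le_mul_of_nonneg_left h (bb_nonneg hσ.le _)) (sq_nonneg _)).trans ?_
      exact vel_arith2 (bb_pos hσ _) (hb' N) hM hφp hSv0
    · refine le_trans (mul_le_mul_of_nonneg_right (by linarith [ht.2] : t - s ≤ τ) (by positivity)) hsm

lemma bern_all {ν M : ℝ} {th p q r : ℕ → ℝ → ℝ → ℝ → ℝ} {u2 : ℝ → ℝ → ℝ → ℝ}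
    (S : Sol ν M th p q r u2) (hν : 0 < ν) (hM : 0 < M) {t : ℝ} (ht : 0 < t) :
    ∃ δ > 0, ∀ n a b, |th n t a b| ≤ 2 * M * n.factorial / δ ^ n := by
  have hC0 := C0_nonneg
  set Z := 4 * (32 * M * C0) + 2 + 8 * (C0 * M) + 184 * ν with hZ
  have hZ0 : 0 < Z := by positivity
  obtain ⟨τ, hτ0, hτ1, hτt, hτZ⟩ : ∃ τ > 0, τ ≤ 1 ∧ τ < t ∧ τ * Z ≤ ν := by
    refine ⟨min 1 (min (t / 2) (ν / Z)), by positivity, min_le_left _ _, ?_, ?_⟩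
    · exact lt_of_le_of_lt ((min_le_right _ _).trans (min_le_left _ _)) (by linarith)
    · rw [← le_div_iff₀ hZ0]
      exact (min_le_right _ _).trans (min_le_right _ _)
  have key : ∀ N, ∀ k ≤ N, ∀ t' ∈ Set.Icc (t - τ) (t - τ + τ), ∀ a b,
      bb (t' - (t - τ)) k * |th k t' a b| ≤ 2 * M := by
    intro N
    induction N with
    | zero =>
      intro k hk t' ht' a b
      have : k = 0 := by omega
      subst this
      rw [bb_zero, one_mul]
      have : |th 0 t' a b| ≤ M := (S.fam t' (by linarith [ht'.1])).bd a b
      linarith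
    | succ N ih =>
      intro k hk t' ht' a b
      rcases Nat.lt_or_ge k (N + 1) with h | h
      · exact ih k (by omega) t' ht' a b
      · have : k = N + 1 := by omega
        subst this
        exact bern_step S hν hM (by linarith) hτ0 hτ1 hτZ N ih t' ht' a b
  refine ⟨τ, hτ0, fun n a b => ?_⟩
  have h := key n n le_rfl t ⟨by linarith, by linarith⟩ a b
  have e : bb (t - (t - τ)) n = τ ^ n / n.factorial := by unfold bb; congr 2; ring
  rw [e] at h
  have hp : 0 < τ ^ n := by positivity
  have hf : (0 : ℝ) < n.factorial := by positivity
  rw [le_div_iff₀ hp]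
  rw [div_mul_eq_mul_div, div_le_iff₀ hf] at h
  linarith


/-- mean of a convolution with an odd kernel -/
lemma conv_mean_zero {κ g : ℝ × ℝ → ℝ} {f : ℝ → ℝ → ℝ} {C : ℝ} (hκ : Measurable κ)
    (hκp : ∀ a, Function.Periodic (fun b => κ (a, b)) (2 * π))
    (hodd : ∀ a b, κ (a, -b) = - κ (a, b))
    (hg : Integrable g mS) (hκg : ∀ z, |κ z| ≤ g z)
    (hf : Continuous (fun x : ℝ × ℝ => f x.1 x.2)) (hp : ∀ a b, f a (b + 2 * π) = f a b)
    (hC : ∀ a b, |f a b| ≤ C) (a : ℝ) :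
    ∫ b in Set.Icc 0 (2 * π), conv κ f a b = 0 := by
  unfold conv
  have hI : Integrable (Function.uncurry fun (b : ℝ) (z : ℝ × ℝ) => κ z * f (a - z.1) (b - z.2))
      ((volume.restrict (Set.Icc 0 (2 * π))).prod mS) := by
    have h1 := (integrable_const (C : ℝ) (μ := volume.restrict (Set.Icc 0 (2 * π)))).mul_prod hg
    refine Integrable.mono' h1 ?_ (Filter.Eventually.of_forall ?_)
    · refine Measurable.aestronglyMeasurable ?_
      refine (hκ.comp measurable_snd).mul ?_
      exact (hf.comp (f := fun z : ℝ × (ℝ × ℝ) => (a - z.2.1, z.1 - z.2.2)) (by fun_prop)).measurable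
    · rintro ⟨b, z⟩
      simp only [Function.uncurry, norm_mul, Real.norm_eq_abs]
      rw [mul_comm]
      exact mul_le_mul (hC _ _) (hκg z) (abs_nonneg _) ((abs_nonneg _).trans (hC 0 0))
  rw [integral_integral_swap hI]
  have e1 : ∀ z : ℝ × ℝ, ∫ b in Set.Icc 0 (2 * π), κ z * f (a - z.1) (b - z.2)
      = κ z * ∫ b in Set.Icc 0 (2 * π), f (a - z.1) b := by
    intro z
    rw [integral_const_mul]
    congr 1
    rw [Icc_int_eq, Icc_int_eq, intervalIntegral.integral_comp_sub_right]
    have := (show Function.Periodic (f (a - z.1)) (2 * π) from fun b => hp _ b).intervalIntegral_add_eq (0 - z.2) 0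
    rw [zero_add] at this
    rw [← this]; congr 1; ring
  simp only [e1]
  have hI2 : Integrable (fun z : ℝ × ℝ => κ z * ∫ b in Set.Icc 0 (2 * π), f (a - z.1) b) mS := by
    have := hI.integral_prod_right
    refine this.congr (Filter.Eventually.of_forall fun z => ?_)
    exact e1 z
  rw [mS_eq] at hI2 ⊢
  rw [integral_prod _ hI2]
  have e2 : ∀ x : ℝ, ∫ y in Set.Icc 0 (2 * π), κ (x, y) * ∫ b in Set.Icc 0 (2 * π), f (a - x) b = 0 := by
    intro x
    rw [integral_mul_const]
    have h := per_sub_integral (hκp x) 0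
    simp only [zero_sub, hodd] at h
    rw [integral_neg] at h
    have : ∫ y in Set.Icc 0 (2 * π), κ (x, y) = 0 := by linarith
    rw [this, zero_mul]
  simp only [e2]
  simp

lemma VV_mean_zero {th : ℕ → ℝ → ℝ → ℝ} {M : ℝ} (F : Fam th M) (a : ℝ) :
    ∫ b in (0)..(2 * π), VV 1 th 0 a b = 0 := by
  have d1 := fun b => near_deriv F (hN_meas 0 1) m1_int (hN_m1 le_rfl le_rfl) (fun z => hN_supp) 0 a b
  obtain ⟨C1, h1⟩ := near_bd F (κ := hN 0 1) (ρ := 1) (fun z => hN_supp) 1 a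
  have c1 : Continuous fun b => conv (hN 0 1) (th 1) a b :=
    conv_cont (hN_meas 0 1) m1_int (hN_m1 le_rfl le_rfl) (F.cont 1) a h1
  have c2 : Continuous fun b => conv (hF 0 1) (th 0) a b :=
    conv_cont (hF_meas 0 1) (m2r_int 1) (hF_m2 le_rfl one_pos le_rfl) (F.cont 0) a
      (fun z _ b => F.bd _ b)
  have i1 : ∫ b in (0)..(2 * π), conv (hN 0 1) (th 1) a b = 0 := by
    rw [intervalIntegral.integral_eq_sub_of_hasDerivAt (fun b _ => d1 b) (c1.intervalIntegrable _ _)]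
    have := conv_per (κ := hN 0 1) (F.per 0) a 0
    rw [zero_add] at this
    rw [this, sub_self]
  have i2 : ∫ b in (0)..(2 * π), conv (hF 0 1) (th 0) a b = 0 := by
    rw [← Icc_int_eq]
    refine conv_mean_zero (hF_meas 0 1) ?_ ?_ (m2r_int 1) (hF_m2 le_rfl one_pos le_rfl) (F.cont 0)
      (F.per 0) F.bd a
    · intro a b; simp only [hF, k1R, Dn_per, Real.sin_add_two_pi]
    · intro a b
      simp only [hF, k1R, Dn, Real.sin_neg, Real.cos_neg]
      split_ifs
      · simp
      · ring
  have : ∀ b, VV 1 th 0 a b = -conv (hN 0 1) (th 1) a b + conv (hF 0 1) (th 0) a b := fun b => rfl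
  simp only [this]
  rw [intervalIntegral.integral_add (f := fun b => -conv (hN 0 1) (th 1) a b) (c1.neg.intervalIntegrable _ _) (c2.intervalIntegrable _ _),
    intervalIntegral.integral_neg, i1, i2]; simp

section
variable {g : ℕ → ℝ → ℝ} {C δ : ℝ}

lemma flat_step (hg : ∀ k b, HasDerivAt (g k) (g (k + 1) b) b) (hδ : 0 < δ)
    (hb : ∀ n b, |g n b| ≤ C * n.factorial / δ ^ n) {b0 : ℝ} (h0 : ∀ k, g (k + 1) b0 = 0) :
    ∀ x ∈ Set.Icc b0 (b0 + δ / 2), g 1 x = 0 := by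
  have hC : 0 ≤ C := by have := (abs_nonneg _).trans (hb 0 0); simpa using this
  have key : ∀ n k : ℕ, ∀ y, ∀ x ∈ Set.Icc b0 y, |g (k + 1) x| ≤
      (C * (n + (k + 1)).factorial / δ ^ (n + (k + 1))) * ((x - b0) ^ n / n.factorial) := by
    intro n
    induction n with
    | zero => intro k y x _; have := hb (k + 1) x; simpa using this
    | succ n ih =>
      intro k y
      have := image_norm_le_of_norm_deriv_right_le_deriv_boundary (f := g (k + 1))
        (f' := g (k + 2)) (a := b0) (b := y)
        (B := fun x => (C * (n + 1 + (k + 1)).factorial / δ ^ (n + 1 + (k + 1))) *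
          ((x - b0) ^ (n + 1) / (n + 1).factorial))
        (B' := fun x => (C * (n + (k + 1 + 1)).factorial / δ ^ (n + (k + 1 + 1))) *
          ((x - b0) ^ n / n.factorial))
        (cont_of_deriv (hg (k + 1))).continuousOn
        (fun x _ => (hg (k + 1) x).hasDerivWithinAt) (by simp [h0]) ?_ ?_
      · intro x hx; exact this hx
      · intro x
        have h := (((((hasDerivAt_id x).sub_const b0).pow (n + 1)).div_const
          ((n + 1).factorial : ℝ))).const_mul (C * (n + 1 + (k + 1)).factorial / δ ^ (n + 1 + (k + 1)))
        refine h.congr_deriv ?_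
        have e : n + 1 + (k + 1) = n + (k + 1 + 1) := by ring
        rw [e]
        have : ((n + 1).factorial : ℝ) = (n + 1) * n.factorial := by
          rw [Nat.factorial_succ]; push_cast; ring
        rw [this]
        have h1 : (n.factorial : ℝ) ≠ 0 := by positivity
        have h2 : (n : ℝ) + 1 ≠ 0 := by positivity
        simp
        left
        field_simp
      · intro x hx
        exact ih (k + 1) y x ⟨hx.1, hx.2.le⟩
  intro x hx
  have hlim : Filter.Tendsto (fun n : ℕ => 2 * C / δ * (((n + 1 : ℕ) : ℝ) ^ 1 * (1 / 2 : ℝ) ^ (n + 1))) Filter.atTop (nhds 0) := by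
    have := (tendsto_pow_const_mul_const_pow_of_abs_lt_one 1 (r := 1 / 2) (by norm_num [abs_lt])).comp
      (Filter.tendsto_add_atTop_nat 1)
    simpa using this.const_mul (2 * C / δ)
  have hle : ∀ n : ℕ, |g 1 x| ≤ 2 * C / δ * (((n + 1 : ℕ) : ℝ) ^ 1 * (1 / 2 : ℝ) ^ (n + 1)) := by
    intro n
    refine (key n 0 _ x hx).trans ?_
    have h1 : (x - b0) ^ n ≤ (δ / 2) ^ n := pow_le_pow_left₀ (by linarith [hx.1]) (by linarith [hx.2]) n
    have h2 : C * (n + (0 + 1)).factorial / δ ^ (n + (0 + 1)) * ((x - b0) ^ n / n.factorial) ≤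
      C * (n + (0 + 1)).factorial / δ ^ (n + (0 + 1)) * ((δ / 2) ^ n / n.factorial) := by gcongr
    refine h2.trans (le_of_eq ?_)
    have : ((n + (0 + 1)).factorial : ℝ) = (n + 1) * n.factorial := by
      rw [zero_add, Nat.factorial_succ]; push_cast; ring
    rw [this]
    have h1 : (n.factorial : ℝ) ≠ 0 := by positivity
    push_cast
    rw [div_pow, one_div, inv_pow]
    field_simp
    ring
  have := ge_of_tendsto' hlim hle
  exact abs_eq_zero.1 (le_antisymm this (abs_nonneg _))

lemma flat_all (hg : ∀ k b, HasDerivAt (g k) (g (k + 1) b) b) (hδ : 0 < δ)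
    (hb : ∀ n b, |g n b| ≤ C * n.factorial / δ ^ n) (hp : ∀ b, g 1 (b + 2 * π) = g 1 b)
    {b0 : ℝ} (h0 : ∀ k, g (k + 1) b0 = 0) : ∀ x, g 1 x = 0 := by
  have step : ∀ b0, (∀ k, g (k + 1) b0 = 0) → ∀ k, g (k + 1) (b0 + δ / 4) = 0 := by
    intro b0 h0
    have h1 := flat_step hg hδ hb h0
    have : ∀ k, ∀ x ∈ Set.Ioo b0 (b0 + δ / 2), g (k + 1) x = 0 := by
      intro k
      induction k with
      | zero => intro x hx; exact h1 x ⟨hx.1.le, hx.2.le⟩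
      | succ k ih =>
        intro x hx
        have hz : HasDerivAt (g (k + 1)) 0 x :=
          (hasDerivAt_const x (0 : ℝ)).congr_of_eventuallyEq
            (Filter.eventually_of_mem (isOpen_Ioo.mem_nhds hx) ih)
        exact (hg (k + 1) x).unique hz
    intro k
    exact this k _ ⟨by linarith, by linarith⟩
  have iter : ∀ n : ℕ, ∀ k, g (k + 1) (b0 + n * (δ / 4)) = 0 := by
    intro n
    induction n with
    | zero => simpa using h0
    | succ n ih =>
      have := step _ ih
      intro k
      rw [← this k]; congr 1; push_cast; ring
  have right : ∀ x, b0 ≤ x → g 1 x = 0 := by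
    intro x hx
    set n := ⌊(x - b0) / (δ / 4)⌋₊ with hn
    have hd : 0 < δ / 4 := by positivity
    have e1 := Nat.floor_le (a := (x - b0) / (δ / 4)) (div_nonneg (by linarith) hd.le)
    have e2 := Nat.lt_floor_add_one ((x - b0) / (δ / 4))
    rw [← hn, le_div_iff₀ hd] at e1
    rw [← hn, div_lt_iff₀ hd] at e2
    exact flat_step hg hδ hb (iter n) x ⟨by linarith, by nlinarith⟩
  intro x
  obtain ⟨n, hn⟩ := exists_nat_ge ((b0 - x) / (2 * π))
  have hpi : 0 < 2 * π := by positivity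
  rw [div_le_iff₀ hpi] at hn
  have := (show Function.Periodic (g 1) (2 * π) from hp).nat_mul n x
  rw [← this]
  exact right _ (by linarith)

lemma fiber_abs {G : ℕ → ℝ → ℝ} (hg : ∀ k b, HasDerivAt (g k) (g (k + 1) b) b) (hδ : 0 < δ)
    (hb : ∀ n b, |g n b| ≤ C * n.factorial / δ ^ n) (hp : ∀ b, g 1 (b + 2 * π) = g 1 b)
    (hG : ∀ k b, HasDerivAt (G k) (G (k + 1) b) b)
    (hcoll : ∀ i j b, G i b * g (j + 1) b = G j b * g (i + 1) b)
    (h0 : ∀ b, g 1 b = 0 → G 0 b = 0) : ∃ c, ∀ b, G 0 b = c * g 1 b := by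
  by_cases hne : ∀ x, g 1 x = 0
  · exact ⟨0, fun b => by rw [h0 b (hne b), zero_mul]⟩
  push Not at hne
  obtain ⟨bs, hbs⟩ := hne
  set c := G 0 bs / g 1 bs with hc
  have hcl : IsClosed {b | ∀ k, G k b = c * g (k + 1) b} := by
    simp only [Set.ofPred_forall]
    exact isClosed_iInter fun k => isClosed_eq (cont_of_deriv (hG k))
      (continuous_const.mul (cont_of_deriv (hg (k + 1))))
  have hop : IsOpen {b | ∀ k, G k b = c * g (k + 1) b} := by
    rw [Metric.isOpen_iff]
    intro b1 hb1
    have hb1' : ∀ k, G k b1 = c * g (k + 1) b1 := hb1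
    obtain ⟨k, hk⟩ : ∃ k, g (k + 1) b1 ≠ 0 := by
      by_contra hcon
      push Not at hcon
      exact hbs (flat_all hg hδ hb hp hcon bs)
    have hev := (cont_of_deriv (hg (k + 1))).continuousAt.eventually_ne hk
    obtain ⟨ε, hε, hball⟩ := Metric.eventually_nhds_iff_ball.1 hev
    refine ⟨ε, hε, ?_⟩
    have hconst : ∀ x ∈ Metric.ball b1 ε, G k x / g (k + 1) x = c := by
      intro x hx
      have hd : ∀ y ∈ Metric.ball b1 ε, HasDerivWithinAt (fun y => G k y / g (k + 1) y) 0 (Metric.ball b1 ε) y := by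
        intro y hy
        have h := (hG k y).div (hg (k + 1) y) (hball y hy)
        refine (h.congr_deriv ?_).hasDerivWithinAt
        rw [hcoll (k + 1) k y, sub_self, zero_div]
      have h2 := (convex_ball b1 ε).norm_image_sub_le_of_norm_hasDerivWithin_le (C := 0) hd
        (by simp) (Metric.mem_ball_self hε) hx
      simp only [zero_mul] at h2
      have h3 : G k x / g (k + 1) x = G k b1 / g (k + 1) b1 := by
        have := norm_le_zero_iff.1 h2; linarith
      rw [h3, hb1' k]; field_simp
    intro x hx j
    have hx1 := hball x hx
    have hx2 := hconst x hx
    rw [div_eq_iff hx1] at hx2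
    have h3 := hcoll j k x
    rw [hx2] at h3
    have : (G j x - c * g (j + 1) x) * g (k + 1) x = 0 := by linarith
    rcases mul_eq_zero.1 this with h | h
    · linarith
    · exact absurd h hx1
  have huniv := IsClopen.eq_univ ⟨hcl, hop⟩ ⟨bs, fun k => by
    have := hcoll k 0 bs
    rw [hc, div_mul_eq_mul_div, eq_div_iff hbs, this]⟩
  refine ⟨c, fun b => ?_⟩
  have : b ∈ {b | ∀ k, G k b = c * g (k + 1) b} := by rw [huniv]; trivial
  exact this 0
end

/-- Fibre identity. -/
lemma fiber_id {ν M : ℝ} {th p q r : ℕ → ℝ → ℝ → ℝ → ℝ} {u2 : ℝ → ℝ → ℝ → ℝ}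
    (S : Sol ν M th p q r u2) (hν : 0 < ν) (hM : 0 < M) {t : ℝ} (ht : 0 < t) (a : ℝ) :
    ∫ b in (0)..(2 * π), FF ν th p q r t a 0 b =
      ∫ b in (0)..(2 * π), VV 1 (fun k => th k t) 0 a b * th 0 t a b := by
  have F := S.fam t ht
  obtain ⟨δ, hδ, hbd⟩ := bern_all S hν hM ht
  have hGB : ∀ i, GB (th i t) := fun i => ⟨_, hbd i⟩
  obtain ⟨c, hc⟩ := fiber_abs (g := fun k => th k t a) (C := 2 * M) (δ := δ)
    (G := fun k => GG ν th p q r t a 0 k) (fun k b => F.d2 k a b) hδ (fun n b => hbd n a b)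
    (fun b => F.per 1 a b) (fun k b => GG_deriv S ht a 0 b k (fun i _ => hGB i))
    (fun i j b => GG_coll S ht a 0 (max i j) (fun i _ => hGB i) i j (le_max_left _ _)
      (le_max_right _ _) b)
    (fun b h => by
      have h' : th 1 t a b = 0 := h
      simp only [GG, leib_zero, FF_zero S ht, h']; simp)
  have e1 : ∀ b, FF ν th p q r t a 0 b = (c + vv (fun k => th k t) a 0 0 b) * th 1 t a b := by
    intro b
    have := hc b
    simp only [GG, leib_zero, zero_add] at this
    linarith
  have hV : Continuous fun b => VV 1 (fun k => th k t) 0 a b :=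
    VV_cont F one_pos le_rfl 0 ⟨M, F.bd⟩ a
  have d : ∀ b, HasDerivAt (fun b => (c + vv (fun k => th k t) a 0 0 b) * th 0 t a b)
      (-(VV 1 (fun k => th k t) 0 a b) * th 0 t a b
        + (c + vv (fun k => th k t) a 0 0 b) * th 1 t a b) b := fun b =>
    ((vv_zero_deriv F a 0 b).const_add c).mul (F.d2 0 a b)
  have cv : Continuous (vv (fun k => th k t) a 0 0) := vv_cont F a 0 0 (by simp)
  have c0 : Continuous (th 0 t a) := cont_of_deriv (fun b => F.d2 0 a b)
  have c1 : Continuous (th 1 t a) := cont_of_deriv (fun b => F.d2 1 a b)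
  have i1 : IntervalIntegrable (fun b => -(VV 1 (fun k => th k t) 0 a b) * th 0 t a b) volume 0 (2 * π) :=
    (hV.neg.mul c0).intervalIntegrable _ _
  have i2 : IntervalIntegrable (fun b => (c + vv (fun k => th k t) a 0 0 b) * th 1 t a b) volume 0 (2 * π) :=
    ((continuous_const.add cv).mul c1).intervalIntegrable _ _
  have h := intervalIntegral.integral_eq_sub_of_hasDerivAt (fun b _ => d b) (i1.add i2)
  rw [intervalIntegral.integral_add i1 i2] at h
  simp only [e1]
  have z1 : vv (fun k => th k t) a 0 0 (2 * π) = 0 := by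
    simp only [vv, intervalIntegral.integral_neg, VV_mean_zero F a, neg_zero]
  have z2 : vv (fun k => th k t) a 0 0 0 = 0 := by simp [vv]
  have z3 : th 0 t a (2 * π) = th 0 t a 0 := by have := F.per 0 a 0; simpa using this
  rw [z1, z2, z3, sub_self] at h
  simp only [neg_mul, intervalIntegral.integral_neg] at h
  linarith


noncomputable def jb (a : ℝ) : ℝ := √(1 + a ^ 2)
lemma jb_pos (a : ℝ) : 0 < jb a := Real.sqrt_pos.2 (by positivity)
lemma jb_sq (a : ℝ) : jb a ^ 2 = 1 + a ^ 2 := Real.sq_sqrt (by positivity)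
lemma jb_ge (a : ℝ) : |a| ≤ jb a := Real.abs_le_sqrt (by linarith)
lemma jb_deriv (a : ℝ) : HasDerivAt jb (a / jb a) a := by
  have h := (((hasDerivAt_pow 2 a).const_add 1)).sqrt (by positivity)
  refine h.congr_deriv ?_
  unfold jb
  simp
  field_simp
lemma jb_deriv2 (a : ℝ) : HasDerivAt (fun a => a / jb a) (1 / jb a ^ 3) a := by
  have h := (hasDerivAt_id a).div (jb_deriv a) (jb_pos a).ne'
  refine h.congr_deriv ?_
  have h1 := jb_sq a
  have h2 := jb_pos a
  simp only [id]
  field_simp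
  linarith

/-- barrier -/
lemma barrier {ν M : ℝ} {th p q r : ℕ → ℝ → ℝ → ℝ → ℝ} {u2 : ℝ → ℝ → ℝ → ℝ}
    (S : Sol ν M th p q r u2) (hν : 0 < ν) (hM : 0 < M)
    (hcont : Continuous fun x : ℝ × (ℝ × ℝ) => th 0 x.1 x.2.1 x.2.2)
    (hper : ∀ t a b, th 0 t a (b + 2 * π) = th 0 t a b)
    (hbd : ∀ t ≥ 0, ∀ a b, th 0 t a b ≤ M)
    {Cb : ℝ} (hCb : 0 < Cb) (hsupp : ∀ a b, th 0 0 a b ≠ 0 → |a| ≤ Cb) :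
    ∃ C κ : ℝ, 0 < C ∧ 0 ≤ κ ∧ ∀ t ≥ 0, ∀ a b, th 0 t a b ≤ C * Real.exp (κ * t) * Real.exp (-|a|) := by
  have hC0 := C0_nonneg
  set B := C0 * M with hB
  have hB0 : 0 ≤ B := by positivity
  set κ := B + ν with hκ
  set C := M * Real.exp (jb Cb) with hC
  have hCp : 0 < C := by positivity
  refine ⟨C, κ, hCp, by positivity, ?_⟩
  intro T hT a b
  set E : ℝ → ℝ → ℝ := fun t a => C * (Real.exp (κ * t) * Real.exp (-jb a)) with hE
  have hEp : ∀ t a, 0 < E t a := fun t a => by simp only [hE]; positivity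
  have hjc : Continuous jb := cont_of_deriv jb_deriv
  have dE1 : ∀ t a, HasDerivAt (fun a => E t a) (-(E t a * (a / jb a))) a := by
    intro t a
    have h := (((jb_deriv a).neg.exp).const_mul (Real.exp (κ * t))).const_mul C
    refine h.congr_deriv ?_
    simp only [hE, Pi.neg_apply]; ring
  have MP := max_principle (ν := ν) (B := B) (s := 0) (T := T) (Λ := 0) (m := 0) (C := M)
    hν.le hB0 hT
    (fun t a b => th 0 t a b - E t a)
    (fun t a b => r 0 t a b - κ * E t a)
    (fun t a b => p 0 t a b - -(E t a * (a / jb a)))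
    (fun t a b => q 0 t a b - -(-(E t a * (a / jb a)) * (a / jb a) + E t a * (1 / jb a ^ 3)))
    (fun t a b => th 1 t a b)
    (fun t a b => th 2 t a b) ?_ ?_ ?_ ?_ ?_ ?_ ?_ ?_ ?_ ?_
  · have h := MP T ⟨hT, le_rfl⟩ a b
    have h2 : Real.exp (-jb a) ≤ Real.exp (-|a|) := Real.exp_le_exp.2 (by linarith [jb_ge a])
    have h3 := mul_le_mul_of_nonneg_left h2 (by positivity : 0 ≤ C * Real.exp (κ * T))
    simp only [hE] at h
    linarith
  · refine Continuous.continuousOn (hcont.sub ?_)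
    simp only [hE]; fun_prop
  · intro t _ a b; simp only [hper]
  · intro t ht a b
    have := hbd t ht.1 a b
    have := hEp t a
    linarith
  · intro a b
    by_cases h : th 0 0 a b = 0
    · rw [h]; have := hEp 0 a; linarith
    · have h1 := hsupp a b h
      have h2 := hbd 0 le_rfl a b
      have h3 : jb a ≤ jb Cb := by
        unfold jb; apply Real.sqrt_le_sqrt
        have := sq_le_sq' (by linarith [(abs_le.1 h1).1]) (abs_le.1 h1).2
        linarith
      have h4 : M ≤ E 0 a := by
        simp only [hE, hC, mul_zero, Real.exp_zero, one_mul]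
        rw [mul_assoc, ← Real.exp_add]
        have : 1 ≤ Real.exp (jb Cb + -jb a) := Real.one_le_exp (by linarith)
        nlinarith
      linarith
  · intro t ht a b
    refine (S.ht 0 t ht.1 a b).sub ?_
    have h := (((((hasDerivAt_id t).const_mul κ).exp).mul_const (Real.exp (-jb a)))).const_mul C
    refine h.congr_deriv ?_
    simp only [hE, id]; ring
  · intro t ht a b
    exact (S.h1 0 t ht.1 a b).sub (dE1 t a)
  · intro t ht a b
    exact (S.h11 0 t ht.1 a b).sub (((dE1 t a).mul (jb_deriv2 a)).neg)
  · intro t ht a b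
    exact ((S.fam t ht.1).d2 0 a b).sub_const _
  · intro t ht a b
    exact ((S.fam t ht.1).d2 1 a b)
  · intro t ht a b h1 h2
    have hp := S.pde t ht.1 a b
    have hU := UU_zero_bd (ρ := 1) hM.le (S.fam t ht.1) a b
    rw [← hB] at hU
    have h1' : th 1 t a b = 0 := h1
    have h2' : th 2 t a b ≤ 0 := h2
    rw [h1'] at hp
    have hy : |a / jb a| ≤ 1 := by
      rw [abs_div, abs_of_pos (jb_pos a)]; exact (div_le_one (jb_pos a)).2 (jb_ge a)
    have hE0 := hEp t a
    set y := a / jb a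
    set x := p 0 t a b
    set U := UU 1 (fun k => th k t) 0 a b
    have e1 : -(U * x) ≤ B * |x - -(E t a * y)| + B * E t a := by
      have f1 : -(U * x) ≤ |U| * |x| := by rw [← abs_mul]; exact neg_le_abs _
      have f2 : |x| ≤ |x - -(E t a * y)| + E t a := by
        have g1 : |x| ≤ |x - -(E t a * y)| + |E t a * y| := by
          have := abs_sub (x - -(E t a * y)) (E t a * y)
          simpa using this
        have g2 : |E t a * y| ≤ E t a := by
          rw [abs_mul, abs_of_pos hE0]; nlinarith
        linarith
      have f3 := mul_le_mul hU f2 (abs_nonneg _) hB0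
      linarith
    have e2 : -(-(E t a * y) * y + E t a * (1 / jb a ^ 3)) ≤ E t a := by
      have : 0 ≤ E t a * (1 / jb a ^ 3) := by have := jb_pos a; positivity
      have hyy : y * y ≤ 1 := by rw [← abs_mul_abs_self]; nlinarith [abs_nonneg y]
      nlinarith
    have e3 := mul_le_mul_of_nonneg_left e2 hν.le
    have e4 := mul_nonneg hν.le (neg_nonneg.2 h2')
    simp only [hκ]
    have hsum : r 0 t a b = ν * q 0 t a b + ν * th 2 t a b - U * x := by linarith
    rw [hsum]
    nlinarith

lemma conv_cont2 {κ g : ℝ × ℝ → ℝ} {f : ℝ → ℝ → ℝ} {C : ℝ} (hκ : Measurable κ)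
    (hg : Integrable g mS) (hκg : ∀ z, |κ z| ≤ g z)
    (hf : Continuous (fun x : ℝ × ℝ => f x.1 x.2)) (hC : ∀ a b, |f a b| ≤ C) :
    Continuous (fun x : ℝ × ℝ => conv κ f x.1 x.2) := by
  refine continuous_of_dominated (bound := fun z => g z * C) ?_ ?_ (hg.mul_const _) ?_
  · exact fun x => (hκ.mul (shiftcont hf x.1 x.2).measurable).aestronglyMeasurable
  · intro x
    refine Filter.Eventually.of_forall fun z => ?_
    rw [norm_mul]
    exact mul_le_mul (hκg z) (hC _ _) (abs_nonneg _) ((abs_nonneg _).trans (hκg z))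
  · refine Filter.Eventually.of_forall fun z => ?_
    exact continuous_const.mul (hf.comp (f := fun x : ℝ × ℝ => (x.1 - z.1, x.2 - z.2)) (by fun_prop))

lemma UU_zero_cont2 {th : ℕ → ℝ → ℝ → ℝ} {M : ℝ} (F : Fam th M) :
    Continuous (fun x : ℝ × ℝ => UU 1 th 0 x.1 x.2) :=
  conv_cont2 (kR_meas 0) m1_int kR_m1 (F.cont 0) F.bd

lemma VV_zero_cont2 {th : ℕ → ℝ → ℝ → ℝ} {M : ℝ} (F : Fam th M) (h : GB (th 1)) :
    Continuous (fun x : ℝ × ℝ => VV 1 th 0 x.1 x.2) := by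
  obtain ⟨C, hC⟩ := h
  exact (conv_cont2 (hN_meas 0 1) m1_int (hN_m1 le_rfl le_rfl) (F.cont 1) hC).neg.add
    (conv_cont2 (hF_meas 0 1) (m2r_int 1) (hF_m2 le_rfl one_pos le_rfl) (F.cont 0) F.bd)


/-- Compactly supported, twice continuously differentiable test function. -/
structure TF (R : ℝ) (ψ ψ1 ψ2 : ℝ → ℝ) : Prop where
  d1 : ∀ x, HasDerivAt ψ (ψ1 x) x
  d2 : ∀ x, HasDerivAt ψ1 (ψ2 x) x
  c2 : Continuous ψ2
  z0 : ∀ x, R < |x| → ψ x = 0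
  z1 : ∀ x, R < |x| → ψ1 x = 0
  z2 : ∀ x, R < |x| → ψ2 x = 0

lemma TF.c0 {R : ℝ} {ψ ψ1 ψ2 : ℝ → ℝ} (T : TF R ψ ψ1 ψ2) : Continuous ψ := cont_of_deriv T.d1
lemma TF.c1 {R : ℝ} {ψ ψ1 ψ2 : ℝ → ℝ} (T : TF R ψ ψ1 ψ2) : Continuous ψ1 := cont_of_deriv T.d2

lemma cs_int {f : ℝ × ℝ → ℝ} (hf : Continuous f) {R : ℝ} (hz : ∀ x : ℝ × ℝ, R < |x.1| → f x = 0) :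
    Integrable f mS := by
  have hc : IsCompact (Set.Icc (-R) R ×ˢ Set.Icc (0 : ℝ) (2 * π)) := isCompact_Icc.prod isCompact_Icc
  have h1 : IntegrableOn f (Set.Icc (-R) R ×ˢ Set.Icc (0 : ℝ) (2 * π)) :=
    hf.continuousOn.integrableOn_compact hc
  have hms : MeasurableSet strip := MeasurableSet.univ.prod measurableSet_Icc
  unfold mS
  change IntegrableOn f strip
  refine IntegrableOn.of_forall_sdiff_eq_zero h1 hms ?_
  intro x hx
  apply hz
  by_contra hc
  push Not at hc
  exact hx.2 ⟨abs_le.1 hc, hx.1.2⟩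

lemma cs_int1 {f : ℝ → ℝ} (hf : Continuous f) {R : ℝ} (hz : ∀ x : ℝ, R < |x| → f x = 0) :
    Integrable f := by
  have h1 : IntegrableOn f (Set.Icc (-R) R) :=
    hf.continuousOn.integrableOn_compact isCompact_Icc
  rw [← integrableOn_univ]
  refine IntegrableOn.of_forall_sdiff_eq_zero h1 MeasurableSet.univ ?_
  intro x hx
  apply hz
  by_contra hc
  push Not at hc
  exact hx.2 (abs_le.1 hc)

lemma cs_fub {f : ℝ × ℝ → ℝ} (hf : Integrable f mS) :
    ∫ x, f x ∂mS = ∫ a, ∫ b in (0)..(2 * π), f (a, b) := by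
  rw [mS_eq] at hf ⊢
  rw [integral_prod _ hf]
  simp only [Icc_int_eq]

lemma cs_ibp {ψ ψ1 : ℝ → ℝ} {R : ℝ} {G G1 : ℝ × ℝ → ℝ} (hd : ∀ x, HasDerivAt ψ (ψ1 x) x)
    (hc : Continuous ψ1) (z0 : ∀ x, R < |x| → ψ x = 0) (z1 : ∀ x, R < |x| → ψ1 x = 0)
    (hG : Continuous G) (hG1 : Continuous G1)
    (hGd : ∀ a b, HasDerivAt (fun a => G (a, b)) (G1 (a, b)) a) :
    ∫ x, ψ x.1 * G1 x ∂mS = - ∫ x, ψ1 x.1 * G x ∂mS := by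
  have c0 := cont_of_deriv hd
  have i1 : Integrable (fun x : ℝ × ℝ => ψ x.1 * G1 x) mS :=
    cs_int (R := R) (by fun_prop) (fun x hx => by rw [z0 _ hx, zero_mul])
  have i2 : Integrable (fun x : ℝ × ℝ => ψ1 x.1 * G x) mS :=
    cs_int (R := R) (by fun_prop) (fun x hx => by rw [z1 _ hx, zero_mul])
  rw [mS_eq] at i1 i2 ⊢
  rw [integral_prod_symm _ i1, integral_prod_symm _ i2, ← integral_neg]
  congr 1
  funext b
  have k1 : Continuous fun a => G (a, b) := by fun_prop
  have k2 : Continuous fun a => G1 (a, b) := by fun_prop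
  refine integral_mul_deriv_eq_deriv_mul_of_integrable (u := ψ) (v := fun a => G (a, b))
    (v' := fun a => G1 (a, b)) (fun x _ => hd x) (fun x _ => hGd x b) ?_ ?_ ?_
  · exact cs_int1 (R := R) (c0.mul k2) (fun x hx => by simp [z0 x hx])
  · exact cs_int1 (R := R) (hc.mul k1) (fun x hx => by simp [z1 x hx])
  · exact cs_int1 (R := R) (c0.mul k1) (fun x hx => by simp [z0 x hx])

section
variable {ν M : ℝ} {th p q r : ℕ → ℝ → ℝ → ℝ → ℝ} {u2 : ℝ → ℝ → ℝ → ℝ}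

lemma fixt {f : ℝ → ℝ → ℝ → ℝ}
    (h : ContinuousOn (fun x : ℝ × (ℝ × ℝ) => f x.1 x.2.1 x.2.2) Om) {t : ℝ} (ht : 0 < t) :
    Continuous (fun x : ℝ × ℝ => f t x.1 x.2) :=
  h.comp_continuous (f := fun x : ℝ × ℝ => (t, x)) (by fun_prop) (fun _ => ht)

lemma time_deriv (S : Sol ν M th p q r u2) {t : ℝ} (ht : 0 < t) {R : ℝ} {ψ : ℝ → ℝ}
    (hψ : Continuous ψ) (z0 : ∀ x, R < |x| → ψ x = 0) :
    HasDerivAt (fun t => ∫ x, th 0 t x.1 x.2 * ψ x.1 ∂mS) (∫ x, r 0 t x.1 x.2 * ψ x.1 ∂mS) t := by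
  have hc : IsCompact (Set.Icc (t / 2) (2 * t) ×ˢ
      (Set.Icc (-R) R ×ˢ Set.Icc (0 : ℝ) (2 * π))) :=
    isCompact_Icc.prod (isCompact_Icc.prod isCompact_Icc)
  obtain ⟨C, hC⟩ := hc.exists_bound_of_continuousOn ((S.cr 0).mono (fun x hx => by
    have := hx.1.1; change 0 < x.1; linarith))
  have hs : Set.Icc (t / 2) (2 * t) ∈ nhds t := Icc_mem_nhds (by linarith) (by linarith)
  have hms : MeasurableSet strip := MeasurableSet.univ.prod measurableSet_Icc
  refine (hasDerivAt_integral_of_dominated_loc_of_deriv_le (μ := mS)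
    (F := fun t x => th 0 t x.1 x.2 * ψ x.1) (F' := fun t x => r 0 t x.1 x.2 * ψ x.1)
    (bound := fun x => C * |ψ x.1|) hs ?_ ?_ ?_ ?_ ?_ ?_).2
  · filter_upwards [hs] with s hs'
    have hs0 : 0 < s := by linarith [hs'.1]
    have := fixt (S.cth 0) hs0
    exact (this.mul (hψ.comp continuous_fst)).aestronglyMeasurable
  · have := fixt (S.cth 0) ht
    exact cs_int (R := R) (this.mul (hψ.comp continuous_fst)) (fun x hx => by simp [z0 _ hx])
  · have := fixt (S.cr 0) ht
    exact (this.mul (hψ.comp continuous_fst)).aestronglyMeasurable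
  · unfold mS
    refine (ae_restrict_iff' hms).2 (Filter.Eventually.of_forall fun x hx s hs' => ?_)
    by_cases hR : R < |x.1|
    · simp [z0 _ hR]
    · push Not at hR
      rw [norm_mul]
      exact mul_le_mul_of_nonneg_right (hC (s, x) ⟨hs', abs_le.1 hR, hx.2⟩) (abs_nonneg _)
  · exact cs_int (R := R) (by fun_prop) (fun x hx => by simp [z0 _ hx])
  · refine Filter.Eventually.of_forall fun x s hs' => ?_
    have hs0 : 0 < s := by linarith [hs'.1]
    exact (S.ht 0 s hs0 x.1 x.2).mul_const _

lemma weak_id (S : Sol ν M th p q r u2) (hν : 0 < ν) (hM : 0 < M) {t : ℝ} (ht : 0 < t) {R : ℝ}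
    {ψ ψ1 ψ2 : ℝ → ℝ} (T : TF R ψ ψ1 ψ2) :
    HasDerivAt (fun t => ∫ x, th 0 t x.1 x.2 * ψ x.1 ∂mS)
      (ν * (∫ x, ψ2 x.1 * th 0 t x.1 x.2 ∂mS) +
        ∫ x, ψ1 x.1 * (UU 1 (fun k => th k t) 0 x.1 x.2 * th 0 t x.1 x.2) ∂mS) t := by
  have F := S.fam t ht
  obtain ⟨δ, hδ, hbd⟩ := bern_all S hν hM ht
  have gb : GB (th 1 t) := ⟨_, fun a b => hbd 1 a b⟩
  refine (time_deriv S ht T.c0 T.z0).congr_deriv ?_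
  have cθ := fixt (S.cth 0) ht
  have cθ2 := fixt (S.cth 2) ht
  have cp := fixt (S.cp 0) ht
  have cq := fixt (S.cq 0) ht
  have cr := fixt (S.cr 0) ht
  have cU := UU_zero_cont2 F
  have cV := VV_zero_cont2 F gb
  have cψ := T.c0
  have cψ1 := T.c1
  have cψ2 := T.c2
  set U := UU 1 (fun k => th k t) 0 with hU
  set V := VV 1 (fun k => th k t) 0 with hV
  have key : ∫ x, r 0 t x.1 x.2 * ψ x.1 ∂mS = ∫ x, ψ x.1 *
      (ν * q 0 t x.1 x.2 - (V x.1 x.2 * th 0 t x.1 x.2 + U x.1 x.2 * p 0 t x.1 x.2)) ∂mS := by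
    rw [cs_fub (cs_int (R := R) (by fun_prop) (fun x hx => by simp [T.z0 _ hx])),
      cs_fub (cs_int (R := R) (by fun_prop) (fun x hx => by simp [T.z0 _ hx]))]
    congr 1
    funext a
    simp only
    rw [intervalIntegral.integral_mul_const, intervalIntegral.integral_const_mul, mul_comm]
    congr 1
    have h := fiber_id S hν hM ht a
    simp only [FF, leib_zero] at h
    have k1 : Continuous fun b => r 0 t a b := cr.comp (Continuous.prodMk_right a)
    have k2 : Continuous fun b => q 0 t a b := cq.comp (Continuous.prodMk_right a)
    have k3 : Continuous fun b => p 0 t a b := cp.comp (Continuous.prodMk_right a)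
    have k4 : Continuous fun b => th 0 t a b := cθ.comp (Continuous.prodMk_right a)
    have k5 : Continuous fun b => th 2 t a b := cθ2.comp (Continuous.prodMk_right a)
    have k6 : Continuous fun b => U a b := cU.comp (Continuous.prodMk_right a)
    have k7 : Continuous fun b => V a b := cV.comp (Continuous.prodMk_right a)
    have z : ∫ b in (0)..(2 * π), th 2 t a b = 0 := by
      rw [intervalIntegral.integral_eq_sub_of_hasDerivAt (f := th 1 t a)
        (fun b _ => F.d2 1 a b) (k5.intervalIntegrable _ _)]
      have := F.per 1 a 0
      simp only [zero_add] at this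
      rw [this, sub_self]
    have e : ∀ b, r 0 t a b = (ν * q 0 t a b - (V a b * th 0 t a b + U a b * p 0 t a b)) +
        ν * th 2 t a b - ((ν * (q 0 t a b + th (0 + 2) t a b) - r 0 t a b - U a b * p 0 t a b)
          - V a b * th 0 t a b) := by intro b; ring
    have k5' : Continuous fun b => th (0 + 2) t a b := k5
    have ii : ∀ {f : ℝ → ℝ}, Continuous f → IntervalIntegrable f volume 0 (2 * π) :=
      fun h => h.intervalIntegrable _ _
    have h' : ∫ b in (0)..(2 * π), ((ν * (q 0 t a b + th (0 + 2) t a b) - r 0 t a b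
        - U a b * p 0 t a b) - V a b * th 0 t a b) = 0 := by
      rw [intervalIntegral.integral_sub (ii (by fun_prop)) (ii (by fun_prop))]
      exact sub_eq_zero.2 h
    rw [intervalIntegral.integral_congr (fun b _ => e b), intervalIntegral.integral_sub
      (ii (by fun_prop)) (ii (by fun_prop)), intervalIntegral.integral_add
      (ii (by fun_prop)) (ii (by fun_prop)), intervalIntegral.integral_const_mul, z, h']
    ring
  rw [key]
  have i1 := cs_ibp (G := fun x => ν * p 0 t x.1 x.2 - U x.1 x.2 * th 0 t x.1 x.2)
    (G1 := fun x => ν * q 0 t x.1 x.2 - (V x.1 x.2 * th 0 t x.1 x.2 + U x.1 x.2 * p 0 t x.1 x.2))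
    T.d1 T.c1 T.z0 T.z1 (by fun_prop) (by fun_prop) (fun a b =>
      ((S.h11 0 t ht a b).const_mul ν).sub
        ((UU_zero_deriv1 hM.le F one_pos le_rfl a b).mul (S.h1 0 t ht a b)))
  have i2 := cs_ibp (G := fun x => th 0 t x.1 x.2) (G1 := fun x => p 0 t x.1 x.2)
    T.d2 T.c2 T.z1 T.z2 (by fun_prop) (by fun_prop) (fun a b => S.h1 0 t ht a b)
  rw [i1]
  have j1 : Integrable (fun x : ℝ × ℝ => ν * (ψ1 x.1 * p 0 t x.1 x.2)) mS :=
    cs_int (R := R) (by fun_prop) (fun x hx => by simp [T.z1 _ hx])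
  have j2 : Integrable (fun x : ℝ × ℝ => ψ1 x.1 * (U x.1 x.2 * th 0 t x.1 x.2)) mS :=
    cs_int (R := R) (by fun_prop) (fun x hx => by simp [T.z1 _ hx])
  have e2 : ∫ x, ψ1 x.1 * (ν * p 0 t x.1 x.2 - U x.1 x.2 * th 0 t x.1 x.2) ∂mS =
      ν * (∫ x, ψ1 x.1 * p 0 t x.1 x.2 ∂mS) - ∫ x, ψ1 x.1 * (U x.1 x.2 * th 0 t x.1 x.2) ∂mS := by
    rw [← integral_const_mul, ← integral_sub j1 j2]
    congr 1; funext x; ring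
  rw [e2, i2]; ring
end


lemma cosh_shift (a d : ℝ) : Real.cosh (a + d) ≤ Real.cosh a * Real.exp |d| := by
  rw [Real.cosh_add]
  have h1 : |Real.sinh a| ≤ Real.cosh a := by
    rw [abs_le]; have := Real.cosh_add_sinh a; have := Real.cosh_sub_sinh a
    have := Real.exp_pos a; have := Real.exp_pos (-a); constructor <;> linarith
  have h2 : Real.sinh a * Real.sinh d ≤ Real.cosh a * |Real.sinh d| := by
    refine (le_abs_self _).trans ?_
    rw [abs_mul]; exact mul_le_mul_of_nonneg_right h1 (abs_nonneg _)
  have h3 : Real.exp |d| = Real.cosh d + |Real.sinh d| := by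
    rw [Real.abs_sinh, ← Real.cosh_abs d, Real.cosh_add_sinh]
  rw [h3]; linarith

lemma mv_bound {ψ1 ψ2 : ℝ → ℝ} {D ε : ℝ} (hD : 0 ≤ D) (hε : 0 ≤ ε)
    (hd : ∀ x, HasDerivAt ψ1 (ψ2 x) x) (hb : ∀ x, |ψ2 x| ≤ D * Real.cosh (ε * x)) (x y : ℝ) :
    |ψ1 x - ψ1 y| ≤ D * Real.cosh (ε * x) * Real.exp (ε * |x - y|) * |x - y| := by
  have h := Convex.norm_image_sub_le_of_norm_hasDerivWithin_le (𝕜 := ℝ) (s := Set.uIcc y x)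
    (f := ψ1) (f' := ψ2) (C := D * Real.cosh (ε * x) * Real.exp (ε * |x - y|)) (x := y) (y := x)
    (fun z _ => (hd z).hasDerivWithinAt) ?_ (convex_uIcc _ _) Set.left_mem_uIcc Set.right_mem_uIcc
  · exact h
  · intro z hz
    refine (hb z).trans ?_
    rw [mul_assoc]
    refine mul_le_mul_of_nonneg_left ?_ hD
    have h1 := cosh_shift (ε * x) (ε * (z - x))
    have h2 : |ε * (z - x)| ≤ ε * |x - y| := by
      rw [abs_mul, abs_of_nonneg hε]
      refine mul_le_mul_of_nonneg_left ?_ hε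
      rw [abs_sub_comm z x]
      have := Set.abs_sub_left_of_mem_uIcc hz
      have := Set.abs_sub_right_of_mem_uIcc hz
      rw [abs_sub_comm z y] at *
      linarith
    have e : ε * x + ε * (z - x) = ε * z := by ring
    rw [e] at h1
    exact h1.trans (mul_le_mul_of_nonneg_left (Real.exp_le_exp.2 h2) (Real.cosh_pos _).le)

noncomputable def C2 : ℝ := ∫ z, Real.exp (-(1 / 8) * |z.1|) ∂mS

lemma C2_nonneg : 0 ≤ C2 := integral_nonneg fun _ => (Real.exp_pos _).le

lemma kR_odd (z : ℝ × ℝ) : kR 0 (-z) = -kR 0 z := by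
  simp only [kR, Dn, Prod.fst_neg, Prod.snd_neg, Real.cosh_neg, Real.cos_neg, Real.sin_neg]
  ring

lemma flux_bound {θ : ℝ → ℝ → ℝ} {M D ε R : ℝ} {ψ1 ψ2 : ℝ → ℝ} (hD : 0 ≤ D) (hε : 0 ≤ ε)
    (hε8 : ε ≤ 1 / 8)
    (cθ : Continuous (fun x : ℝ × ℝ => θ x.1 x.2)) (hp : ∀ a b, θ a (b + 2 * π) = θ a b)
    (h0 : ∀ a b, 0 ≤ θ a b) (hM : ∀ a b, θ a b ≤ M)
    (hJ : Integrable (fun x : ℝ × ℝ => Real.cosh (ε * x.1) * θ x.1 x.2) mS)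
    (hd : ∀ x, HasDerivAt ψ1 (ψ2 x) x) (hb : ∀ x, |ψ2 x| ≤ D * Real.cosh (ε * x))
    (z1 : ∀ x, R < |x| → ψ1 x = 0) :
    ∫ x, ψ1 x.1 * (conv (kR 0) θ x.1 x.2 * θ x.1 x.2) ∂mS ≤
      1 / 2 * D * M * C2 * ∫ x, Real.cosh (ε * x.1) * θ x.1 x.2 ∂mS := by
  have c1 := cont_of_deriv hd
  have hM0 : 0 ≤ M := (h0 0 0).trans (hM 0 0)
  have hab : ∀ a b, |θ a b| ≤ M := fun a b => by rw [abs_of_nonneg (h0 a b)]; exact hM a b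
  have sw1 := fun x : ℝ × ℝ => conv_swap (kR_meas 0) (kR_per 0) m1_int kR_m1 cθ hp x.1 x.2
    (fun z _ => hab _ _)
  have hκm : Measurable (fun z => |kR 0 z|) := (kR_meas 0).abs
  have sw2 := fun x : ℝ × ℝ => conv_swap (κ := fun z => |kR 0 z|) hκm
    (fun a b => by simp only [kR_per 0 a b]) m1_int (fun z => by rw [abs_abs]; exact kR_m1 z) cθ hp
    x.1 x.2 (fun z _ => hab _ _)
  have cc2 : Continuous (fun x : ℝ × ℝ => conv (fun z => |kR 0 z|) θ x.1 x.2) :=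
    conv_cont2 hκm m1_int (fun z => by rw [abs_abs]; exact kR_m1 z) cθ hab
  set Φ : (ℝ × ℝ) × (ℝ × ℝ) → ℝ := fun w =>
    ψ1 w.1.1 * θ w.1.1 w.1.2 * (kR 0 (w.1.1 - w.2.1, w.1.2 - w.2.2) * θ w.2.1 w.2.2) with hΦ
  have mΦ : Measurable Φ := by
    have a1 : Measurable fun w : (ℝ × ℝ) × (ℝ × ℝ) => kR 0 (w.1.1 - w.2.1, w.1.2 - w.2.2) :=
      (kR_meas 0).comp (by fun_prop)
    have a2 : Continuous fun w : (ℝ × ℝ) × (ℝ × ℝ) => ψ1 w.1.1 * θ w.1.1 w.1.2 :=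
      (c1.comp (by fun_prop)).mul (cθ.comp continuous_fst)
    have a3 : Continuous fun w : (ℝ × ℝ) × (ℝ × ℝ) => θ w.2.1 w.2.2 := cθ.comp continuous_snd
    exact a2.measurable.mul (a1.mul a3.measurable)
  have iΦ : Integrable Φ (mS.prod mS) := by
    rw [integrable_prod_iff mΦ.aestronglyMeasurable]
    refine ⟨Filter.Eventually.of_forall fun x => (sw1 x).1.const_mul (ψ1 x.1 * θ x.1 x.2), ?_⟩
    have e : (fun x => ∫ y, ‖Φ (x, y)‖ ∂mS) = fun x : ℝ × ℝ =>
        |ψ1 x.1| * θ x.1 x.2 * conv (fun z => |kR 0 z|) θ x.1 x.2 := by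
      funext x
      rw [(sw2 x).2, ← integral_const_mul]
      congr 1; funext y
      simp only [hΦ, Real.norm_eq_abs, abs_mul, abs_of_nonneg (h0 _ _)]
    rw [e]
    exact cs_int (R := R) (by fun_prop) (fun x hx => by simp [z1 _ hx])
  have I1 : ∫ w, Φ w ∂(mS.prod mS) =
      ∫ x, ψ1 x.1 * (conv (kR 0) θ x.1 x.2 * θ x.1 x.2) ∂mS := by
    rw [integral_prod _ iΦ]
    congr 1; funext x
    simp only [hΦ]
    rw [integral_const_mul, ← (sw1 x).2]; ring
  have I2 : ∫ w, Φ w.swap ∂(mS.prod mS) = ∫ w, Φ w ∂(mS.prod mS) := integral_prod_swap Φ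
  have iΦs : Integrable (fun w => Φ w.swap) (mS.prod mS) := iΦ.swap
  set B : (ℝ × ℝ) × (ℝ × ℝ) → ℝ := fun w =>
    D * M * (Real.cosh (ε * w.1.1) * θ w.1.1 w.1.2) * Real.exp (-(1 / 8) * |w.1.1 - w.2.1|) with hB
  have hei : Integrable (fun z : ℝ × ℝ => Real.exp (-(1 / 8) * |z.1|)) mS :=
    int_exp_mS _ (by norm_num)
  have hem : Measurable (fun z : ℝ × ℝ => Real.exp (-(1 / 8) * |z.1|)) :=
    Continuous.measurable (by fun_prop)
  have hes := fun x : ℝ × ℝ => shift_integrable hem (fun a b => rfl) hei x.1 x.2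
  have hev := fun x : ℝ × ℝ => shift_integral hem (fun a b => rfl) hei x.1 x.2
  have iB : Integrable B (mS.prod mS) := by
    have mB : Continuous B := by
      have a3 : Continuous fun w : (ℝ × ℝ) × (ℝ × ℝ) => θ w.1.1 w.1.2 := cθ.comp continuous_fst
      simp only [hB]; fun_prop
    rw [integrable_prod_iff mB.aestronglyMeasurable]
    refine ⟨Filter.Eventually.of_forall fun x => (hes x).const_mul (D * M * (Real.cosh (ε * x.1) * θ x.1 x.2)), ?_⟩
    have e : (fun x => ∫ y, ‖B (x, y)‖ ∂mS) = fun x : ℝ × ℝ =>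
        D * M * C2 * (Real.cosh (ε * x.1) * θ x.1 x.2) := by
      funext x
      have : ∀ y, ‖B (x, y)‖ = D * M * (Real.cosh (ε * x.1) * θ x.1 x.2) *
          Real.exp (-(1 / 8) * |x.1 - y.1|) := by
        intro y
        have h1 := h0 x.1 x.2
        have h2 := (Real.cosh_pos (ε * x.1)).le
        rw [Real.norm_eq_abs, abs_of_nonneg]
        simp only [hB]; positivity
      simp only [this]
      rw [integral_const_mul]
      have h3 := hev x
      simp only at h3
      rw [h3]; unfold C2; ring
    rw [e]
    exact hJ.const_mul _
  have IB : ∫ w, B w ∂(mS.prod mS) = D * M * C2 * ∫ x, Real.cosh (ε * x.1) * θ x.1 x.2 ∂mS := by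
    rw [integral_prod _ iB, ← integral_const_mul]
    congr 1; funext x
    simp only [hB]
    rw [integral_const_mul]
    have h3 := hev x
    simp only at h3
    rw [h3]; unfold C2; ring
  have hle : ∫ w, (Φ w + Φ w.swap) ∂(mS.prod mS) ≤ ∫ w, B w ∂(mS.prod mS) := by
    refine integral_mono (iΦ.add iΦs) iB ?_
    rintro ⟨x, y⟩
    have ho : kR 0 (y.1 - x.1, y.2 - x.2) = -kR 0 (x.1 - y.1, x.2 - y.2) := by
      rw [← kR_odd]; congr 1; ext <;> simp
    have hs := kR_sym_bound (x.1 - y.1, x.2 - y.2)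
    have hm := mv_bound hD hε hd hb x.1 y.1
    simp only at hs
    have e1 : Φ (x, y) + Φ (x, y).swap = (ψ1 x.1 - ψ1 y.1) * kR 0 (x.1 - y.1, x.2 - y.2) *
        (θ x.1 x.2 * θ y.1 y.2) := by
      simp only [hΦ, Prod.swap, ho]; ring
    simp only [e1, hB]
    set d := |x.1 - y.1|
    set k := kR 0 (x.1 - y.1, x.2 - y.2)
    have hd0 : 0 ≤ d := abs_nonneg _
    have hk : d * |k| ≤ Real.exp (-(d / 4)) := by
      rw [Real.exp_neg, ← one_div, le_div_iff₀ (Real.exp_pos _)]; exact hs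
    have hc := (Real.cosh_pos (ε * x.1)).le
    have g1 : (ψ1 x.1 - ψ1 y.1) * k ≤
        D * Real.cosh (ε * x.1) * Real.exp (-(1 / 8) * d) := by
      calc (ψ1 x.1 - ψ1 y.1) * k ≤ |ψ1 x.1 - ψ1 y.1| * |k| := by
            rw [← abs_mul]; exact le_abs_self _
        _ ≤ (D * Real.cosh (ε * x.1) * Real.exp (ε * d) * d) * |k| :=
            mul_le_mul_of_nonneg_right hm (abs_nonneg _)
        _ = D * Real.cosh (ε * x.1) * Real.exp (ε * d) * (d * |k|) := by ring
        _ ≤ D * Real.cosh (ε * x.1) * Real.exp (ε * d) * Real.exp (-(d / 4)) := by gcongr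
        _ = D * Real.cosh (ε * x.1) * Real.exp (ε * d + -(d / 4)) := by rw [Real.exp_add]; ring
        _ ≤ _ := by gcongr; nlinarith
    have g2 : θ x.1 x.2 * θ y.1 y.2 ≤ θ x.1 x.2 * M :=
      mul_le_mul_of_nonneg_left (hM _ _) (h0 _ _)
    calc (ψ1 x.1 - ψ1 y.1) * k * (θ x.1 x.2 * θ y.1 y.2)
        ≤ (D * Real.cosh (ε * x.1) * Real.exp (-(1 / 8) * d)) * (θ x.1 x.2 * θ y.1 y.2) :=
          mul_le_mul_of_nonneg_right g1 (mul_nonneg (h0 _ _) (h0 _ _))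
      _ ≤ (D * Real.cosh (ε * x.1) * Real.exp (-(1 / 8) * d)) * (θ x.1 x.2 * M) :=
          mul_le_mul_of_nonneg_left g2 (by positivity)
      _ = _ := by ring
  rw [integral_add iΦ iΦs, I2, I1, IB] at hle
  linarith

lemma deriv_bound {ν M : ℝ} {th p q r : ℕ → ℝ → ℝ → ℝ → ℝ} {u2 : ℝ → ℝ → ℝ → ℝ}
    (S : Sol ν M th p q r u2) (hν : 0 < ν) (hM : 0 < M) {t : ℝ} (ht : 0 < t) {R D ε : ℝ}
    {ψ ψ1 ψ2 : ℝ → ℝ} (T : TF R ψ ψ1 ψ2) (hD : 0 ≤ D) (hε : 0 ≤ ε) (hε8 : ε ≤ 1 / 8)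
    (h0 : ∀ a b, 0 ≤ th 0 t a b)
    (hJ : Integrable (fun x : ℝ × ℝ => Real.cosh (ε * x.1) * th 0 t x.1 x.2) mS)
    (hb : ∀ x, |ψ2 x| ≤ D * Real.cosh (ε * x)) :
    ∃ d, HasDerivAt (fun t => ∫ x, th 0 t x.1 x.2 * ψ x.1 ∂mS) d t ∧
      d ≤ (ν + 1 / 2 * M * C2) * D * ∫ x, Real.cosh (ε * x.1) * th 0 t x.1 x.2 ∂mS := by
  refine ⟨_, weak_id S hν hM ht T, ?_⟩
  have F := S.fam t ht
  have f1 := flux_bound (θ := th 0 t) (M := M) hD hε hε8 (F.cont 0) (F.per 0) h0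
    (fun a b => (le_abs_self _).trans (F.bd a b)) hJ T.d2 hb T.z1
  have cθ := F.cont 0
  have c2 := T.c2
  have f2 : ∫ x, ψ2 x.1 * th 0 t x.1 x.2 ∂mS ≤
      D * ∫ x, Real.cosh (ε * x.1) * th 0 t x.1 x.2 ∂mS := by
    rw [← integral_const_mul]
    refine integral_mono (cs_int (R := R) (by fun_prop) (fun x hx => by simp [T.z2 _ hx]))
      (hJ.const_mul _) ?_
    intro x
    have := mul_le_mul_of_nonneg_right ((le_abs_self _).trans (hb x.1)) (h0 x.1 x.2)
    simp only; linarith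
  have f3 := mul_le_mul_of_nonneg_left f2 hν.le
  have f1' : ∫ x, ψ1 x.1 * (UU 1 (fun k => th k t) 0 x.1 x.2 * th 0 t x.1 x.2) ∂mS ≤
      1 / 2 * D * M * C2 * ∫ x, Real.cosh (ε * x.1) * th 0 t x.1 x.2 ∂mS := f1
  linarith


lemma abs_sinh_le_cosh (a : ℝ) : |Real.sinh a| ≤ Real.cosh a := by
  rw [abs_le]; have := Real.cosh_add_sinh a; have := Real.cosh_sub_sinh a
  have := Real.exp_pos a; have := Real.exp_pos (-a); constructor <;> linarith

lemma test_fn {ε n : ℝ} (hε : 0 ≤ ε) (hε8 : ε ≤ 1 / 8) (hn : 1 ≤ n) :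
    ∃ ψ1 ψ2, TF n (fun x => Real.cosh (ε * x) * bmp (x / n)) ψ1 ψ2 ∧
      ∀ x, |ψ2 x| ≤ (ε ^ 2 + 72 / n) * Real.cosh (ε * x) := by
  have hn0 : 0 < n := by linarith
  have dc : ∀ x, HasDerivAt (fun x => Real.cosh (ε * x)) (ε * Real.sinh (ε * x)) x := by
    intro x
    have := ((hasDerivAt_id x).const_mul ε).cosh
    refine this.congr_deriv ?_
    simp only [id]; ring
  have ds : ∀ x, HasDerivAt (fun x => Real.sinh (ε * x)) (ε * Real.cosh (ε * x)) x := by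
    intro x
    have := ((hasDerivAt_id x).const_mul ε).sinh
    refine this.congr_deriv ?_
    simp only [id]; ring
  have db : ∀ x, HasDerivAt (fun x => bmp (x / n)) (bmp1 (x / n) / n) x := by
    intro x
    have := (bmp_hasDerivAt (x / n)).comp x ((hasDerivAt_id x).div_const n)
    refine this.congr_deriv ?_
    ring
  have db1 : ∀ x, HasDerivAt (fun x => bmp1 (x / n)) (bmp2 (x / n) / n) x := by
    intro x
    have := (bmp1_hasDerivAt (x / n)).comp x ((hasDerivAt_id x).div_const n)
    refine this.congr_deriv ?_
    ring
  have hz : ∀ x, n < |x| → bph (x / n) = 0 := by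
    intro x hx
    apply bph_eq_zero
    rw [abs_div, abs_of_pos hn0, le_div_iff₀ hn0]; linarith
  have c0 := bmp_cont
  have c1 := bmp1_cont
  have c2 := bmp2_cont
  refine ⟨fun x => ε * Real.sinh (ε * x) * bmp (x / n) + Real.cosh (ε * x) * (bmp1 (x / n) / n),
    fun x => (ε * (ε * Real.cosh (ε * x)) * bmp (x / n) +
      ε * Real.sinh (ε * x) * (bmp1 (x / n) / n)) + (ε * Real.sinh (ε * x) * (bmp1 (x / n) / n) +
      Real.cosh (ε * x) * (bmp2 (x / n) / n / n)), ⟨?_, ?_, ?_, ?_, ?_, ?_⟩, ?_⟩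
  · intro x; exact (dc x).mul (db x)
  · intro x; exact (((ds x).const_mul ε).mul (db x)).add ((dc x).mul ((db1 x).div_const n))
  · fun_prop
  · intro x hx; simp [bmp, hz x hx]
  · intro x hx; simp [bmp, bmp1, hz x hx]
  · intro x hx; simp [bmp, bmp1, bmp2, hz x hx]
  · intro x
    simp only
    have hc := Real.cosh_pos (ε * x)
    have hs := abs_sinh_le_cosh (ε * x)
    have b0 : |bmp (x / n)| ≤ 1 := by rw [abs_of_nonneg (bmp_nonneg _)]; exact bmp_le_one _
    have b1 : |bmp1 (x / n)| ≤ 8 := by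
      have h1 := bmp1_abs (x / n)
      have h2 : bph (x / n) ^ 2 ≤ 1 := pow_le_one₀ (bph_nonneg _) (bph_le_one _)
      linarith
    have b2 := bmp2_abs (x / n)
    have hi : 0 < 1 / n := by positivity
    have hi1 : 1 / n ≤ 1 := (div_le_one hn0).2 hn
    set c := Real.cosh (ε * x)
    set s := Real.sinh (ε * x)
    have t1 : |ε * (ε * c) * bmp (x / n)| ≤ ε ^ 2 * c := by
      rw [abs_mul, abs_of_nonneg (by positivity : 0 ≤ ε * (ε * c))]
      have : 0 ≤ ε * (ε * c) := by positivity
      nlinarith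
    have t2 : |ε * s * (bmp1 (x / n) / n)| ≤ 8 / n * c := by
      have : ε * s * (bmp1 (x / n) / n) = (1 / n) * (ε * (s * bmp1 (x / n))) := by ring
      rw [this, abs_mul, abs_of_pos hi, abs_mul, abs_of_nonneg hε, abs_mul]
      have g : |s| * |bmp1 (x / n)| ≤ c * 8 := mul_le_mul hs b1 (abs_nonneg _) hc.le
      have g2 : ε * (|s| * |bmp1 (x / n)|) ≤ 1 * (c * 8) :=
        mul_le_mul (by linarith) g (by positivity) (by norm_num)
      have g3 := mul_le_mul_of_nonneg_left g2 hi.le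
      calc _ ≤ _ := g3
        _ = _ := by ring
    have t3 : |c * (bmp2 (x / n) / n / n)| ≤ 56 / n * c := by
      have : c * (bmp2 (x / n) / n / n) = (1 / n) * ((1 / n) * (c * bmp2 (x / n))) := by
        field_simp
      rw [this, abs_mul, abs_of_pos hi, abs_mul, abs_of_pos hi, abs_mul, abs_of_pos hc]
      have g : c * |bmp2 (x / n)| ≤ c * 56 := mul_le_mul_of_nonneg_left b2 hc.le
      have g2 : 1 / n * (c * |bmp2 (x / n)|) ≤ 1 * (c * 56) :=
        mul_le_mul hi1 g (by positivity) (by norm_num)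
      have g3 := mul_le_mul_of_nonneg_left g2 hi.le
      calc _ ≤ _ := g3
        _ = _ := by ring
    refine (abs_add_le _ _).trans ((add_le_add (abs_add_le _ _) (abs_add_le _ _)).trans ?_)
    calc _ ≤ (ε ^ 2 * c + 8 / n * c) + (8 / n * c + 56 / n * c) :=
          add_le_add (add_le_add t1 t2) (add_le_add t2 t3)
      _ = _ := by ring

lemma cosh_le_exp_abs (x : ℝ) : Real.cosh x ≤ Real.exp |x| := by
  have := cosh_shift 0 x
  simpa using this

section
variable {ν M : ℝ} {th p q r : ℕ → ℝ → ℝ → ℝ → ℝ} {u2 : ℝ → ℝ → ℝ → ℝ}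

lemma J_growth (S : Sol ν M th p q r u2) (hν : 0 < ν) (hM : 0 < M)
    (hcont : Continuous fun x : ℝ × (ℝ × ℝ) => th 0 x.1 x.2.1 x.2.2)
    (h0 : ∀ t, 0 ≤ t → ∀ a b, 0 ≤ th 0 t a b) {C κ : ℝ} (hC : 0 < C) (hκ : 0 ≤ κ)
    (hbar : ∀ t ≥ 0, ∀ a b, th 0 t a b ≤ C * Real.exp (κ * t) * Real.exp (-|a|))
    {ε : ℝ} (hε : 0 ≤ ε) (hε8 : ε ≤ 1 / 8) {t : ℝ} (ht : 0 ≤ t) :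
    Integrable (fun x : ℝ × ℝ => Real.cosh (ε * x.1) * th 0 t x.1 x.2) mS ∧
    ∫ x, Real.cosh (ε * x.1) * th 0 t x.1 x.2 ∂mS ≤
      (∫ x, Real.cosh (ε * x.1) * th 0 0 x.1 x.2 ∂mS) *
        Real.exp ((ν + 1 / 2 * M * C2) * ε ^ 2 * t) := by
  -- pointwise domination
  have dom : ∀ T, ∀ s ∈ Set.Icc 0 T, ∀ x : ℝ × ℝ, Real.cosh (ε * x.1) * th 0 s x.1 x.2 ≤
      C * Real.exp (κ * T) * Real.exp (-(1 / 2) * |x.1|) := by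
    intro T s hs x
    have h1 := hbar s hs.1 x.1 x.2
    have h2 : Real.cosh (ε * x.1) ≤ Real.exp ((1 / 2) * |x.1|) := by
      refine (cosh_le_exp_abs _).trans (Real.exp_le_exp.2 ?_)
      rw [abs_mul, abs_of_nonneg hε]
      exact mul_le_mul_of_nonneg_right (by linarith) (abs_nonneg _)
    have h3 : Real.exp (κ * s) ≤ Real.exp (κ * T) :=
      Real.exp_le_exp.2 (mul_le_mul_of_nonneg_left hs.2 hκ)
    calc _ ≤ Real.exp ((1 / 2) * |x.1|) * (C * Real.exp (κ * s) * Real.exp (-|x.1|)) :=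
          mul_le_mul h2 h1 (h0 s hs.1 _ _) (Real.exp_pos _).le
      _ ≤ Real.exp ((1 / 2) * |x.1|) * (C * Real.exp (κ * T) * Real.exp (-|x.1|)) := by gcongr
      _ = C * Real.exp (κ * T) * Real.exp ((1 / 2) * |x.1| + -|x.1|) := by
          rw [Real.exp_add]; ring
      _ = _ := by congr 2; ring
  have di : ∀ T, Integrable (fun x : ℝ × ℝ => C * Real.exp (κ * T) *
      Real.exp (-(1 / 2) * |x.1|)) mS := fun T => (int_exp_mS _ (by norm_num)).const_mul _
  have ct : ∀ s, Continuous fun x : ℝ × ℝ => th 0 s x.1 x.2 := fun s =>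
    hcont.comp (f := fun x : ℝ × ℝ => (s, x)) (by fun_prop)
  have cs : ∀ x : ℝ × ℝ, Continuous fun s => th 0 s x.1 x.2 := fun x =>
    hcont.comp (f := fun s : ℝ => (s, x)) (by fun_prop)
  have nn : ∀ s, 0 ≤ s → ∀ x : ℝ × ℝ, 0 ≤ Real.cosh (ε * x.1) * th 0 s x.1 x.2 := fun s hs x =>
    mul_nonneg (Real.cosh_pos _).le (h0 s hs _ _)
  have iJ : ∀ s, 0 ≤ s → Integrable (fun x : ℝ × ℝ => Real.cosh (ε * x.1) * th 0 s x.1 x.2) mS := by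
    intro s hs
    refine (di s).mono' (by have := ct s; fun_prop) (Filter.Eventually.of_forall fun x => ?_)
    rw [Real.norm_eq_abs, abs_of_nonneg (nn s hs x)]
    exact dom s s ⟨hs, le_rfl⟩ x
  refine ⟨iJ t ht, ?_⟩
  set J : ℝ → ℝ := fun s => ∫ x, Real.cosh (ε * x.1) * th 0 s x.1 x.2 ∂mS with hJ
  set c := ν + 1 / 2 * M * C2 with hc
  have hc0 : 0 ≤ c := by have := C2_nonneg; positivity
  -- continuity of J and of truncated J
  have contJ : ∀ T, ∀ χ : ℝ → ℝ, Continuous χ → (∀ x, 0 ≤ χ x) → (∀ x, χ x ≤ 1) →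
      ContinuousOn (fun s => ∫ x, th 0 s x.1 x.2 * (Real.cosh (ε * x.1) * χ x.1) ∂mS)
        (Set.Icc 0 T) := by
    intro T χ hχ χ0 χ1
    refine continuousOn_of_dominated (bound := fun x => C * Real.exp (κ * T) *
      Real.exp (-(1 / 2) * |x.1|)) ?_ ?_ (di T) ?_
    · intro s _; have := ct s; fun_prop
    · intro s hs
      refine Filter.Eventually.of_forall fun x => ?_
      have e : th 0 s x.1 x.2 * (Real.cosh (ε * x.1) * χ x.1) =
        (Real.cosh (ε * x.1) * th 0 s x.1 x.2) * χ x.1 := by ring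
      rw [e, Real.norm_eq_abs, abs_of_nonneg (mul_nonneg (nn s hs.1 x) (χ0 _))]
      exact (mul_le_of_le_one_right (nn s hs.1 x) (χ1 _)).trans (dom T s hs x)
    · refine Filter.Eventually.of_forall fun x => ?_
      exact ((cs x).mul continuous_const).continuousOn
  have cJ : ∀ T, ContinuousOn J (Set.Icc 0 T) := by
    intro T
    refine (contJ T (fun _ => 1) continuous_const (fun _ => zero_le_one) (fun _ => le_rfl)).congr ?_
    intro s _
    simp only [hJ]
    congr 1; funext x; ring
  have cJ' : ContinuousOn J (Set.Ici 0) := by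
    intro s hs
    have h := cJ (s + 1) s ⟨hs, by linarith⟩
    refine h.mono_of_mem_nhdsWithin ?_
    filter_upwards [self_mem_nhdsWithin, mem_nhdsWithin_of_mem_nhds (Iio_mem_nhds (lt_add_one s))]
      with y hy hy2 using ⟨hy, le_of_lt hy2⟩
  set Jc : ℝ → ℝ := fun s => J (max s 0) with hJc
  have cJc : Continuous Jc := cJ'.comp_continuous (by fun_prop) (fun s => Set.mem_Ici.2 (le_max_right s 0))
  have eJc : ∀ s, 0 ≤ s → Jc s = J s := fun s hs => by simp only [hJc, max_eq_left hs]
  set H : ℝ → ℝ := fun s => ∫ x in (0)..s, Jc x with hH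
  have dH : ∀ s, HasDerivAt H (Jc s) s := fun s =>
    intervalIntegral.integral_hasDerivAt_right (cJc.intervalIntegrable _ _)
      (cJc.stronglyMeasurableAtFilter _ _) cJc.continuousAt
  have H0 : H 0 = 0 := by simp [hH]
  -- truncated inequality
  have step : ∀ n : ℕ, ∀ s, 0 ≤ s →
      ∫ x, th 0 s x.1 x.2 * (Real.cosh (ε * x.1) * bmp (x.1 / ((n : ℝ) + 1))) ∂mS ≤
      J 0 + c * (ε ^ 2 + 72 / ((n : ℝ) + 1)) * H s := by
    intro n s hs
    have hn1 : (1 : ℝ) ≤ (n : ℝ) + 1 := by have := Nat.cast_nonneg (α := ℝ) n; linarith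
    obtain ⟨ψ1, ψ2, T, hb⟩ := test_fn hε hε8 hn1
    set N : ℝ := (n : ℝ) + 1
    have hD : 0 ≤ ε ^ 2 + 72 / N := by positivity
    set D := ε ^ 2 + 72 / N
    set Jn : ℝ → ℝ := fun s => ∫ x, th 0 s x.1 x.2 * (Real.cosh (ε * x.1) * bmp (x.1 / N)) ∂mS
      with hJn
    have cb := bmp_cont
    have cJn : ContinuousOn Jn (Set.Icc 0 s) := contJ s (fun x => bmp (x / N)) (by fun_prop)
      (fun x => bmp_nonneg _) (fun x => bmp_le_one _)
    have cH : Continuous H := cont_of_deriv dH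
    have dv : ∀ y ∈ Set.Ioo 0 s, ∃ d, HasDerivAt Jn d y ∧ d ≤ c * D * Jc y := by
      intro y hy
      obtain ⟨d, h1, h2⟩ := deriv_bound S hν hM hy.1 T hD hε hε8 (h0 y hy.1.le) (iJ y hy.1.le) hb
      refine ⟨d, h1, ?_⟩
      rw [eJc y hy.1.le]; exact h2
    have anti : AntitoneOn (fun y => Jn y - c * D * H y) (Set.Icc 0 s) := by
      refine antitoneOn_of_deriv_nonpos (convex_Icc _ _) (by fun_prop) ?_ ?_
      · intro y hy
        rw [interior_Icc] at hy
        obtain ⟨d, h1, h2⟩ := dv y hy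
        exact (h1.sub ((dH y).const_mul _)).differentiableAt.differentiableWithinAt
      · intro y hy
        rw [interior_Icc] at hy
        obtain ⟨d, h1, h2⟩ := dv y hy
        have := (h1.sub ((dH y).const_mul (c * D))).deriv
        have e : deriv (fun y => Jn y - c * D * H y) y = d - c * D * Jc y := this
        rw [e]; linarith
    have h := anti (Set.left_mem_Icc.2 hs) (Set.right_mem_Icc.2 hs) hs
    simp only [H0, mul_zero, sub_zero] at h
    have hn0 : Jn 0 ≤ J 0 := by
      refine integral_mono_of_nonneg (Filter.Eventually.of_forall fun x => ?_) (iJ 0 le_rfl)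
        (Filter.Eventually.of_forall fun x => ?_)
      · exact mul_nonneg (h0 0 le_rfl _ _) (mul_nonneg (Real.cosh_pos _).le (bmp_nonneg _))
      · have e : th 0 0 x.1 x.2 * (Real.cosh (ε * x.1) * bmp (x.1 / N)) =
          (Real.cosh (ε * x.1) * th 0 0 x.1 x.2) * bmp (x.1 / N) := by ring
        simp only [e]
        exact mul_le_of_le_one_right (nn 0 le_rfl x) (bmp_le_one _)
    have : Jn s ≤ J 0 + c * D * H s := by linarith
    exact this
  have lim0 : Filter.Tendsto (fun n : ℕ => 1 / ((n : ℝ) + 1)) Filter.atTop (nhds 0) :=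
    tendsto_one_div_add_atTop_nhds_zero_nat
  have main : ∀ s, 0 ≤ s → J s ≤ J 0 + c * ε ^ 2 * H s := by
    intro s hs
    have l1 : Filter.Tendsto (fun n : ℕ => ∫ x, th 0 s x.1 x.2 *
        (Real.cosh (ε * x.1) * bmp (x.1 / ((n : ℝ) + 1))) ∂mS) Filter.atTop (nhds (J s)) := by
      refine tendsto_integral_of_dominated_convergence
        (fun x => Real.cosh (ε * x.1) * th 0 s x.1 x.2) ?_ (iJ s hs) ?_ ?_
      · intro n; have := ct s; have := bmp_cont; fun_prop
      · intro n
        refine Filter.Eventually.of_forall fun x => ?_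
        have e : th 0 s x.1 x.2 * (Real.cosh (ε * x.1) * bmp (x.1 / ((n : ℝ) + 1))) =
          (Real.cosh (ε * x.1) * th 0 s x.1 x.2) * bmp (x.1 / ((n : ℝ) + 1)) := by ring
        rw [e, Real.norm_eq_abs, abs_of_nonneg (mul_nonneg (nn s hs x) (bmp_nonneg _))]
        exact mul_le_of_le_one_right (nn s hs x) (bmp_le_one _)
      · refine Filter.Eventually.of_forall fun x => ?_
        have h1 : Filter.Tendsto (fun n : ℕ => x.1 / ((n : ℝ) + 1)) Filter.atTop (nhds 0) := by
          have := lim0.const_mul x.1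
          simpa [div_eq_mul_inv] using this
        have h2 := (bmp_cont.tendsto 0).comp h1
        have h3 : bmp 0 = 1 := by simp [bmp, bph]
        rw [h3] at h2
        have h4 := (h2.const_mul (Real.cosh (ε * x.1))).const_mul (th 0 s x.1 x.2)
        rw [mul_one, mul_comm (th 0 s x.1 x.2) (Real.cosh _)] at h4
        exact h4
    have l2 : Filter.Tendsto (fun n : ℕ => J 0 + c * (ε ^ 2 + 72 / ((n : ℝ) + 1)) * H s)
        Filter.atTop (nhds (J 0 + c * ε ^ 2 * H s)) := by
      have := ((((lim0.const_mul 72).const_add (ε ^ 2)).const_mul c).mul_const (H s)).const_add (J 0)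
      simpa [div_eq_mul_inv] using this
    exact le_of_tendsto_of_tendsto' l1 l2 (fun n => step n s hs)
  -- Gronwall
  set k := c * ε ^ 2 with hk
  have hk0 : 0 ≤ k := by positivity
  have dg : ∀ y, HasDerivAt (fun y => (J 0 + k * H y) * Real.exp (-(k * y)))
      (k * Jc y * Real.exp (-(k * y)) + (J 0 + k * H y) * (Real.exp (-(k * y)) * (-(k * 1)))) y :=
    fun y => (((dH y).const_mul k).const_add (J 0)).mul (((hasDerivAt_id y).const_mul k).neg.exp)
  have anti : AntitoneOn (fun y => (J 0 + k * H y) * Real.exp (-(k * y))) (Set.Icc 0 t) := by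
    refine antitoneOn_of_deriv_nonpos (convex_Icc _ _) (cont_of_deriv dg).continuousOn
      (fun y _ => (dg y).differentiableAt.differentiableWithinAt) ?_
    intro y hy
    rw [interior_Icc] at hy
    rw [(dg y).deriv]
    have h1 := main y hy.1.le
    rw [← eJc y hy.1.le] at h1
    have h2 := mul_le_mul_of_nonneg_left h1 (mul_nonneg hk0 (Real.exp_pos (-(k * y))).le)
    linarith
  have h := anti (Set.left_mem_Icc.2 ht) (Set.right_mem_Icc.2 ht) ht
  simp only [H0, mul_zero, add_zero, neg_zero, Real.exp_zero, mul_one] at h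
  rw [Real.exp_neg, ← div_eq_mul_inv, div_le_iff₀ (Real.exp_pos _)] at h
  exact (main t ht).trans h
end


lemma tail_bound {θ : ℝ × ℝ → ℝ} {ε R : ℝ} (h0 : ∀ x, 0 ≤ θ x) (hε : 0 ≤ ε)
    (hi : IntegrableOn θ strip)
    (hJ : Integrable (fun x : ℝ × ℝ => Real.cosh (ε * x.1) * θ x) mS) :
    ∫ y in {y : ℝ × ℝ | R < |y.1|} ∩ strip, θ y ≤
      2 * Real.exp (-(ε * R)) * ∫ x, Real.cosh (ε * x.1) * θ x ∂mS := by
  have hA : MeasurableSet {y : ℝ × ℝ | R < |y.1|} :=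
    measurableSet_lt measurable_const (by fun_prop)
  have e : (volume.restrict ({y : ℝ × ℝ | R < |y.1|} ∩ strip) : Measure (ℝ × ℝ)) =
      mS.restrict {y : ℝ × ℝ | R < |y.1|} := by
    rw [mS, Measure.restrict_restrict hA]
  have hi' : Integrable θ mS := hi
  rw [e, ← integral_const_mul]
  have hJ2 := hJ.const_mul (2 * Real.exp (-(ε * R)))
  have hn : ∀ x : ℝ × ℝ, 0 ≤ 2 * Real.exp (-(ε * R)) * (Real.cosh (ε * x.1) * θ x) := fun x =>
    mul_nonneg (by positivity) (mul_nonneg (Real.cosh_pos _).le (h0 x))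
  refine le_trans ?_ (setIntegral_le_integral (s := {y : ℝ × ℝ | R < |y.1|}) hJ2 (Filter.Eventually.of_forall hn))
  refine setIntegral_mono_on hi'.integrableOn hJ2.integrableOn hA ?_
  intro x hx
  have hx' : R < |x.1| := hx
  have h1 : Real.exp (ε * R) ≤ 2 * Real.cosh (ε * x.1) := by
    have a1 : Real.exp (ε * R) ≤ Real.exp |ε * x.1| := by
      apply Real.exp_le_exp.2
      rw [abs_mul, abs_of_nonneg hε]
      exact mul_le_mul_of_nonneg_left hx'.le hε
    have a2 : Real.exp |ε * x.1| ≤ 2 * Real.cosh |ε * x.1| := by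
      rw [Real.cosh_eq]; have := Real.exp_pos (-|ε * x.1|); linarith
    rw [Real.cosh_abs] at a2
    linarith
  have h2 : 1 ≤ 2 * Real.exp (-(ε * R)) * Real.cosh (ε * x.1) := by
    have := mul_le_mul_of_nonneg_left h1 (Real.exp_pos (-(ε * R))).le
    rw [← Real.exp_add, neg_add_cancel, Real.exp_zero] at this
    linarith
  have := mul_le_mul_of_nonneg_right h2 (h0 x)
  linarith

lemma asymp {c A ℓ α : ℝ} (hc : 0 < c) (hA : 0 ≤ A) (hℓ : 0 < ℓ) (hα : 1 < α) :
    ∃ T : ℝ, ∀ t ≥ T, 1 < t ∧ Real.log t ^ α ≤ c ^ 2 / 16 * t ∧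
      2 * A * Real.exp (-(Real.log t ^ α / (4 * c))) ≤ t ^ (-ℓ) := by
  have h1 : ∀ᶠ t : ℝ in Filter.atTop, Real.log t ^ α ≤ c ^ 2 / 16 * t := by
    have h := (isLittleO_log_rpow_rpow_atTop α one_pos).def (by positivity : 0 < c ^ 2 / 16)
    filter_upwards [h, Filter.eventually_gt_atTop 1] with t ht ht1
    rw [Real.rpow_one, Real.norm_eq_abs, Real.norm_eq_abs, abs_of_pos (by linarith : 0 < t)] at ht
    exact (le_abs_self _).trans ht
  have h2 : ∀ᶠ t : ℝ in Filter.atTop, 4 * c * (2 * A + ℓ) ≤ Real.log t ^ (α - 1) :=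
    ((tendsto_rpow_atTop (by linarith : 0 < α - 1)).comp Real.tendsto_log_atTop).eventually_ge_atTop _
  have h3 : ∀ᶠ t : ℝ in Filter.atTop, 1 ≤ Real.log t :=
    Real.tendsto_log_atTop.eventually_ge_atTop _
  obtain ⟨T, hT⟩ := Filter.eventually_atTop.1
    (h1.and (h2.and (h3.and (Filter.eventually_gt_atTop 1))))
  refine ⟨T, fun t ht => ?_⟩
  obtain ⟨g1, g2, g3, g4⟩ := hT t ht
  refine ⟨g4, g1, ?_⟩
  have hs : 0 < Real.log t := by linarith
  rw [Real.rpow_def_of_pos (by linarith : 0 < t)]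
  set s := Real.log t
  have hp : s ^ α = s ^ (α - 1) * s := by
    rw [Real.rpow_sub hs, Real.rpow_one, div_mul_cancel₀ _ hs.ne']
  have hb : (2 * A + ℓ) * s ≤ s ^ α / (4 * c) := by
    rw [le_div_iff₀ (by positivity), hp]
    nlinarith
  have h2A : 2 * A ≤ Real.exp (2 * A) := by have := Real.add_one_le_exp (2 * A); linarith
  calc 2 * A * Real.exp (-(s ^ α / (4 * c))) ≤
      Real.exp (2 * A) * Real.exp (-(s ^ α / (4 * c))) :=
        mul_le_mul_of_nonneg_right h2A (Real.exp_pos _).le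
    _ = Real.exp (2 * A + -(s ^ α / (4 * c))) := by rw [Real.exp_add]
    _ ≤ _ := by apply Real.exp_le_exp.2; nlinarith

/-- Confinement of vorticity for Navier–Stokes on the cylinder: if `ω` is the vorticity
of a solution with viscosity `ν > 0` and nonnegative, bounded, compactly supported
initial vorticity, then for each `ℓ > 0` and `α > 1` the vorticity mass in the region
`|y₁| > sqrt(t (log t)^α)` is eventually bounded by `t^{-ℓ}`. -/
theorem navier_stokes_confinement_log
    (ν : ℝ) (hν : 0 < ν) (ω : ℝ → ℝ × ℝ → ℝ) (u : ℝ → ℝ × ℝ → ℝ × ℝ)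
    -- regularity: continuous up to `t = 0`, smooth for `t > 0`
    (hcont : Continuous fun p : ℝ × (ℝ × ℝ) => ω p.1 p.2)
    (hsmooth : ContDiffOn ℝ (⊤ : ℕ∞) (fun p : ℝ × (ℝ × ℝ) => ω p.1 p.2)
      {p : ℝ × (ℝ × ℝ) | 0 < p.1})
    -- periodicity in the second spatial variable
    (hper : ∀ t x1 x2, ω t (x1, x2 + 2 * Real.pi) = ω t (x1, x2))
    -- the initial vorticity is nonnegative, bounded and compactly supported
    (M : ℝ) (hM : 0 < M) (hω₀nonneg : ∀ x, 0 ≤ ω 0 x) (hω₀bdd : ∀ x, ω 0 x ≤ M)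
    (Cb : ℝ) (hCb : 0 < Cb) (hsupp : ∀ x : ℝ × ℝ, ω 0 x ≠ 0 → |x.1| ≤ Cb)
    -- the vorticity equation `∂ₜω + u·∇ω = νΔω` for `t > 0`
    (hPDE : ∀ t > (0 : ℝ), ∀ x : ℝ × ℝ,
      deriv (fun s => ω s x) t
        + (u t x).1 * deriv (fun a => ω t (a, x.2)) x.1
        + (u t x).2 * deriv (fun b => ω t (x.1, b)) x.2
      = ν * (deriv (deriv (fun a => ω t (a, x.2))) x.1
        + deriv (deriv (fun b => ω t (x.1, b))) x.2))
    -- incompressibility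
    (hdiv : ∀ t > (0 : ℝ), ∀ x : ℝ × ℝ,
      deriv (fun a => (u t (a, x.2)).1) x.1 + deriv (fun b => (u t (x.1, b)).2) x.2 = 0)
    -- cylindrical Biot–Savart law for the first velocity component
    (hBS : ∀ t > (0 : ℝ), ∀ x : ℝ × ℝ, (u t x).1 = ∫ y in strip, K x y * ω t y)
    -- properties of the solution (maximum principle, mass conservation, integrability)
    (hbounds : ∀ t ≥ (0 : ℝ), ∀ x, 0 ≤ ω t x ∧ ω t x ≤ M)
    (hint : ∀ t ≥ (0 : ℝ), IntegrableOn (ω t) strip)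
    (hmass : ∀ t ≥ (0 : ℝ), ∫ y in strip, ω t y = ∫ y in strip, ω 0 y) :
    ∀ ℓ > (0 : ℝ), ∀ α > (1 : ℝ), ∃ T : ℝ, ∀ t ≥ T,
      ∫ y in {y : ℝ × ℝ | Real.sqrt (t * Real.log t ^ α) < |y.1|} ∩ strip, ω t y ≤
        t ^ (-ℓ) := by
  intro ℓ hℓ α hα
  obtain ⟨th, p, q, r, S, hth⟩ := sol_mk hsmooth hper hM hPDE hdiv hBS hbounds
  have hc' : Continuous fun x : ℝ × (ℝ × ℝ) => th 0 x.1 x.2.1 x.2.2 := by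
    simp only [hth]; exact hcont
  obtain ⟨C, κ, hC, hκ, hbar⟩ := barrier S hν hM hc'
    (fun t a b => by simp only [hth, hper])
    (fun t ht a b => by rw [hth]; exact (hbounds t ht _).2) hCb
    (fun a b h => hsupp (a, b) (by rwa [hth] at h))
  set c := ν + 1 / 2 * M * C2 with hcdef
  have hc : 0 < c := by have := C2_nonneg; positivity
  set A := Real.cosh Cb * ∫ y, ω 0 y ∂mS with hAdef
  have hA : 0 ≤ A := mul_nonneg (Real.cosh_pos _).le (integral_nonneg hω₀nonneg)
  obtain ⟨T, hT⟩ := asymp hc hA hℓ hα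
  refine ⟨T, fun t ht => ?_⟩
  obtain ⟨t1, g1, g2⟩ := hT t ht
  have ht0 : 0 < t := by linarith
  set L := Real.log t ^ α
  have hL : 0 ≤ L := Real.rpow_nonneg (Real.log_nonneg t1.le) _
  set R := Real.sqrt (t * L) with hR
  have hR0 : 0 ≤ R := Real.sqrt_nonneg _
  have hR2 : R ^ 2 = t * L := Real.sq_sqrt (mul_nonneg ht0.le hL)
  set ε := R / (2 * c * t) with hεdef
  have hε : 0 ≤ ε := by positivity
  have hε8 : ε ≤ 1 / 8 := by
    rw [hεdef, div_le_iff₀ (by positivity)]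
    have : R ≤ c * t / 4 := by
      rw [hR]; apply Real.sqrt_le_iff.2 ⟨by positivity, ?_⟩
      have := mul_le_mul_of_nonneg_left g1 ht0.le
      calc _ ≤ _ := this
        _ = _ := by ring
    linarith
  obtain ⟨iJ, hJ⟩ := J_growth S hν hM hc'
    (fun t ht a b => by rw [hth]; exact (hbounds t ht _).1) hC hκ hbar hε hε8 ht0.le
  obtain ⟨iJ0, -⟩ := J_growth S hν hM hc'
    (fun t ht a b => by rw [hth]; exact (hbounds t ht _).1) hC hκ hbar hε hε8 le_rfl
  simp only [hth, Prod.mk.eta] at iJ hJ iJ0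
  have hJ0 : ∫ x, Real.cosh (ε * x.1) * ω 0 x ∂mS ≤ A := by
    rw [hAdef, ← integral_const_mul]
    refine integral_mono iJ0 ((show Integrable (ω 0) mS from hint 0 le_rfl).const_mul _) ?_
    intro x
    by_cases h : ω 0 x = 0
    · simp [h]
    · have hx := hsupp x h
      refine mul_le_mul_of_nonneg_right ?_ (hω₀nonneg x)
      rw [Real.cosh_le_cosh, abs_mul, abs_of_nonneg hε, abs_of_pos hCb]
      nlinarith [abs_nonneg x.1]
  have hb := tail_bound (R := R) (fun x => (hbounds t ht0.le x).1) hε (hint t ht0.le) iJ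
  refine hb.trans (le_trans ?_ g2)
  have k1 := hJ.trans (mul_le_mul_of_nonneg_right hJ0 (Real.exp_pos _).le)
  have k2 := mul_le_mul_of_nonneg_left k1 (by positivity : 0 ≤ 2 * Real.exp (-(ε * R)))
  refine k2.trans (le_of_eq ?_)
  have e : -(L / (4 * c)) = -(ε * R) + c * ε ^ 2 * t := by
    have : L = R ^ 2 / t := by rw [hR2]; field_simp
    rw [this, hεdef]; field_simp; ring
  rw [e, Real.exp_add]; ring
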